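/- Let C > 0 be arbitrary and let A₂ = ∏_p (1 + ((1 − 1/p)² − 1)/(p − 1)), the product being over all primes p. Then there is a constant K (depending only on C) such that for all x ≥ 2, |Σ_{p ≤ x} F_{g PR, h RPPR}(p)/(p-1) − A₂ · Li(x)| ≤ K · x / (log x)^C, where the sum is over primes p ≤ x. -/

import Mathlib

namespace FixPt
open Complex MeasureTheory Finset Set Filter Topology DirichletCharacter

/-- density of a character -/
noncomputable def dl {q : ℕ} (χ : DirichletCharacter ℂ q) : ℂ :=
  open Classical in if χ = 1 then ((Nat.totient q : ℂ) / (q : ℂ)) else 0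

noncomputable def SS {q : ℕ} (χ : DirichletCharacter ℂ q) (N : ℕ) (M : ℕ) : ℂ :=
  ∑ n ∈ Finset.Ioc N M, χ (n : ZMod q)

lemma norm_chi_le {q : ℕ} (χ : DirichletCharacter ℂ q) (n : ℕ) : ‖χ (n : ZMod q)‖ ≤ 1 :=
  DirichletCharacter.norm_le_one χ _

lemma norm_dl_le {q : ℕ} [NeZero q] (χ : DirichletCharacter ℂ q) : ‖dl χ‖ ≤ 1 := by
  unfold dl
  split_ifs
  · rw [norm_div, Complex.norm_natCast, Complex.norm_natCast]
    have := Nat.totient_le q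
    apply div_le_one_of_le₀ (by exact_mod_cast this) (by positivity)
  · simp

lemma sum_period {q : ℕ} [NeZero q] (χ : DirichletCharacter ℂ q) (M : ℕ) :
    ∑ n ∈ Finset.range q, χ ((M + n : ℕ) : ZMod q) = dl χ * q := by
  have hq : (q : ℂ) ≠ 0 := by exact_mod_cast NeZero.ne q
  have h1 : ∑ n ∈ Finset.range q, χ ((M + n : ℕ) : ZMod q) = ∑ a : ZMod q, χ a := by
    have e : ∑ a : ZMod q, χ a = ∑ a : ZMod q, χ ((M : ZMod q) + a) :=
      (Equiv.sum_comp (Equiv.addLeft (M : ZMod q)) (fun a => χ a)).symm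
    rw [e]
    symm
    refine Finset.sum_bij' (fun a _ => a.val) (fun n _ => (n : ZMod q)) ?_ ?_ ?_ ?_ ?_
    · intro a _; simpa using ZMod.val_lt a
    · intro a _; simp
    · intro a _; simp
    · intro a ha; simpa using Nat.mod_eq_of_lt (by simpa using ha)
    · intro a _; simp
  rw [h1]
  unfold dl
  split_ifs with h
  · subst h
    rw [div_mul_cancel₀ _ hq, MulChar.sum_one_eq_card_units, ZMod.card_units_eq_totient]
  · rw [zero_mul, MulChar.sum_eq_zero_of_ne_one h]

lemma SS_bound {q : ℕ} [NeZero q] (χ : DirichletCharacter ℂ q) (N m : ℕ) :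
    ‖SS χ N (N + m) - dl χ * m‖ ≤ 2 * q := by
  have hq : 0 < q := NeZero.pos q
  induction m using Nat.strong_induction_on with
  | _ m ih =>
    by_cases h : m < q
    · have h2 : ‖SS χ N (N + m)‖ ≤ m := by
        refine (norm_sum_le _ _).trans ?_
        refine (Finset.sum_le_sum (fun n _ => norm_chi_le χ n)).trans ?_
        simp
      have h3 : ‖dl χ * m‖ ≤ m := by
        rw [norm_mul, Complex.norm_natCast]
        exact mul_le_of_le_one_left (by positivity) (norm_dl_le χ)
      have h4 : (m : ℝ) ≤ q := by exact_mod_cast h.le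
      exact (norm_sub_le _ _).trans (by linarith)
    · push Not at h
      have := ih (m - q) (by omega)
      have e : SS χ N (N + m) = SS χ N (N + (m - q)) + dl χ * q := by
        rw [← sum_period χ (N + (m - q) + 1)]
        unfold SS
        rw [← Finset.sum_Ioc_consecutive _ (by omega : N ≤ N + (m - q)) (by omega : N + (m-q) ≤ N + m)]
        congr 1
        have eI : Finset.Ioc (N + (m - q)) (N + m) = Finset.Ico (N + (m - q) + 1) (N + m + 1) := by
          ext; simp
        rw [eI, Finset.sum_Ico_eq_sum_range]
        congr 1
        congr 1
        omega
      have e2 : (m : ℂ) = ((m - q : ℕ) : ℂ) + q := by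
        push_cast [Nat.cast_sub h]; ring
      rw [e, e2]
      convert this using 2
      ring

/-- the bounded remainder in the partial sums -/
noncomputable def bb {q : ℕ} (χ : DirichletCharacter ℂ q) (N : ℕ) (u : ℝ) : ℂ :=
  if (N : ℝ) < u then SS χ N ⌊u⌋₊ - dl χ * ((u : ℂ) - N) else 0

lemma bb_bound {q : ℕ} [NeZero q] (χ : DirichletCharacter ℂ q) (N : ℕ) (u : ℝ) :
    ‖bb χ N u‖ ≤ 3 * q := by
  have hq : (1 : ℝ) ≤ q := by exact_mod_cast NeZero.pos q
  unfold bb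
  split_ifs with h
  · have hu : 0 ≤ u := (Nat.cast_nonneg N).trans h.le
    have hN : N ≤ ⌊u⌋₊ := Nat.le_floor h.le
    have h1 := SS_bound χ N (⌊u⌋₊ - N)
    rw [Nat.add_sub_cancel' hN] at h1
    have e : SS χ N ⌊u⌋₊ - dl χ * ((u : ℂ) - N) =
        (SS χ N ⌊u⌋₊ - dl χ * ((⌊u⌋₊ - N : ℕ) : ℂ)) - dl χ * (((u - ⌊u⌋₊ : ℝ)) : ℂ) := by
      push_cast [Nat.cast_sub hN]; ring
    rw [e]
    have h2 : ‖dl χ * (((u - ⌊u⌋₊ : ℝ)) : ℂ)‖ ≤ 1 := by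
      rw [norm_mul, Complex.norm_real, Real.norm_eq_abs]
      have a1 := Nat.floor_le hu
      have a2 := Nat.lt_floor_add_one u
      have : |u - ⌊u⌋₊| ≤ 1 := by rw [abs_le]; constructor <;> linarith
      exact mul_le_one₀ (norm_dl_le χ) (abs_nonneg _) this
    exact (norm_sub_le _ _).trans (by linarith)
  · simp; 

lemma bb_measurable {q : ℕ} (χ : DirichletCharacter ℂ q) (N : ℕ) : Measurable (bb χ N) := by
  unfold bb
  refine Measurable.ite measurableSet_Ioi ?_ measurable_const
  refine Measurable.sub ?_ ?_
  · exact (measurable_from_top (f := SS χ N)).comp Nat.measurable_floor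
  · fun_prop

noncomputable def JJ {q : ℕ} (χ : DirichletCharacter ℂ q) (N : ℕ) (s : ℂ) : ℂ := mellin (bb χ N) (-s)

lemma JJ_diff {q : ℕ} [NeZero q] (χ : DirichletCharacter ℂ q) (N : ℕ) (hN : 1 ≤ N) {s : ℂ} (hs : 0 < s.re) :
    DifferentiableAt ℂ (JJ χ N) s := by
  have hb : ∀ C : ℝ, ∀ᶠ u : ℝ in 𝓝[>] 0, bb χ N u = 0 := by
    intro C
    have : ∀ᶠ u : ℝ in 𝓝[>] 0, u < 1 := (eventually_lt_nhds (by norm_num)).filter_mono nhdsWithin_le_nhds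
    filter_upwards [this] with u hu
    unfold bb
    rw [if_neg]
    have : (1 : ℝ) ≤ N := by exact_mod_cast hN
    linarith
  have h := mellin_differentiableAt_of_isBigO_rpow (E := ℂ) (a := 0) (b := (-s).re - 1) (f := bb χ N) (s := -s)
    ?_ ?_ (by simpa using hs) ?_ (by linarith)
  · exact DifferentiableAt.comp s h differentiableAt_id.neg
  · refine LocallyIntegrable.locallyIntegrableOn ?_ _
    refine (locallyIntegrable_const (3 * q : ℝ)).mono (bb_measurable χ N).aestronglyMeasurable ?_
    refine Eventually.of_forall fun u => ?_
    rw [Real.norm_of_nonneg (by positivity)]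
    exact bb_bound χ N u
  · simp only [neg_zero, Real.rpow_zero]
    refine Asymptotics.IsBigO.of_bound (3 * q) (Eventually.of_forall fun u => ?_)
    simpa using bb_bound χ N u
  · refine Asymptotics.IsBigO.of_bound 0 ?_
    filter_upwards [hb 0] with u hu
    simp [hu]

lemma JJ_bound {q : ℕ} [NeZero q] (χ : DirichletCharacter ℂ q) (N : ℕ) (hN : 1 ≤ N) {s : ℂ} (hs : 0 < s.re) :
    ‖JJ χ N s‖ ≤ 3 * q * ((N : ℝ) ^ (-s.re) / s.re) := by
  have hN0 : (0 : ℝ) < N := by exact_mod_cast hN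
  unfold JJ mellin
  have e : ∫ t in Ioi (0 : ℝ), (t : ℂ) ^ (-s - 1) • bb χ N t = ∫ t in Ioi (N : ℝ), (t : ℂ) ^ (-s - 1) • bb χ N t := by
    refine setIntegral_eq_of_subset_of_forall_sdiff_eq_zero measurableSet_Ioi (Ioi_subset_Ioi hN0.le) ?_
    intro t ht
    have : ¬ (N : ℝ) < t := ht.2
    simp [bb, this]
  rw [e]
  have hIntg := integral_Ioi_rpow_of_lt (a := -s.re - 1) (c := (N : ℝ)) (by linarith) hN0
  have hi := integrableOn_Ioi_rpow_of_lt (a := -s.re - 1) (c := (N : ℝ)) (by linarith) hN0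
  have := norm_integral_le_of_norm_le (μ := volume.restrict (Ioi (N : ℝ))) (f := fun t : ℝ => (t : ℂ) ^ (-s - 1) • bb χ N t)
    (g := fun t => 3 * q * t ^ (-s.re - 1)) (hi.const_mul _) ?_
  · refine this.trans (le_of_eq ?_)
    rw [integral_const_mul, hIntg]
    congr 1
    have : -s.re - 1 + 1 = -s.re := by ring
    rw [this]
    rw [neg_div_neg_eq]
  · refine (ae_restrict_iff' measurableSet_Ioi).2 (Eventually.of_forall fun t ht => ?_)
    have ht0 : 0 < t := hN0.trans ht
    rw [norm_smul, Complex.norm_cpow_eq_rpow_re_of_pos ht0, mul_comm]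
    simp only [sub_re, neg_re, one_re]
    gcongr
    exact bb_bound χ N t
end FixPt

namespace FixPt
open Complex MeasureTheory Finset Set Filter Topology DirichletCharacter

lemma int_aux (N : ℕ) (hN : 1 ≤ N) {s : ℂ} (hs : 1 < s.re) :
    IntegrableOn (fun t : ℝ => ((t : ℂ) - N) * (t : ℂ) ^ (-(s + 1))) (Ioi (N : ℝ)) ∧
    s * ∫ t in Ioi (N : ℝ), ((t : ℂ) - N) * (t : ℂ) ^ (-(s + 1)) = (N : ℂ) ^ (1 - s) / (s - 1) := by
  have hN0 : (0 : ℝ) < N := by exact_mod_cast hN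
  have hNc : (N : ℂ) ≠ 0 := by exact_mod_cast hN0.ne'
  have hs0 : s ≠ 0 := by intro h; rw [h] at hs; simp at hs; linarith
  have hs1 : s - 1 ≠ 0 := by
    intro h; have := congrArg Complex.re h; simp at this; linarith
  have i1 := integrableOn_Ioi_cpow_of_lt (a := -s) (c := (N : ℝ)) (by simpa using hs) hN0
  have i2 := integrableOn_Ioi_cpow_of_lt (a := -s - 1) (c := (N : ℝ)) (by simp; linarith) hN0
  have v1 := integral_Ioi_cpow_of_lt (a := -s) (c := (N : ℝ)) (by simpa using hs) hN0
  have v2 := integral_Ioi_cpow_of_lt (a := -s - 1) (c := (N : ℝ)) (by simp; linarith) hN0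
  have e : EqOn (fun t : ℝ => ((t : ℂ) - N) * (t : ℂ) ^ (-(s + 1)))
      (fun t : ℝ => (t : ℂ) ^ (-s) - N * (t : ℂ) ^ (-s - 1)) (Ioi (N : ℝ)) := by
    intro t ht
    have ht0 : (t : ℂ) ≠ 0 := by exact_mod_cast (hN0.trans ht).ne'
    have : -s = (-s - 1) + 1 := by ring
    simp only
    rw [this, Complex.cpow_add _ _ ht0, Complex.cpow_one]
    ring_nf
  have i3 := i1.sub (i2.const_mul (N : ℂ))
  refine ⟨(integrableOn_congr_fun e measurableSet_Ioi).2 i3, ?_⟩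
  rw [setIntegral_congr_fun measurableSet_Ioi e, integral_sub i1 (i2.const_mul (N : ℂ)), integral_const_mul, v1, v2]
  have h1 : (N : ℂ) ^ (1 - s) = (N : ℂ) * (N : ℂ) ^ (-s) := by
    rw [sub_eq_add_neg, Complex.cpow_add _ _ hNc, Complex.cpow_one]
  have h2 : -s - 1 + 1 = -s := by ring
  have h3 : -s + 1 = 1 - s := by ring
  rw [h2, h3]
  push_cast
  rw [h1]
  have : (1 - s) = -(s - 1) := by ring
  rw [this]
  field_simp
  ring

lemma sum_trunc {q : ℕ} (χ : DirichletCharacter ℂ q) (N M : ℕ) :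
    ∑ k ∈ Finset.Icc 1 M, (if N < k then χ (k : ZMod q) else 0) = SS χ N M := by
  unfold SS
  rw [← Finset.sum_filter]
  congr 1
  ext k
  simp
  omega

lemma L_formula_re {q : ℕ} [NeZero q] (χ : DirichletCharacter ℂ q) (N : ℕ) (hN : 1 ≤ N) {s : ℂ} (hs : 1 < s.re) :
    LFunction χ s = ∑ n ∈ Finset.Icc 1 N, χ (n : ZMod q) * (n : ℂ) ^ (-s) +
      dl χ * ((N : ℂ) ^ (1 - s) / (s - 1)) + s * JJ χ N s := by
  have hN0 : (0 : ℝ) < N := by exact_mod_cast hN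
  have hN1 : (1 : ℝ) ≤ N := by exact_mod_cast hN
  set f : ℕ → ℂ := fun n => if N < n then χ (n : ZMod q) else 0 with hf
  have hfb : ∀ n, ‖f n‖ ≤ 1 := by
    intro n; simp only [hf]; split_ifs; exact norm_chi_le χ n; simp
  have hsum : LSeriesSummable (fun n : ℕ => χ (n : ZMod q)) s := by
    exact ZMod.LSeriesSummable_of_one_lt_re χ hs
  have hsumf : LSeriesSummable f s := by
    refine LSeriesSummable_of_bounded_of_one_lt_re (m := 1) (fun n _ => hfb n) hs
  have hfO : (fun n ↦ ∑ k ∈ Finset.Icc 1 n, f k) =O[atTop] fun n : ℕ ↦ (n : ℝ) ^ (1 : ℝ) := by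
    refine Asymptotics.IsBigO.of_bound 1 (Eventually.of_forall fun n => ?_)
    refine (norm_sum_le _ _).trans ((Finset.sum_le_sum (fun k _ => hfb k)).trans ?_)
    simp
  have h1 := LSeries_eq_mul_integral f zero_le_one hs hsumf hfO
  have h2 : LFunction χ s = LSeries f s + ∑ n ∈ Finset.Icc 1 N, χ (n : ZMod q) * (n : ℂ) ^ (-s) := by
    rw [LFunction_eq_LSeries χ hs]
    have : LSeries (fun n : ℕ => χ (n : ZMod q)) s - LSeries f s = LSeries ((fun n : ℕ => χ (n : ZMod q)) - f) s :=
      (LSeries_sub hsum hsumf).symm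
    rw [← sub_eq_iff_eq_add', this, LSeries, tsum_eq_sum (s := Finset.Icc 1 N)]
    · refine Finset.sum_congr rfl fun n hn => ?_
      simp only [Finset.mem_Icc] at hn
      rw [LSeries.term_of_ne_zero (by omega)]
      simp only [Pi.sub_apply, hf]
      rw [if_neg (by omega), sub_zero, Complex.cpow_neg, div_eq_mul_inv]
    · intro n hn
      simp only [Finset.mem_Icc] at hn
      by_cases h0 : n = 0
      · simp [h0]
      · rw [LSeries.term_of_ne_zero h0]
        simp only [Pi.sub_apply, hf]
        rw [if_pos (by omega), sub_self, zero_div]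
  have hJ : JJ χ N s = ∫ t in Ioi (1 : ℝ), bb χ N t * (t : ℂ) ^ (-(s + 1)) := by
    unfold JJ mellin
    rw [setIntegral_eq_of_subset_of_forall_sdiff_eq_zero (s := Ioi (1 : ℝ)) measurableSet_Ioi (Ioi_subset_Ioi zero_le_one)]
    · refine setIntegral_congr_fun measurableSet_Ioi fun t _ => ?_
      simp only [smul_eq_mul]
      rw [mul_comm]; ring_nf
    · intro t ht
      have : ¬ (N : ℝ) < t := by
        have : ¬ (1 : ℝ) < t := ht.2
        push Not at this ⊢; linarith
      simp [bb, this]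
  have hb : IntegrableOn (fun t : ℝ => bb χ N t * (t : ℂ) ^ (-(s + 1))) (Ioi (1 : ℝ)) := by
    have i2 := integrableOn_Ioi_cpow_of_lt (a := -(s + 1)) (c := (1 : ℝ)) (by simp; linarith) one_pos
    exact i2.bdd_mul (bb_measurable χ N).aestronglyMeasurable (Eventually.of_forall (bb_bound χ N))
  obtain ⟨hc1, hc2⟩ := int_aux N hN hs
  have hc3 : IntegrableOn ((Ioi (N : ℝ)).indicator (fun t : ℝ => ((t : ℂ) - N) * (t : ℂ) ^ (-(s + 1)))) (Ioi (1 : ℝ)) :=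
    ((integrable_indicator_iff measurableSet_Ioi).2 hc1).integrableOn
  have hc4 : ∫ t in Ioi (1 : ℝ), (Ioi (N : ℝ)).indicator (fun t : ℝ => ((t : ℂ) - N) * (t : ℂ) ^ (-(s + 1))) t =
      ∫ t in Ioi (N : ℝ), ((t : ℂ) - N) * (t : ℂ) ^ (-(s + 1)) := by
    rw [setIntegral_indicator measurableSet_Ioi]
    congr 2
    ext t; simp; intro; linarith
  have h3 : ∫ t in Ioi (1 : ℝ), (∑ k ∈ Finset.Icc 1 ⌊t⌋₊, f k) * (t : ℂ) ^ (-(s + 1)) =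
      dl χ * (∫ t in Ioi (N : ℝ), ((t : ℂ) - N) * (t : ℂ) ^ (-(s + 1))) + JJ χ N s := by
    rw [hJ, ← hc4, ← integral_const_mul, ← integral_add (hc3.const_mul _) hb]
    refine setIntegral_congr_fun measurableSet_Ioi fun t ht => ?_
    rw [sum_trunc]
    by_cases h : (N : ℝ) < t
    · rw [indicator_of_mem (by exact h), bb, if_pos h]; ring
    · rw [indicator_of_notMem (by exact h), bb, if_neg h]
      have : SS χ N ⌊t⌋₊ = 0 := by
        unfold SS
        rw [Finset.Ioc_eq_empty, Finset.sum_empty]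
        push Not at h ⊢
        exact Nat.floor_le_of_le h
      rw [this]; ring
  rw [h2, h1, h3, mul_add, ← mul_assoc, mul_comm s (dl χ), mul_assoc, hc2]
  ring

/-- `(s-1) L(s,χ)` as an entire function. -/
noncomputable def HH {q : ℕ} [NeZero q] (χ : DirichletCharacter ℂ q) (s : ℂ) : ℂ :=
  open Classical in if χ = 1 then LFunctionTrivChar₁ q s else (s - 1) * LFunction χ s

lemma HH_diff {q : ℕ} [NeZero q] (χ : DirichletCharacter ℂ q) : Differentiable ℂ (HH χ) := by
  by_cases h : χ = 1
  · have : HH χ = LFunctionTrivChar₁ q := by ext s; simp [HH, h]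
    rw [this]; exact differentiable_LFunctionTrivChar₁ q
  · have : HH χ = fun s => (s - 1) * LFunction χ s := by ext s; simp [HH, h]
    rw [this]; exact (differentiable_id.sub_const 1).mul (differentiable_LFunction h)

lemma HH_eq {q : ℕ} [NeZero q] (χ : DirichletCharacter ℂ q) {s : ℂ} (hs : s ≠ 1 ∨ χ ≠ 1) :
    HH χ s = (s - 1) * LFunction χ s := by
  by_cases h : χ = 1
  · have hs2 : s ≠ 1 := by tauto
    subst h
    simp only [HH, if_true, LFunctionTrivChar₁, Function.update_of_ne hs2]
  · simp [HH, h]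

lemma HH_formula {q : ℕ} [NeZero q] (χ : DirichletCharacter ℂ q) (N : ℕ) (hN : 1 ≤ N) {s : ℂ} (hs : 0 < s.re) :
    HH χ s = (s - 1) * (∑ n ∈ Finset.Icc 1 N, χ (n : ZMod q) * (n : ℂ) ^ (-s) + s * JJ χ N s) +
      dl χ * (N : ℂ) ^ (1 - s) := by
  have hNc : (N : ℂ) ≠ 0 := by exact_mod_cast (by omega : N ≠ 0)
  have hopen : IsOpen {s : ℂ | 0 < s.re} := isOpen_lt continuous_const Complex.continuous_re
  have h1 : AnalyticOnNhd ℂ (HH χ) {s : ℂ | 0 < s.re} :=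
    (HH_diff χ).differentiableOn.analyticOnNhd hopen
  have h2 : AnalyticOnNhd ℂ (fun s => (s - 1) * (∑ n ∈ Finset.Icc 1 N, χ (n : ZMod q) * (n : ℂ) ^ (-s) + s * JJ χ N s) +
      dl χ * (N : ℂ) ^ (1 - s)) {s : ℂ | 0 < s.re} := by
    refine DifferentiableOn.analyticOnNhd ?_ hopen
    intro z hz
    refine DifferentiableAt.differentiableWithinAt ?_
    refine DifferentiableAt.add (DifferentiableAt.mul (by fun_prop) (DifferentiableAt.add ?_ ?_)) ?_
    · refine DifferentiableAt.fun_sum fun n hn => ?_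
      have : (n : ℂ) ≠ 0 := by simp at hn; exact_mod_cast (by omega : n ≠ 0)
      exact (differentiableAt_const _).mul ((differentiableAt_id.neg).const_cpow (Or.inl this))
    · exact differentiableAt_id.mul (JJ_diff χ N hN hz)
    · exact (differentiableAt_const _).mul (((differentiableAt_const _).sub differentiableAt_id).const_cpow (Or.inl hNc))
  have hpre : IsPreconnected {s : ℂ | 0 < s.re} := (convex_halfSpace_re_gt 0).isPreconnected
  refine h1.eqOn_of_preconnected_of_eventuallyEq h2 hpre (z₀ := 2) (by simp) ?_ hs
  have : ∀ᶠ z : ℂ in 𝓝 2, 1 < z.re := (isOpen_lt continuous_const Complex.continuous_re).mem_nhds (by simp)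
  filter_upwards [this] with z hz
  have hz1 : z - 1 ≠ 0 := by
    intro h; have := congrArg Complex.re h; simp at this; linarith
  rw [HH_eq χ (Or.inl (sub_ne_zero.1 hz1)), L_formula_re χ N hN hz]
  field_simp
  ring

lemma L_formula {q : ℕ} [NeZero q] (χ : DirichletCharacter ℂ q) (N : ℕ) (hN : 1 ≤ N) {s : ℂ} (hs : 0 < s.re)
    (hs1 : s ≠ 1) :
    LFunction χ s = ∑ n ∈ Finset.Icc 1 N, χ (n : ZMod q) * (n : ℂ) ^ (-s) +
      dl χ * ((N : ℂ) ^ (1 - s) / (s - 1)) + s * JJ χ N s := by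
  have h := HH_formula χ N hN hs
  rw [HH_eq χ (Or.inl hs1)] at h
  have hz1 : s - 1 ≠ 0 := sub_ne_zero.2 hs1
  field_simp
  linear_combination h

end FixPt

namespace FixPt
open Complex MeasureTheory Finset Set Filter Topology DirichletCharacter

lemma dl_ne {q : ℕ} {χ : DirichletCharacter ℂ q} (h : χ ≠ 1) : dl χ = 0 := by
  simp [dl, h]

lemma L_formula_ne {q : ℕ} [NeZero q] {χ : DirichletCharacter ℂ q} (hχ : χ ≠ 1) (N : ℕ) (hN : 1 ≤ N) {s : ℂ} (hs : 0 < s.re) :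
    LFunction χ s = ∑ n ∈ Finset.Icc 1 N, χ (n : ZMod q) * (n : ℂ) ^ (-s) + s * JJ χ N s := by
  by_cases hs1 : s = 1
  · subst hs1
    have c1 : ContinuousAt (LFunction χ) 1 := (differentiable_LFunction hχ).continuous.continuousAt
    have c2 : ContinuousAt (fun s : ℂ => ∑ n ∈ Finset.Icc 1 N, χ (n : ZMod q) * (n : ℂ) ^ (-s) + s * JJ χ N s) 1 := by
      refine DifferentiableAt.continuousAt (𝕜 := ℂ) (DifferentiableAt.add ?_ ?_)
      · refine DifferentiableAt.fun_sum fun n hn => ?_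
        have : (n : ℂ) ≠ 0 := by simp at hn; exact_mod_cast (by omega : n ≠ 0)
        exact (differentiableAt_const _).mul ((differentiableAt_id.neg).const_cpow (Or.inl this))
      · exact differentiableAt_id.mul (JJ_diff χ N hN hs)
    refine ((c1.eventuallyEq_nhds_iff_eventuallyEq_nhdsNE c2).1 ?_).self_of_nhds
    have h1 : ∀ᶠ z : ℂ in 𝓝[≠] 1, 0 < z.re :=
      nhdsWithin_le_nhds ((isOpen_lt continuous_const Complex.continuous_re).mem_nhds (by simp))
    filter_upwards [h1, self_mem_nhdsWithin] with z hz hz1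
    rw [L_formula χ N hN hz hz1, dl_ne hχ]; ring
  · rw [L_formula χ N hN hs hs1, dl_ne hχ]; ring

/-- analytic conductor -/
noncomputable def QQ (q : ℕ) (s : ℂ) : ℝ := q * (2 + |s.im|)

lemma QQ_ge {q : ℕ} [NeZero q] (s : ℂ) : 2 ≤ QQ q s := by
  have hq : (1 : ℝ) ≤ q := by exact_mod_cast NeZero.pos q
  have := abs_nonneg s.im
  unfold QQ
  nlinarith

noncomputable def ind {q : ℕ} (χ : DirichletCharacter ℂ q) : ℝ :=
  open Classical in if χ = 1 then 1 else 0

lemma upper_core {q : ℕ} [NeZero q] (χ : DirichletCharacter ℂ q) {ε : ℝ} (hε : 0 < ε) (hε2 : ε ≤ 1/4) {s : ℂ}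
    (h1 : 1 - ε ≤ s.re) (h3 : s.re ≤ 3) (hs : s ≠ 1 ∨ χ ≠ 1) :
    ‖LFunction χ s‖ ≤ (100 + 2 / ε) * QQ q s ^ (2 * ε) * (1 + ind χ / ‖s - 1‖) := by
  have hQ := QQ_ge (q := q) s
  set Q := QQ q s with hQdef
  set N := ⌈Q⌉₊ with hNdef
  have hNQ : Q ≤ N := Nat.le_ceil Q
  have hN2 : (N : ℝ) ≤ 2 * Q := by
    have := Nat.ceil_lt_add_one (by linarith : 0 ≤ Q); linarith
  have hN1r : (1 : ℝ) ≤ N := by linarith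
  have hN1 : 1 ≤ N := by exact_mod_cast hN1r
  have hN0 : (0 : ℝ) < N := by linarith
  have hσ : 0 < s.re := by linarith
  have hNε1 : (1 : ℝ) ≤ (N : ℝ) ^ ε := Real.one_le_rpow hN1r hε.le
  have hNε2 : (N : ℝ) ^ ε ≤ (N : ℝ) ^ (2 * ε) := Real.rpow_le_rpow_of_exponent_le hN1r (by linarith)
  have hNQε : (N : ℝ) ^ (2 * ε) ≤ 2 * Q ^ (2 * ε) := by
    calc (N : ℝ) ^ (2 * ε) ≤ (2 * Q) ^ (2 * ε) := Real.rpow_le_rpow hN0.le hN2 (by linarith)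
      _ = 2 ^ (2 * ε) * Q ^ (2 * ε) := Real.mul_rpow (by norm_num) (by linarith)
      _ ≤ 2 ^ (1 : ℝ) * Q ^ (2 * ε) := by
        gcongr
        · norm_num
        · linarith
      _ = _ := by norm_num
  have hA : ‖∑ n ∈ Finset.Icc 1 N, χ (n : ZMod q) * (n : ℂ) ^ (-s)‖ ≤ (1 + 1 / ε) * (N : ℝ) ^ (2 * ε) := by
    have t1 : ∀ n ∈ Finset.Icc 1 N, ‖χ (n : ZMod q) * (n : ℂ) ^ (-s)‖ ≤ (N : ℝ) ^ ε * ((n : ℝ))⁻¹ := by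
      intro n hn
      simp only [Finset.mem_Icc] at hn
      have hn0 : (0 : ℝ) < n := by exact_mod_cast hn.1
      have hn1 : (1 : ℝ) ≤ n := by exact_mod_cast hn.1
      have hnN : (n : ℝ) ≤ N := by exact_mod_cast hn.2
      rw [norm_mul, Complex.norm_natCast_cpow_of_pos hn.1]
      calc ‖χ (n : ZMod q)‖ * (n : ℝ) ^ (-s).re ≤ 1 * (n : ℝ) ^ (ε - 1) := by
            gcongr
            · exact norm_chi_le χ n
            · simp; linarith
        _ = (n : ℝ) ^ ε * (n : ℝ)⁻¹ := by rw [one_mul, Real.rpow_sub hn0, Real.rpow_one, div_eq_mul_inv]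
        _ ≤ _ := by gcongr
    refine (norm_sum_le _ _).trans ((Finset.sum_le_sum t1).trans ?_)
    rw [← Finset.mul_sum]
    have t2 : ∑ n ∈ Finset.Icc 1 N, ((n : ℝ))⁻¹ ≤ 1 + Real.log N := by
      have := harmonic_le_one_add_log N
      rw [harmonic_eq_sum_Icc] at this
      push_cast at this
      exact this
    have t3 : Real.log N ≤ (N : ℝ) ^ ε / ε := Real.log_le_rpow_div hN0.le hε
    have t4 : (N : ℝ) ^ (2 * ε) = (N : ℝ) ^ ε * (N : ℝ) ^ ε := by rw [two_mul, Real.rpow_add hN0]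
    calc (N : ℝ) ^ ε * ∑ n ∈ Finset.Icc 1 N, ((n : ℝ))⁻¹ ≤ (N : ℝ) ^ ε * ((N : ℝ) ^ ε + (N : ℝ) ^ ε / ε) := by
          gcongr; linarith
      _ = _ := by rw [t4]; ring
  have hsn : ‖s‖ ≤ 2 * (2 + |s.im|) := by
    have := Complex.norm_le_abs_re_add_abs_im s
    rw [abs_of_pos hσ] at this
    have := abs_nonneg s.im
    linarith
  have hNσ : (N : ℝ) ^ (-s.re) ≤ (N : ℝ) ^ ε / N := by
    calc (N : ℝ) ^ (-s.re) ≤ (N : ℝ) ^ (ε - 1) := Real.rpow_le_rpow_of_exponent_le hN1r (by linarith)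
      _ = _ := by rw [Real.rpow_sub hN0, Real.rpow_one]
  have hB : ‖s * JJ χ N s‖ ≤ 8 * (N : ℝ) ^ (2 * ε) := by
    rw [norm_mul]
    have hσ34 : 3/4 ≤ s.re := by linarith
    calc ‖s‖ * ‖JJ χ N s‖ ≤ (2 * (2 + |s.im|)) * (3 * q * ((N : ℝ) ^ (-s.re) / s.re)) := by
          gcongr; exact JJ_bound χ N hN1 hσ
      _ ≤ (2 * (2 + |s.im|)) * (3 * q * (((N : ℝ) ^ ε / N) / (3/4))) := by gcongr
      _ = 8 * (N : ℝ) ^ ε * (Q / N) := by rw [hQdef, QQ]; field_simp; ring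
      _ ≤ 8 * (N : ℝ) ^ ε * 1 := by
        gcongr
        exact div_le_one_of_le₀ hNQ hN0.le
      _ ≤ _ := by linarith
  have hind : 0 ≤ ind χ := by unfold ind; split_ifs <;> norm_num
  have hD : ‖dl χ * ((N : ℂ) ^ (1 - s) / (s - 1))‖ ≤ (N : ℝ) ^ (2 * ε) * (ind χ / ‖s - 1‖) := by
    by_cases h : χ = 1
    · have : ind χ = 1 := by simp [ind, h]
      rw [this, norm_mul, norm_div, Complex.norm_natCast_cpow_of_pos hN1]
      have a : (N : ℝ) ^ (1 - s).re ≤ (N : ℝ) ^ (2 * ε) := by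
        apply Real.rpow_le_rpow_of_exponent_le hN1r; simp; linarith
      calc ‖dl χ‖ * ((N : ℝ) ^ (1 - s).re / ‖s - 1‖) ≤ 1 * ((N : ℝ) ^ (2 * ε) / ‖s - 1‖) := by
            gcongr; exact norm_dl_le χ
        _ = _ := by ring
    · rw [dl_ne h]; simp; positivity
  have hmain : ‖LFunction χ s‖ ≤ (1 + 1 / ε) * (N : ℝ) ^ (2 * ε) + (N : ℝ) ^ (2 * ε) * (ind χ / ‖s - 1‖) + 8 * (N : ℝ) ^ (2 * ε) := by
    by_cases h : s = 1
    · have hχ : χ ≠ 1 := by tauto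
      rw [L_formula_ne hχ N hN1 hσ]
      have : 0 ≤ (N : ℝ) ^ (2 * ε) * (ind χ / ‖s - 1‖) := by positivity
      exact (norm_add_le _ _).trans (by linarith)
    · rw [L_formula χ N hN1 hσ h]
      exact (norm_add₃_le).trans (by gcongr)
  refine hmain.trans ?_
  have hi : 0 ≤ ind χ / ‖s - 1‖ := by positivity
  set w := ind χ / ‖s - 1‖
  have hQp : 0 ≤ Q ^ (2 * ε) := by positivity
  calc _ = (N : ℝ) ^ (2 * ε) * (9 + 1 / ε + w) := by ring
    _ ≤ (2 * Q ^ (2 * ε)) * (9 + 1 / ε + w) := by gcongr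
    _ = Q ^ (2 * ε) * (18 + 2 / ε + 2 * w) := by ring
    _ ≤ Q ^ (2 * ε) * ((100 + 2 / ε) * (1 + w)) := by
      gcongr
      have : 0 ≤ 2 / ε * w := by positivity
      nlinarith
    _ = _ := by ring

lemma upper_simple {q : ℕ} [NeZero q] {χ : DirichletCharacter ℂ q} (hχ : χ ≠ 1) {s : ℂ}
    (h1 : 1/2 ≤ s.re) (h3 : ‖s‖ ≤ 4) : ‖LFunction χ s‖ ≤ 25 * q := by
  have hq : (1 : ℝ) ≤ q := by exact_mod_cast NeZero.pos q
  rw [L_formula_ne hχ 1 le_rfl (by linarith)]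
  refine (norm_add_le _ _).trans ?_
  have a := JJ_bound χ 1 le_rfl (s := s) (by linarith)
  simp only [Nat.cast_one, Real.one_rpow] at a
  have b : ‖JJ χ 1 s‖ ≤ 6 * q := by
    refine a.trans ?_
    have : 1 / s.re ≤ 2 := by rw [div_le_iff₀ (by linarith)]; linarith
    calc 3 * (q : ℝ) * (1 / s.re) ≤ 3 * q * 2 := by gcongr
      _ = _ := by ring
  have c : ‖∑ n ∈ Finset.Icc (1:ℕ) 1, χ (n : ZMod q) * (n : ℂ) ^ (-s)‖ ≤ 1 := by
    simp
  rw [norm_mul]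
  have : ‖s‖ * ‖JJ χ 1 s‖ ≤ 4 * (6 * q) := by gcongr
  linarith
end FixPt

namespace FixPt
open Complex MeasureTheory Finset Set Filter Topology DirichletCharacter

lemma zeta_real_bound {x : ℝ} (hx : 1 < x) (hx2 : x ≤ 2) :
    Summable (fun n : ℕ => (n : ℝ) ^ (-x)) ∧ ∑' n : ℕ, (n : ℝ) ^ (-x) ≤ 10 / (x - 1) := by
  have hs : Summable (fun n : ℕ => (n : ℝ) ^ (-x)) := Real.summable_nat_rpow.2 (by linarith)
  refine ⟨hs, ?_⟩
  have e : ((∑' n : ℕ, (n : ℝ) ^ (-x) : ℝ) : ℂ) = LFunction (1 : DirichletCharacter ℂ 1) (x : ℂ) := by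
    rw [LFunction_modOne_eq, zeta_eq_tsum_one_div_nat_cpow (by simpa using hx), Complex.ofReal_tsum]
    refine tsum_congr fun n => ?_
    rw [Complex.ofReal_cpow (by positivity)]
    push_cast
    rw [Complex.cpow_neg, one_div]
  have h0 : 0 ≤ ∑' n : ℕ, (n : ℝ) ^ (-x) := tsum_nonneg fun n => by positivity
  have hn : ∑' n : ℕ, (n : ℝ) ^ (-x) = ‖LFunction (1 : DirichletCharacter ℂ 1) (x : ℂ)‖ := by
    rw [← e, Complex.norm_real, Real.norm_of_nonneg h0]
  rw [hn, L_formula_re 1 1 le_rfl (by simpa using hx)]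
  have a := JJ_bound (1 : DirichletCharacter ℂ 1) 1 le_rfl (s := (x : ℂ)) (by simp; linarith)
  simp only [Nat.cast_one, Real.one_rpow, Complex.ofReal_re] at a
  have hJ : ‖JJ (1 : DirichletCharacter ℂ 1) 1 (x : ℂ)‖ ≤ 3 := by
    refine a.trans ?_
    have : 1 / x ≤ 1 := by rw [div_le_one (by linarith)]; linarith
    linarith
  have hd : ‖dl (1 : DirichletCharacter ℂ 1)‖ ≤ 1 := norm_dl_le _
  have hx1 : ‖(x : ℂ) - 1‖ = x - 1 := by
    rw [← Complex.ofReal_one, ← Complex.ofReal_sub, Complex.norm_real, Real.norm_of_nonneg (by linarith)]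
  have hb : ‖dl (1 : DirichletCharacter ℂ 1) * (((1 : ℕ) : ℂ) ^ (1 - (x : ℂ)) / ((x : ℂ) - 1))‖ ≤ 1 / (x - 1) := by
    rw [norm_mul, norm_div, hx1, Nat.cast_one, Complex.one_cpow, norm_one]
    exact mul_le_of_le_one_left (by have : 0 < x - 1 := by linarith
                                    positivity) hd
  have hc : ‖(x : ℂ) * JJ (1 : DirichletCharacter ℂ 1) 1 (x : ℂ)‖ ≤ 2 * 3 := by
    rw [norm_mul, Complex.norm_real, Real.norm_of_nonneg (by linarith)]
    gcongr
  have hd2 : ‖∑ n ∈ Finset.Icc (1:ℕ) 1, (1 : DirichletCharacter ℂ 1) (n : ZMod 1) * (n : ℂ) ^ (-(x : ℂ))‖ ≤ 1 := by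
    simpa using norm_chi_le (1 : DirichletCharacter ℂ 1) 1
  refine norm_add₃_le.trans ?_
  have h7 : 7 ≤ 9 / (x - 1) := by rw [le_div_iff₀ (by linarith)]; linarith
  have : 10 / (x - 1) = 9 / (x - 1) + 1 / (x - 1) := by ring
  linarith

lemma L_le_zeta {q : ℕ} [NeZero q] (χ : DirichletCharacter ℂ q) {s : ℂ} (h1 : 1 < s.re) (h2 : s.re ≤ 2) :
    ‖LFunction χ s‖ ≤ 10 / (s.re - 1) := by
  obtain ⟨a, b⟩ := zeta_real_bound h1 h2
  refine le_trans ?_ b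
  rw [LFunction_eq_LSeries χ h1, LSeries]
  refine tsum_of_norm_bounded a.hasSum fun n => ?_
  rcases Nat.eq_zero_or_pos n with h | h
  · subst h; simp; positivity
  · rw [LSeries.term_of_ne_zero h.ne', norm_div, Complex.norm_natCast_cpow_of_pos h, Real.rpow_neg (by positivity), ← one_div]
    gcongr
    exact norm_chi_le χ n

lemma lower_direct {q : ℕ} [NeZero q] (χ : DirichletCharacter ℂ q) {σ t M : ℝ} (h1 : 1 < σ) (h2 : σ ≤ 2)
    (hM0 : 0 < M) (hM : ‖LFunction (χ ^ 2) (σ + 2 * t * I)‖ ≤ M) :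
    ((σ - 1) / 10) ^ 3 / M ≤ ‖LFunction χ (σ + t * I)‖ ^ 4 := by
  have h := norm_LFunction_product_ge_one χ (x := σ - 1) (by linarith) t
  have hp : 0 < σ - 1 := by linarith
  have hL := L_le_zeta (1 : DirichletCharacter ℂ q) (s := (σ : ℂ)) (by simpa using h1) (by simpa using h2)
  simp only [Complex.ofReal_re] at hL
  have e1 : (1 : ℂ) + ((σ - 1 : ℝ) : ℂ) = σ := by push_cast; ring
  have e2 : (σ : ℂ) + I * t = σ + t * I := by ring
  have e3 : (σ : ℂ) + 2 * I * t = σ + 2 * t * I := by ring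
  rw [e1, e2, e3, norm_mul, norm_mul, norm_pow, norm_pow] at h
  set X := ‖LFunction χ (σ + t * I)‖
  have h' : 1 ≤ (10 / (σ - 1)) ^ 3 * X ^ 4 * M := by
    refine le_trans (ge_iff_le.1 h) ?_
    have : ‖LFunctionTrivChar q σ‖ ≤ 10 / (σ - 1) := hL
    gcongr
  rw [div_le_iff₀ hM0]
  have : ((σ - 1) / 10) ^ 3 * ((10 / (σ - 1)) ^ 3 * X ^ 4 * M) = X ^ 4 * M := by
    field_simp
  rw [← this]
  have hh : 0 ≤ ((σ - 1) / 10) ^ 3 := by positivity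
  nlinarith

lemma lower_341 {q : ℕ} [NeZero q] (χ : DirichletCharacter ℂ q) {t M : ℝ} (hM1 : 1 ≤ M)
    (hM : ∀ σ : ℝ, 1 < σ → σ ≤ 2 → ‖LFunction (χ ^ 2) (σ + 2 * t * I)‖ ≤ M)
    (hd : ∀ σ : ℝ, 1 < σ → σ ≤ 2 → ‖deriv (LFunction χ) (σ + t * I)‖ ≤ M) {σ : ℝ} (h1 : 1 < σ) (h2 : σ ≤ 2) :
    1 / (16000 * M ^ 4) ≤ ‖LFunction χ (σ + t * I)‖ := by
  have hM0 : 0 < M := by linarith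
  set η : ℝ := 10 * (1/20)^4 / M ^ 5 with hη
  have hM5 : 1 ≤ M ^ 5 := one_le_pow₀ hM1
  have hη0 : 0 < η := by positivity
  have hη1 : η ≤ 1 := by
    rw [hη, div_le_one (by positivity)]; norm_num; linarith
  have key : ∀ σ' : ℝ, 1 + η ≤ σ' → σ' ≤ 2 → 1 / (8000 * M ^ 4) ≤ ‖LFunction χ (σ' + t * I)‖ := by
    intro σ' ha hb
    have h := lower_direct χ (by linarith) hb hM0 (hM σ' (by linarith) hb)
    have h3 : (1 / (8000 * M ^ 4)) ^ 4 ≤ ‖LFunction χ (σ' + t * I)‖ ^ 4 := by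
      refine le_trans ?_ h
      calc (1 / (8000 * M ^ 4)) ^ 4 = (η / 10) ^ 3 / M := by rw [hη]; field_simp; norm_num
        _ ≤ _ := by gcongr; linarith
    exact le_of_pow_le_pow_left₀ (by norm_num) (norm_nonneg _) h3
  by_cases hc : 1 + η ≤ σ
  · refine le_trans ?_ (key σ hc h2)
    gcongr; norm_num
  · push Not at hc
    have h3 := key (1 + η) le_rfl (by linarith)
    have hconv : Convex ℝ {z : ℂ | 1 < z.re ∧ z.re ≤ 2 ∧ z.im = t} := by
      refine (convex_halfSpace_re_gt 1).inter ((convex_halfSpace_re_le 2).inter ?_)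
      exact convex_hyperplane (f := Complex.im) Complex.imLm.isLinear t
    have h4 := hconv.norm_image_sub_le_of_norm_deriv_le (𝕜 := ℂ) (f := LFunction χ) (C := M) (x := (σ : ℂ) + t * I)
      (y := ((1 + η : ℝ) : ℂ) + t * I) ?_ ?_ ?_ ?_
    · have e : ‖((1 + η : ℝ) : ℂ) + t * I - ((σ : ℂ) + t * I)‖ ≤ η := by
        rw [add_sub_add_right_eq_sub, ← Complex.ofReal_sub, Complex.norm_real, Real.norm_eq_abs, abs_le]
        constructor <;> linarith
      have h5 : M * ‖((1 + η : ℝ) : ℂ) + t * I - ((σ : ℂ) + t * I)‖ ≤ 1 / (16000 * M ^ 4) := by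
        calc _ ≤ M * η := by gcongr
          _ = 1 / (16000 * M ^ 4) := by rw [hη]; field_simp; norm_num
      have h6 := norm_sub_norm_le (LFunction χ (((1 + η : ℝ) : ℂ) + t * I)) (LFunction χ ((σ : ℂ) + t * I))
      have h7 : 1 / (8000 * M ^ 4) = 1 / (16000 * M ^ 4) + 1 / (16000 * M ^ 4) := by field_simp; norm_num
      linarith
    · intro z hz
      refine differentiableAt_LFunction χ z (Or.inl ?_)
      intro h; rw [h] at hz; simp at hz
    · intro z hz
      have := hd z.re hz.1 hz.2.1
      rwa [← hz.2.2, Complex.re_add_im] at this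
    · simp; exact ⟨h1, h2⟩
    · simp; exact ⟨hη0, by linarith⟩
end FixPt

namespace FixPt
open Complex MeasureTheory Finset Set Filter Topology DirichletCharacter

noncomputable def KK (ε : ℝ) : ℝ := 5 * (100 + 2 / ε) / ε

lemma KK_ge {ε : ℝ} (hε : 0 < ε) (hε2 : ε ≤ 1/4) : 5 * (100 + 2 / ε) ≤ KK ε ∧ 1 ≤ KK ε := by
  have h1 : 0 ≤ 2 / ε := by positivity
  have h2 : 5 * (100 + 2 / ε) ≤ KK ε := by
    unfold KK
    rw [le_div_iff₀ hε]
    nlinarith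
  exact ⟨h2, by linarith⟩

lemma QQ_rpow_two {q : ℕ} [NeZero q] {s z : ℂ} {ε : ℝ} (hε : 0 < ε) (hε2 : ε ≤ 1/4) (h : 2 + |z.im| ≤ 2 * (2 + |s.im|)) :
    QQ q z ^ (2 * ε) ≤ 2 * QQ q s ^ (2 * ε) := by
  have h1 : QQ q z ≤ 2 * QQ q s := by
    unfold QQ
    have : (0 : ℝ) ≤ q := by positivity
    nlinarith
  have h0 := QQ_ge (q := q) z
  have h0' := QQ_ge (q := q) s
  calc QQ q z ^ (2 * ε) ≤ (2 * QQ q s) ^ (2 * ε) := Real.rpow_le_rpow (by linarith) h1 (by linarith)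
      _ = 2 ^ (2 * ε) * QQ q s ^ (2 * ε) := Real.mul_rpow (by norm_num) (by linarith)
      _ ≤ 2 ^ (1 : ℝ) * QQ q s ^ (2 * ε) := by
        gcongr
        · norm_num
        · linarith
      _ = _ := by norm_num

lemma local_upper {q : ℕ} [NeZero q] {χ : DirichletCharacter ℂ q} {ε : ℝ} (hε : 0 < ε) (hε2 : ε ≤ 1/4) {s : ℂ}
    (h1 : 1 ≤ s.re) (h3 : s.re ≤ 2) (hs : χ ≠ 1 ∨ 1 ≤ |s.im|) {z : ℂ} (hz : ‖z - s‖ ≤ ε) :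
    DifferentiableAt ℂ (LFunction χ) z ∧ ‖LFunction χ z‖ ≤ 5 * (100 + 2 / ε) * QQ q s ^ (2 * ε) := by
  have hre := (Complex.abs_re_le_norm (z - s)).trans hz
  have him := (Complex.abs_im_le_norm (z - s)).trans hz
  rw [Complex.sub_re, abs_le] at hre
  rw [Complex.sub_im] at him
  have him2 : |z.im| ≤ |s.im| + ε := by
    have := abs_sub_abs_le_abs_sub z.im s.im; linarith
  have him3 : |s.im| - ε ≤ |z.im| := by
    have := abs_sub_abs_le_abs_sub s.im z.im; rw [abs_sub_comm] at this; linarith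
  have hor : z ≠ 1 ∨ χ ≠ 1 := by
    rcases hs with h | h
    · exact Or.inr h
    · left; intro hz1; rw [hz1] at him3; simp at him3; linarith
  refine ⟨differentiableAt_LFunction χ z hor, ?_⟩
  have hu := upper_core χ hε hε2 (s := z) (by linarith) (by linarith) hor
  have hQ := QQ_rpow_two (q := q) (s := s) (z := z) hε hε2 (by have := abs_nonneg s.im; linarith)
  have hQ0 : 0 ≤ QQ q s ^ (2 * ε) := by
    have := QQ_ge (q := q) s
    positivity
  have hi : 1 + ind χ / ‖z - 1‖ ≤ 5 / 2 := by
    by_cases h : χ = 1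
    · have h' : 1 ≤ |s.im| := by tauto
      have : ind χ = 1 := by simp [ind, h]
      rw [this]
      have h4 : 3/4 ≤ ‖z - 1‖ := by
        have := Complex.abs_im_le_norm (z - 1)
        simp at this; linarith
      have : 1 / ‖z - 1‖ ≤ 3/2 := by rw [div_le_iff₀ (by linarith)]; linarith
      linarith
    · have : ind χ = 0 := by simp [ind, h]
      rw [this]; norm_num
  have h2e : 0 ≤ 2 / ε := by positivity
  have hi0 : 0 ≤ 1 + ind χ / ‖z - 1‖ := by
    have : 0 ≤ ind χ := by unfold ind; split_ifs <;> norm_num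
    positivity
  calc _ ≤ _ := hu
    _ ≤ (100 + 2 / ε) * (2 * QQ q s ^ (2 * ε)) * (5 / 2) := by gcongr
    _ = _ := by ring

lemma deriv_upper {q : ℕ} [NeZero q] {χ : DirichletCharacter ℂ q} {ε : ℝ} (hε : 0 < ε) (hε2 : ε ≤ 1/4) {s : ℂ}
    (h1 : 1 ≤ s.re) (h3 : s.re ≤ 2) (hs : χ ≠ 1 ∨ 1 ≤ |s.im|) :
    ‖deriv (LFunction χ) s‖ ≤ KK ε * QQ q s ^ (2 * ε) := by
  have := Complex.norm_deriv_le_of_forall_mem_sphere_norm_le (f := LFunction χ) (c := s) (R := ε)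
    (C := 5 * (100 + 2 / ε) * QQ q s ^ (2 * ε)) hε ?_ ?_
  · refine this.trans (le_of_eq ?_)
    unfold KK; ring
  · refine DifferentiableOn.diffContOnCl_ball (U := Metric.closedBall s ε) ?_ subset_rfl
    intro z hz
    rw [Metric.mem_closedBall, dist_eq_norm] at hz
    exact (local_upper hε hε2 h1 h3 hs hz).1.differentiableWithinAt
  · intro z hz
    rw [mem_sphere_iff_norm] at hz
    exact (local_upper hε hε2 h1 h3 hs hz.le).2

lemma lower_341' {q : ℕ} [NeZero q] {χ : DirichletCharacter ℂ q} {ε : ℝ} (hε : 0 < ε) (hε2 : ε ≤ 1/4) {s : ℂ}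
    (h1 : 1 < s.re) (h3 : s.re ≤ 2) (hs : χ ≠ 1 ∨ 1 ≤ |s.im|) {w : ℝ} (hw : 1 ≤ w)
    (h4 : χ ^ 2 ≠ 1 ∨ 1 ≤ |s.im| * w) :
    1 / (16000 * (4 * KK ε * QQ q s ^ (2 * ε) * w) ^ 4) ≤ ‖LFunction χ s‖ := by
  obtain ⟨hK1, hK2⟩ := KK_ge hε hε2
  have hQ2 := QQ_ge (q := q) s
  have hQ1 : 1 ≤ QQ q s ^ (2 * ε) := Real.one_le_rpow (by linarith) (by linarith)
  have hKQ : 1 ≤ KK ε * QQ q s ^ (2 * ε) := one_le_mul_of_one_le_of_one_le hK2 hQ1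
  have hKQw : KK ε * QQ q s ^ (2 * ε) ≤ KK ε * QQ q s ^ (2 * ε) * w := le_mul_of_one_le_right (by linarith) hw
  have key := lower_341 χ (t := s.im) (M := 4 * KK ε * QQ q s ^ (2 * ε) * w) (by linarith) ?_ ?_ h1 h3
  · rwa [Complex.re_add_im] at key
  · intro σ ha hb
    set z : ℂ := σ + 2 * s.im * I with hz
    have zre : z.re = σ := by simp [hz]
    have zim : z.im = 2 * s.im := by simp [hz]
    have hz1 : z ≠ 1 := by intro h; rw [h] at zre; simp at zre; linarith
    have hu := upper_core (χ ^ 2) hε hε2 (s := z) (by linarith) (by linarith) (Or.inl hz1)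
    have hQ := QQ_rpow_two (q := q) (s := s) (z := z) hε hε2 (by rw [zim, abs_mul, abs_two]; linarith)
    have hi : 1 + ind (χ ^ 2) / ‖z - 1‖ ≤ 2 * w := by
      by_cases h : χ ^ 2 = 1
      · have h' : 1 ≤ |s.im| * w := by tauto
        have : ind (χ ^ 2) = 1 := by simp [ind, h]
        rw [this]
        have h4 : 2 * |s.im| ≤ ‖z - 1‖ := by
          have := Complex.abs_im_le_norm (z - 1)
          simp [zim, abs_mul] at this; linarith
        have h5 : 0 < |s.im| := by
          by_contra hc
          push Not at hc
          have : |s.im| = 0 := le_antisymm hc (abs_nonneg _)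
          rw [this] at h'; linarith
        have : 1 / ‖z - 1‖ ≤ w := by rw [div_le_iff₀ (by linarith)]; nlinarith
        linarith
      · have : ind (χ ^ 2) = 0 := by simp [ind, h]
        rw [this]; norm_num; linarith
    have h2e : 0 ≤ 2 / ε := by positivity
    have hi0 : 0 ≤ 1 + ind (χ ^ 2) / ‖z - 1‖ := by
      have : 0 ≤ ind (χ ^ 2) := by unfold ind; split_ifs <;> norm_num
      positivity
    have hQz : 0 ≤ QQ q z ^ (2 * ε) := by
      have := QQ_ge (q := q) z
      positivity
    calc _ ≤ _ := hu
      _ ≤ (KK ε) * (2 * QQ q s ^ (2 * ε)) * (2 * w) := by gcongr; linarith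
      _ = _ := by ring
  · intro σ ha hb
    have := deriv_upper (χ := χ) hε hε2 (s := σ + s.im * I) (by simpa using ha.le) (by simpa using hb) (by simpa using hs)
    have e : QQ q (σ + s.im * I) = QQ q s := by simp [QQ]
    rw [e] at this
    refine this.trans ?_
    linarith
end FixPt

namespace FixPt
open Complex MeasureTheory Finset Set Filter Topology DirichletCharacter
open scoped ComplexOrder

lemma alt_nonneg {F : ℂ → ℂ} {c : ℕ → ℂ} (hc : 0 ≤ c) (ha : LSeries.abscissaOfAbsConv c ≤ 1)
    (hF : ∀ s : ℂ, 1 < s.re → HasDerivAt F (-(F s * LSeries c s)) s) (h2 : 0 ≤ F 2) (n : ℕ) :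
    0 ≤ (-1) ^ n * iteratedDeriv n F 2 := by
  have hopen : IsOpen {s : ℂ | 1 < s.re} := isOpen_lt continuous_const Complex.continuous_re
  have h2m : (2 : ℂ) ∈ {s : ℂ | 1 < s.re} := by simp
  have hFd : DifferentiableOn ℂ F {s : ℂ | 1 < s.re} := fun s hs => (hF s hs).differentiableAt.differentiableWithinAt
  have hLd : DifferentiableOn ℂ (LSeries c) {s : ℂ | 1 < s.re} := by
    refine (LSeries_differentiableOn c).mono ?_
    intro s hs
    exact lt_of_le_of_lt ha (by exact_mod_cast hs)
  have hFc (k : ℕ) : ContDiffAt ℂ k F 2 := (hFd.contDiffOn hopen).contDiffAt (hopen.mem_nhds h2m)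
  have hLc (k : ℕ) : ContDiffAt ℂ k (LSeries c) 2 := (hLd.contDiffOn hopen).contDiffAt (hopen.mem_nhds h2m)
  induction n using Nat.strong_induction_on with
  | _ n ih =>
  rcases n with _ | n
  · simpa using h2
  have e1 : iteratedDeriv (n+1) F 2 = - ∑ i ∈ Finset.range (n + 1), ↑(n.choose i) * iteratedDeriv i F 2 * iteratedDeriv (n - i) (LSeries c) 2 := by
    rw [iteratedDeriv_succ']
    have : Set.EqOn (deriv F) (fun s => -(F s * LSeries c s)) {s : ℂ | 1 < s.re} := fun s hs => (hF s hs).deriv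
    rw [this.iteratedDeriv_of_isOpen hopen n h2m, iteratedDeriv_fun_neg, iteratedDeriv_fun_mul (hFc n) (hLc n)]
  rw [e1, pow_succ]
  have e2 : (-1 : ℂ) ^ n * -1 * (- ∑ i ∈ Finset.range (n + 1), ↑(n.choose i) * iteratedDeriv i F 2 * iteratedDeriv (n - i) (LSeries c) 2)
      = ∑ i ∈ Finset.range (n + 1), ↑(n.choose i) * (((-1) ^ i * iteratedDeriv i F 2) * ((-1) ^ (n - i) * iteratedDeriv (n - i) (LSeries c) 2)) := by
    rw [mul_neg, mul_neg_one, neg_mul, neg_neg, Finset.mul_sum]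
    refine Finset.sum_congr rfl fun i hi => ?_
    have : i + (n - i) = n := by have := Finset.mem_range.1 hi; omega
    nth_rewrite 1 [← this]
    rw [pow_add]; ring
  rw [e2]
  refine Finset.sum_nonneg fun i hi => mul_nonneg (by positivity) (mul_nonneg (ih i (Finset.mem_range.1 hi)) ?_)
  have := LSeries.iteratedDeriv_alternating hc (x := 2) (lt_of_le_of_lt ha (by norm_cast)) (n - i)
  simpa using this

lemma estermann {F H : ℂ → ℂ} {c : ℕ → ℂ} (hc : 0 ≤ c) (ha : LSeries.abscissaOfAbsConv c ≤ 1)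
    (hF : ∀ s : ℂ, 1 < s.re → HasDerivAt F (-(F s * LSeries c s)) s)
    (hH : Differentiable ℂ H) (hHF : ∀ s : ℂ, 1 < s.re → H s = (s - 1) * F s)
    {c0 B : ℝ} (hc0 : 0 < c0) (h2 : (c0 : ℂ) ≤ F 2) (hB : ∀ s : ℂ, ‖s - 2‖ ≤ 3/2 → ‖H s‖ ≤ B)
    {β : ℝ} (hβ : 3/4 ≤ β) (hβ1 : β < 1) (hpos : 0 ≤ (H β).re) {M : ℕ} (hM : 24 * B * (5/6) ^ M ≤ c0 / 2) :
    c0 / 2 * (1 - β) ≤ (H 1).re * (2 - β) ^ M := by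
  have hopen : IsOpen {s : ℂ | 1 < s.re} := isOpen_lt continuous_const Complex.continuous_re
  have h2m : (2 : ℂ) ∈ {s : ℂ | 1 < s.re} := by simp
  have hF2 : 0 ≤ F 2 := le_trans (by exact_mod_cast hc0.le) h2
  set lam := H 1 with hlam
  have hB0 : 0 ≤ B := (norm_nonneg _).trans (hB 2 (by norm_num))
  set G := dslope H 1 with hG
  have hGd : Differentiable ℂ G := by
    rw [← differentiableOn_univ] at hH ⊢
    exact (Complex.differentiableOn_dslope Filter.univ_mem).2 hH
  have hGv (s : ℂ) (hs : s ≠ 1) : G s = (H s - lam) / (s - 1) := by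
    rw [hG, dslope_of_ne _ hs, slope_def_field]
  -- coefficients
  have hFd : DifferentiableOn ℂ F {s : ℂ | 1 < s.re} := fun s hs => (hF s hs).differentiableAt.differentiableWithinAt
  have hFc (k : ℕ) : ContDiffAt ℂ k F 2 := (hFd.contDiffOn hopen).contDiffAt (hopen.mem_nhds h2m)
  have hId : DifferentiableOn ℂ (fun s : ℂ => (1 * s - 1)⁻¹) {s : ℂ | 1 < s.re} := by
    intro s hs
    refine DifferentiableAt.differentiableWithinAt ?_
    refine DifferentiableAt.inv (by fun_prop) ?_
    intro h
    have : s = 1 := by linear_combination h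
    rw [this] at hs; simp at hs
  have hIc (k : ℕ) : ContDiffAt ℂ k (fun s : ℂ => (1 * s - 1)⁻¹) 2 := (hId.contDiffOn hopen).contDiffAt (hopen.mem_nhds h2m)
  have hcoef (m : ℕ) : iteratedDeriv m G 2 = iteratedDeriv m F 2 - lam * ((-1) ^ m * m.factorial) := by
    have : Set.EqOn G (fun s => F s - lam * (1 * s - 1)⁻¹) {s : ℂ | 1 < s.re} := by
      intro s hs
      have hs1 : s ≠ 1 := by rintro rfl; simp at hs
      have : s - 1 ≠ 0 := sub_ne_zero.2 hs1
      simp only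
      rw [hGv s hs1, hHF s hs]
      field_simp
    rw [this.iteratedDeriv_of_isOpen hopen m h2m, iteratedDeriv_fun_sub (hFc m) (contDiffAt_const.mul (hIc m)), iteratedDeriv_const_mul _ (hIc m),
      iteratedDeriv_eq_iterate (f := fun s : ℂ => (1 * s - 1)⁻¹), iter_deriv_inv_linear_sub]
    norm_num
  set g : ℕ → ℂ := fun m => ((m.factorial : ℂ))⁻¹ • ((β : ℂ) - 2) ^ m • iteratedDeriv m G 2 with hg
  have hsum : HasSum g (G β) := Complex.hasSum_taylorSeries_of_entire hGd 2 β
  -- lower bound for coefficients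
  have hre (m : ℕ) : (if m = 0 then c0 else 0) - lam.re * (2 - β) ^ m ≤ (g m).re := by
    have hb := alt_nonneg hc ha hF hF2 m
    have e : g m = ((((m.factorial : ℝ))⁻¹ * (2 - β) ^ m : ℝ) : ℂ) * ((-1) ^ m * iteratedDeriv m F 2) - lam * (((2 - β) ^ m : ℝ) : ℂ) := by
      rw [hg]; simp only [smul_eq_mul]
      rw [hcoef m]
      have h1 : ((β : ℂ) - 2) ^ m = (-1) ^ m * (2 - β) ^ m := by rw [← mul_pow]; ring
      have h3 : (-1 : ℂ) ^ m * (-1) ^ m = 1 := by rw [← mul_pow]; simp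
      have h4 : (m.factorial : ℂ) ≠ 0 := by exact_mod_cast m.factorial_ne_zero
      rw [h1]; push_cast
      field_simp
      linear_combination (-lam * m.factorial * (2 - (β:ℂ)) ^ m) * h3
    rw [e, Complex.sub_re, Complex.re_ofReal_mul, Complex.re_mul_ofReal]
    have hbr := (Complex.le_def.1 hb).1
    simp only [Complex.zero_re] at hbr
    have hp : 0 ≤ ((m.factorial : ℝ))⁻¹ * (2 - β) ^ m := by
      have : 0 ≤ 2 - β := by linarith
      positivity
    split_ifs with hm
    · subst hm
      have := (Complex.le_def.1 h2).1
      simp at this ⊢; linarith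
    · have := mul_nonneg hp hbr
      linarith
  have hnorm (m : ℕ) : ‖g m‖ ≤ 4 * B * (5/6) ^ m := by
    have h1 : ‖iteratedDeriv m G 2‖ ≤ m.factorial * (4 * B) / (3/2) ^ m := by
      refine Complex.norm_iteratedDeriv_le_of_forall_mem_sphere_norm_le m (by norm_num) hGd.diffContOnCl ?_
      intro z hz
      rw [mem_sphere_iff_norm] at hz
      have hz1 : 1/2 ≤ ‖z - 1‖ := by
        have := norm_sub_norm_le (z - 2) (z - 1)
        have e : z - 2 - (z - 1) = -1 := by ring
        rw [e, hz] at this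
        norm_num at this; linarith
      have hz1' : z ≠ 1 := by rintro rfl; norm_num at hz1
      rw [hGv z hz1', norm_div, div_le_iff₀ (by linarith)]
      have a1 := hB z hz.le
      have a2 := hB 1 (by norm_num)
      have := norm_sub_le (H z) lam
      nlinarith
    rw [hg]; simp only [smul_eq_mul, norm_mul, norm_inv, norm_pow, Complex.norm_natCast]
    have h3 : ‖(β : ℂ) - 2‖ = 2 - β := by
      have : (β : ℂ) - 2 = ((β - 2 : ℝ) : ℂ) := by push_cast; ring
      rw [this, Complex.norm_real, Real.norm_eq_abs, abs_of_neg (by linarith)]; ring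
    rw [h3]
    have h4 : (2 - β) ^ m ≤ (5/4) ^ m := pow_le_pow_left₀ (by linarith) (by linarith) m
    have h5 : (0 : ℝ) < m.factorial := by exact_mod_cast m.factorial_pos
    calc (m.factorial : ℝ)⁻¹ * ((2 - β) ^ m * ‖iteratedDeriv m G 2‖) ≤ (m.factorial : ℝ)⁻¹ * ((5/4) ^ m * (m.factorial * (4 * B) / (3/2) ^ m)) := by
          gcongr
      _ = 4 * B * ((5/4) ^ m / (3/2) ^ m) := by field_simp
      _ = _ := by rw [← div_pow]; norm_num
  have htail : ‖G β - ∑ m ∈ Finset.range M, g m‖ ≤ 24 * B * (5/6) ^ M := by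
    have h1 := (hasSum_nat_add_iff' M).2 hsum
    rw [← h1.tsum_eq]
    have h2 : HasSum (fun m : ℕ => 4 * B * (5/6) ^ M * (5/6 : ℝ) ^ m) (4 * B * (5/6) ^ M * (1 - 5/6)⁻¹) :=
      (hasSum_geometric_of_lt_one (by norm_num) (by norm_num)).mul_left _
    refine (tsum_of_norm_bounded h2 fun m => ?_).trans (le_of_eq (by ring))
    refine (hnorm (m + M)).trans (le_of_eq (by rw [pow_add]; ring))
  have hGb : G β = ((H β) - lam) / ((β - 1 : ℝ) : ℂ) := by
    rw [hGv β (by intro h; have : β = 1 := by exact_mod_cast h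
                  linarith)]; push_cast; rfl
  have hGre : (G β).re * (1 - β) = lam.re - (H β).re := by
    rw [hGb, Complex.div_ofReal_re, Complex.sub_re]
    have : β - 1 ≠ 0 := by linarith
    field_simp; ring
  have hsre : ∀ k : ℕ, c0 * (if k = 0 then 0 else 1) - lam.re * ∑ m ∈ Finset.range k, (2 - β) ^ m ≤ (∑ m ∈ Finset.range k, g m).re := by
    intro k
    induction k with
    | zero => simp
    | succ k ih =>
      rw [Finset.sum_range_succ, Finset.sum_range_succ, Complex.add_re]
      have := hre k
      split_ifs at * <;> first | omega | nlinarith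
  have hM0 : M ≠ 0 ∨ M = 0 := by tauto
  have ht := (Complex.abs_re_le_norm _).trans htail
  rw [Complex.sub_re, abs_le] at ht
  have hs := hsre M
  have hgeom : (∑ m ∈ Finset.range M, (2 - β) ^ m) * (1 - β) = (2 - β) ^ M - 1 := by
    have := geom_sum_mul (2 - β) M
    rw [← this]; ring
  have hMne : M ≠ 0 := by
    rintro rfl
    have a2 := hB 2 (by norm_num)
    rw [hHF 2 (by norm_num)] at a2
    have := (Complex.le_def.1 h2).1
    have h3 := Complex.re_le_norm (F 2)
    norm_num at a2 this hM
    linarith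
  rw [if_neg hMne] at hs
  have key : c0 / 2 - lam.re * (∑ m ∈ Finset.range M, (2 - β) ^ m) ≤ (G β).re := by linarith
  have := mul_le_mul_of_nonneg_right key (by linarith : 0 ≤ 1 - β)
  rw [hGre, sub_mul, mul_assoc, hgeom] at this
  linarith

end FixPt

namespace FixPt
open Complex MeasureTheory Finset Set Filter Topology DirichletCharacter
open scoped ComplexOrder

lemma omega_bound (A ε : ℝ) (hA : 1 ≤ A) (hε : 0 < ε) : ∃ C : ℝ, 1 ≤ C ∧ ∀ n : ℕ, n ≠ 0 →
    A ^ (n.primeFactors.card) ≤ C * (n : ℝ) ^ ε := by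
  set P : ℕ := ⌈A ^ (1/ε)⌉₊
  refine ⟨A ^ P, one_le_pow₀ hA, fun n hn => ?_⟩
  have h1 : ∀ p ∈ n.primeFactors, A ≤ (if p < P then A else 1) * (p : ℝ) ^ ε := by
    intro p hp
    have hp1 : (1 : ℝ) ≤ p := by exact_mod_cast (Nat.prime_of_mem_primeFactors hp).one_lt.le
    split_ifs with h
    · have : 1 ≤ (p : ℝ) ^ ε := Real.one_le_rpow hp1 hε.le
      nlinarith
    · rw [one_mul]
      have : A ^ (1/ε) ≤ p := (Nat.le_ceil _).trans (by exact_mod_cast not_lt.1 h)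
      calc A = (A ^ (1/ε)) ^ ε := by rw [← Real.rpow_mul (by linarith)]; field_simp; simp
        _ ≤ _ := Real.rpow_le_rpow (by positivity) this hε.le
  calc A ^ (n.primeFactors.card) = ∏ p ∈ n.primeFactors, A := by simp
    _ ≤ ∏ p ∈ n.primeFactors, ((if p < P then A else 1) * (p : ℝ) ^ ε) :=
        Finset.prod_le_prod (fun _ _ => by linarith) h1
    _ = (∏ p ∈ n.primeFactors, (if p < P then A else 1)) * ∏ p ∈ n.primeFactors, (p : ℝ) ^ ε := Finset.prod_mul_distrib
    _ ≤ A ^ P * (n : ℝ) ^ ε := by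
      gcongr
      · rw [Finset.prod_ite]; simp only [Finset.prod_const, one_pow, mul_one]
        refine pow_le_pow_right₀ hA ?_
        calc _ ≤ (Finset.range P).card := Finset.card_le_card (by intro p; simp)
          _ = P := by simp
      · rw [Real.finsetProd_rpow _ _ (by intros; positivity)]
        refine Real.rpow_le_rpow (by positivity) ?_ hε.le
        rw [← Nat.cast_prod]
        exact_mod_cast Nat.le_of_dvd (Nat.pos_of_ne_zero hn) (Nat.prod_primeFactors_dvd n)

noncomputable def cL {q : ℕ} (χ : DirichletCharacter ℂ q) : ℕ → ℂ := fun n => χ (n : ZMod q) * ((ArithmeticFunction.vonMangoldt n : ℝ) : ℂ)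

def Dat (F : ℂ → ℂ) (c : ℕ → ℂ) : Prop :=
  ∀ s : ℂ, 1 < s.re → HasDerivAt F (-(F s * LSeries c s)) s ∧ LSeriesSummable c s

lemma Dat.mul {F G : ℂ → ℂ} {c d : ℕ → ℂ} (hF : Dat F c) (hG : Dat G d) : Dat (fun s => F s * G s) (c + d) := by
  intro s hs
  obtain ⟨a1, a2⟩ := hF s hs
  obtain ⟨b1, b2⟩ := hG s hs
  refine ⟨?_, a2.add b2⟩
  rw [LSeries_add a2 b2]
  have := a1.mul b1
  refine this.congr_deriv ?_
  ring

lemma Dat_L {q : ℕ} [NeZero q] (χ : DirichletCharacter ℂ q) : Dat (LFunction χ) (cL χ) := by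
  intro s hs
  have hs1 : s ≠ 1 := by rintro rfl; simp at hs
  refine ⟨?_, LSeriesSummable_twist_vonMangoldt χ hs⟩
  have h := (differentiableAt_LFunction χ s (Or.inl hs1)).hasDerivAt
  have e : LSeries (cL χ) s = _ := LSeries_twist_vonMangoldt_eq χ hs
  rw [e]
  have h0 : LFunction χ s ≠ 0 := LFunction_ne_zero_of_one_le_re χ (Or.inr hs1) hs.le
  rw [← LFunction_eq_LSeries χ hs, ← deriv_LFunction_eq_deriv_LSeries χ hs]
  refine h.congr_deriv ?_
  field_simp

lemma Dat.abscissa {F : ℂ → ℂ} {c : ℕ → ℂ} (hF : Dat F c) : LSeries.abscissaOfAbsConv c ≤ 1 := by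
  refine LSeries.abscissaOfAbsConv_le_of_forall_lt_LSeriesSummable (x := 1) ?_
  intro y hy
  exact (hF y (by simpa using hy)).2

lemma real_val {q : ℕ} {χ : DirichletCharacter ℂ q} (h : χ ^ 2 = 1) (a : ZMod q) : χ a = 0 ∨ χ a = 1 ∨ χ a = -1 := by
  by_cases ha : IsUnit a
  · right
    have := congrArg (fun ψ : DirichletCharacter ℂ q => ψ a) h
    simp only [MulChar.pow_apply' _ (by norm_num : (2:ℕ) ≠ 0), MulChar.one_apply ha] at this
    exact sq_eq_one_iff.1 this
  · left; exact χ.map_nonunit ha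

lemma real_val' {q : ℕ} {χ : DirichletCharacter ℂ q} (h : χ ^ 2 = 1) (a : ZMod q) : ∃ r : ℝ, -1 ≤ r ∧ r ≤ 1 ∧ χ a = r := by
  rcases real_val h a with h | h | h
  · exact ⟨0, by norm_num, by norm_num, by simpa using h⟩
  · exact ⟨1, by norm_num, by norm_num, by simpa using h⟩
  · exact ⟨-1, by norm_num, by norm_num, by simpa using h⟩

lemma L_real {q : ℕ} [NeZero q] {χ : DirichletCharacter ℂ q} (hχ : χ ≠ 1) (h : χ ^ 2 = 1) {x : ℝ} (hx : 0 < x) :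
    LFunction χ x = (((LFunction χ x).re : ℝ) : ℂ) := by
  choose r hr1 hr2 hr using real_val' h
  suffices ∃ y : ℝ, LFunction χ x = y by
    obtain ⟨y, hy⟩ := this
    rw [hy, Complex.ofReal_re]
  have hb : ∀ u : ℝ, bb χ 1 u = (((if (1:ℝ) < u then ∑ n ∈ Finset.Ioc 1 ⌊u⌋₊, r n else 0) : ℝ) : ℂ) := by
    intro u
    unfold bb SS
    rw [dl_ne hχ]
    simp only [hr, Nat.cast_one]
    split_ifs <;> push_cast <;> ring
  have hJ : ∃ y : ℝ, JJ χ 1 x = y := by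
    refine ⟨∫ u in Set.Ioi (0:ℝ), u ^ (-x - 1) * (if (1:ℝ) < u then ∑ n ∈ Finset.Ioc 1 ⌊u⌋₊, r n else 0), ?_⟩
    unfold JJ mellin
    rw [← integral_complex_ofReal]
    refine setIntegral_congr_fun measurableSet_Ioi ?_
    intro u hu
    simp only [hb, smul_eq_mul]
    rw [Complex.ofReal_mul, Complex.ofReal_cpow (le_of_lt hu)]
    push_cast; rfl
  obtain ⟨y, hy⟩ := hJ
  rw [L_formula_ne hχ 1 le_rfl (by simpa using hx), hy]
  exact ⟨1 + x * y, by simp⟩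

lemma L_two {q : ℕ} [NeZero q] {χ : DirichletCharacter ℂ q} (h : χ ^ 2 = 1) :
    ((1/4 : ℝ) : ℂ) ≤ LFunction χ 2 := by
  choose r hr1 hr2 hr using real_val' h
  have hs : HasSum (fun n : ℕ => r n * (1 / (n : ℝ) ^ 2)) (∑' n : ℕ, r n * (1 / (n : ℝ) ^ 2)) := by
    refine Summable.hasSum ?_
    refine Summable.of_norm_bounded hasSum_zeta_two.summable fun n => ?_
    rw [norm_mul, Real.norm_eq_abs]
    have : |r n| ≤ 1 := abs_le.2 ⟨hr1 _, hr2 _⟩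
    have h2 : ‖1 / (n:ℝ)^2‖ = 1 / (n:ℝ)^2 := by rw [Real.norm_of_nonneg]; positivity
    rw [h2]
    have : 0 ≤ 1 / (n:ℝ)^2 := by positivity
    nlinarith [abs_nonneg (r n)]
  have e : LFunction χ 2 = ((∑' n : ℕ, r n * (1 / (n : ℝ) ^ 2) : ℝ) : ℂ) := by
    rw [LFunction_eq_LSeries χ (by norm_num), LSeries, Complex.ofReal_tsum]
    refine tsum_congr fun n => ?_
    rcases Nat.eq_zero_or_pos n with h | h
    · subst h; simp
    · rw [LSeries.term_of_ne_zero h.ne', hr]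
      push_cast
      rw [show (2:ℂ) = ((2:ℕ):ℂ) by norm_num, Complex.cpow_natCast]
      ring
  rw [e]
  have h1 : r (1 : ℕ) = 1 := by
    have := hr ((1 : ℕ) : ZMod q)
    simp at this
    have : (r 1 : ℂ) = ((1:ℝ):ℂ) := by rw [← this]; simp
    simpa using Complex.ofReal_injective this
  have hz : HasSum (fun n : ℕ => (if n = 1 then 2 else 0) - 1 / (n : ℝ) ^ 2) (2 - Real.pi ^ 2 / 6) :=
    (hasSum_ite_eq 1 (2:ℝ)).sub hasSum_zeta_two
  have : 2 - Real.pi ^ 2 / 6 ≤ ∑' n : ℕ, r n * (1 / (n : ℝ) ^ 2) := by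
    refine hasSum_le (fun n => ?_) hz hs
    split_ifs with hn
    · subst hn; rw [h1]; norm_num
    · have : 0 ≤ 1 / (n:ℝ)^2 := by positivity
      nlinarith [hr1 n]
  have hpi := Real.pi_lt_d2
  have hpi0 := Real.pi_pos
  refine Complex.real_le_real.2 (le_trans ?_ this)
  nlinarith

lemma L_two_one : ((1 : ℝ) : ℂ) ≤ LFunction (1 : DirichletCharacter ℂ 1) 2 := by
  rw [LFunction_modOne_eq, riemannZeta_two]
  have hpi := Real.pi_gt_three
  norm_cast
  nlinarith

noncomputable abbrev H1 : ℂ → ℂ := HH (1 : DirichletCharacter ℂ 1)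

lemma H1_formula {s : ℂ} (hs : 0 < s.re) : ‖H1 s - 1‖ ≤ ‖s - 1‖ * (1 + ‖s‖ * (3 / s.re)) := by
  rw [H1, HH_formula _ 1 le_rfl hs]
  have a := JJ_bound (1 : DirichletCharacter ℂ 1) 1 le_rfl hs
  simp only [Nat.cast_one, Real.one_rpow, mul_one] at a
  have : dl (1 : DirichletCharacter ℂ 1) = 1 := by simp [dl]
  rw [this]
  simp only [Finset.Icc_self, Finset.sum_singleton, Nat.cast_one, map_one, Complex.one_cpow, mul_one, add_sub_cancel_right]
  rw [norm_mul]
  gcongr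
  refine (norm_add_le _ _).trans ?_
  rw [norm_mul]
  simp only [norm_one]
  gcongr
  refine a.trans (le_of_eq (by ring))

lemma H1_one : H1 1 = 1 := by
  have := H1_formula (s := 1) (by simp)
  simp at this
  exact sub_eq_zero.1 this

lemma H1_bound {s : ℂ} (hs : ‖s - 2‖ ≤ 3/2) : 1/2 ≤ s.re ∧ ‖s‖ ≤ 4 ∧ ‖H1 s‖ ≤ 60 := by
  have h1 := (Complex.abs_re_le_norm (s - 2)).trans hs
  rw [Complex.sub_re, abs_le] at h1
  simp at h1
  have h2 : ‖s‖ ≤ 7/2 := by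
    have := norm_add_le (s - 2) 2
    rw [sub_add_cancel] at this
    norm_num at this; linarith
  have h3 : ‖s - 1‖ ≤ 5/2 := by
    have := norm_add_le (s - 2) 1
    have e : s - 2 + 1 = s - 1 := by ring
    rw [e] at this
    norm_num at this; linarith
  refine ⟨by linarith, by linarith, ?_⟩
  have h4 := H1_formula (s := s) (by linarith)
  have h5 : 3 / s.re ≤ 6 := by rw [div_le_iff₀ (by linarith)]; linarith
  have h6 : ‖s‖ * (3 / s.re) ≤ 7/2 * 6 := by
    have : 0 ≤ 3 / s.re := by apply div_nonneg <;> linarith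
    gcongr
  have h7 : ‖s - 1‖ * (1 + ‖s‖ * (3 / s.re)) ≤ 5/2 * (1 + 7/2*6) := by
    have : 0 ≤ 3 / s.re := by apply div_nonneg <;> linarith
    gcongr
  have h8 := norm_add_le (H1 s - 1) 1
  rw [sub_add_cancel, norm_one] at h8
  linarith

lemma H1_beta {β : ℝ} (h : 3/4 ≤ β) (h1 : β < 1) : 0 ≤ (H1 β).re := by
  have h4 := H1_formula (s := (β : ℂ)) (by simp; linarith)
  have e : ‖(β : ℂ) - 1‖ = 1 - β := by
    have : (β : ℂ) - 1 = ((β - 1 : ℝ) : ℂ) := by push_cast; ring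
    rw [this, Complex.norm_real, Real.norm_eq_abs, abs_of_neg (by linarith)]; ring
  rw [e, Complex.norm_real, Real.norm_of_nonneg (by linarith), Complex.ofReal_re] at h4
  have e2 : β * (3 / β) = 3 := by field_simp
  rw [e2] at h4
  have := (Complex.abs_re_le_norm (H1 β - 1)).trans h4
  rw [abs_le, Complex.sub_re, Complex.one_re] at this
  linarith

lemma choose_M {B β : ℝ} (hB : 1 ≤ B) (hβ : β < 1) (hβ0 : 0 < β) : ∃ M : ℕ, 24 * B * (5/6) ^ M ≤ 1/128 ∧
    (2 - β) ^ M ≤ 3 * (3072 * B) ^ (6 * (1 - β)) := by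
  have hl : 0 < Real.log (3072 * B) := Real.log_pos (by linarith)
  refine ⟨⌈6 * Real.log (3072 * B)⌉₊, ?_, ?_⟩
  · have h1 := Nat.le_ceil (6 * Real.log (3072 * B))
    set M := ⌈6 * Real.log (3072 * B)⌉₊
    have h2 : (5/6 : ℝ) ≤ Real.exp (-(1/6)) := by
      have := Real.add_one_le_exp (-(1/6)); linarith
    have h3 : (5/6 : ℝ) ^ M ≤ (3072 * B)⁻¹ := by
      calc (5/6 : ℝ) ^ M ≤ Real.exp (-(1/6)) ^ M := pow_le_pow_left₀ (by norm_num) h2 _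
        _ = Real.exp (-(M/6)) := by rw [← Real.exp_nat_mul]; congr 1; ring
        _ ≤ Real.exp (-Real.log (3072 * B)) := by apply Real.exp_le_exp.2; linarith
        _ = _ := by rw [Real.exp_neg, Real.exp_log (by linarith)]
    calc 24 * B * (5/6) ^ M ≤ 24 * B * (3072 * B)⁻¹ := by gcongr
      _ = 1/128 := by field_simp; norm_num
  · have h1 := Nat.ceil_lt_add_one (a := 6 * Real.log (3072 * B)) (by linarith)
    set M := ⌈6 * Real.log (3072 * B)⌉₊
    have h2 : 2 - β ≤ Real.exp (1 - β) := by
      have := Real.add_one_le_exp (1 - β); linarith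
    calc (2 - β) ^ M ≤ Real.exp (1 - β) ^ M := pow_le_pow_left₀ (by linarith) h2 _
      _ = Real.exp (M * (1 - β)) := by rw [← Real.exp_nat_mul]
      _ ≤ Real.exp (1 + Real.log (3072 * B) * (6 * (1 - β))) := by
          apply Real.exp_le_exp.2; nlinarith
      _ = Real.exp 1 * (3072 * B) ^ (6 * (1 - β)) := by
          rw [Real.exp_add, Real.rpow_def_of_pos (by linarith)]
      _ ≤ _ := by
          gcongr; exact Real.exp_one_lt_d9.le.trans (by norm_num)

end FixPt

namespace FixPt
open Complex MeasureTheory Finset Set Filter Topology DirichletCharacter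
open scoped ComplexOrder

lemma H1_eq {s : ℂ} (hs : s ≠ 1) : H1 s = (s - 1) * LFunction (1 : DirichletCharacter ℂ 1) s := HH_eq _ (Or.inl hs)

lemma Lam_nn (n : ℕ) : (0:ℝ) ≤ ArithmeticFunction.vonMangoldt n := ArithmeticFunction.vonMangoldt_nonneg

lemma one_char {N : ℕ} [NeZero N] {χ : DirichletCharacter ℂ N} (hχ : χ ≠ 1) (h2 : χ ^ 2 = 1) {β : ℝ}
    (hβ : 3/4 ≤ β) (hβ1 : β < 1) (hpos : 0 ≤ (LFunction χ β).re) :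
    (1 - β) ≤ 384 * (3000000000 * (N:ℝ) ^ 3) ^ (6 * (1 - β)) * ‖LFunction χ 1‖ := by
  have hN : (1 : ℝ) ≤ N := by exact_mod_cast NeZero.pos N
  obtain ⟨M, hM1, hM2⟩ := choose_M (B := 60 * (25 * (N:ℝ)) ^ 3) (β := β) (by nlinarith [one_le_pow₀ hN (n := 3)]) hβ1 (by linarith)
  have hD := (Dat_L (1 : DirichletCharacter ℂ 1)).mul (Dat_L χ)
  have hdiff : Differentiable ℂ (fun s => H1 s * LFunction χ s) := (HH_diff _).mul (differentiable_LFunction hχ)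
  have := estermann (c := cL (1 : DirichletCharacter ℂ 1) + cL χ) (F := fun s => LFunction (1 : DirichletCharacter ℂ 1) s * LFunction χ s)
    (H := fun s => H1 s * LFunction χ s) (c0 := 1/64) (B := 60 * (25 * (N:ℝ)) ^ 3) (β := β) (M := M)
    ?_ hD.abscissa (fun s hs => (hD s hs).1) hdiff ?_ (by norm_num) ?_ ?_ hβ hβ1 ?_ ?_
  · have h3 : (H1 1 * LFunction χ 1).re ≤ ‖LFunction χ 1‖ := by
      rw [H1_one, one_mul]; exact Complex.re_le_norm _
    have h4 : 0 ≤ (2 - β) ^ M := pow_nonneg (by linarith) _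
    have h5 : (H1 1 * LFunction χ 1).re * (2 - β) ^ M ≤ ‖LFunction χ 1‖ * (3 * (3072 * (60 * (25 * (N:ℝ)) ^ 3)) ^ (6 * (1 - β))) := by
      gcongr
    have h6 : (3072 * (60 * (25 * (N:ℝ)) ^ 3)) ^ (6 * (1 - β)) ≤ (3000000000 * (N:ℝ) ^ 3) ^ (6 * (1 - β)) := by
      refine Real.rpow_le_rpow (by positivity) ?_ (by linarith)
      have : (0:ℝ) ≤ (N:ℝ)^3 := by positivity
      nlinarith
    have h7 := mul_le_mul_of_nonneg_left h6 (norm_nonneg (LFunction χ 1))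
    norm_num at this h5 h7 ⊢
    linarith
  · intro n
    obtain ⟨r, hr1, hr2, hr⟩ := real_val' h2 (n : ZMod N)
    have := Lam_nn n
    simp only [Pi.zero_apply, Pi.add_apply, cL, hr]
    rw [MulChar.one_apply (isUnit_of_subsingleton _)]
    norm_cast
    nlinarith
  · intro s hs
    rw [H1_eq (by rintro rfl; simp at hs)]; ring
  · have h1 := L_two_one
    have h3 := L_two h2
    refine le_trans ?_ (mul_le_mul h1 h3 (by norm_cast; norm_num) (le_trans (Complex.zero_le_real.2 zero_le_one) h1))
    norm_cast; norm_num
  · intro s hs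
    obtain ⟨a, b, c⟩ := H1_bound hs
    simp only [norm_mul]
    have d := upper_simple hχ a b
    have e : 25 * (N:ℝ) ≤ (25 * (N:ℝ)) ^ 3 := le_self_pow₀ (by linarith) (by norm_num)
    have := mul_le_mul c (d.trans e) (norm_nonneg _) (by norm_num)
    exact this
  · rw [L_real hχ h2 (by linarith), Complex.re_mul_ofReal]
    exact mul_nonneg (H1_beta hβ hβ1) hpos
  · linarith

lemma two_char {N : ℕ} [NeZero N] {χ ψ : DirichletCharacter ℂ N} (hχ : χ ≠ 1) (hψ : ψ ≠ 1) (hχψ : χ * ψ ≠ 1) (h2 : χ ^ 2 = 1)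
    (h2' : ψ ^ 2 = 1) {β : ℝ} (hβ : 3/4 ≤ β) (hβ1 : β < 1) (hz : LFunction χ β = 0) :
    (1 - β) ≤ 384 * (3000000000 * (N:ℝ) ^ 3) ^ (6 * (1 - β)) * (‖LFunction χ 1‖ * ‖LFunction ψ 1‖ * ‖LFunction (χ * ψ) 1‖) := by
  have hN : (1 : ℝ) ≤ N := by exact_mod_cast NeZero.pos N
  have h2'' : (χ * ψ) ^ 2 = 1 := by rw [mul_pow, h2, h2', one_mul]
  obtain ⟨M, hM1, hM2⟩ := choose_M (B := 60 * (25 * (N:ℝ)) ^ 3) (β := β) (by nlinarith [one_le_pow₀ hN (n := 3)]) hβ1 (by linarith)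
  have hD := (((Dat_L (1 : DirichletCharacter ℂ 1)).mul (Dat_L χ)).mul (Dat_L ψ)).mul (Dat_L (χ * ψ))
  have hdiff : Differentiable ℂ (fun s => H1 s * LFunction χ s * LFunction ψ s * LFunction (χ * ψ) s) :=
    (((HH_diff _).mul (differentiable_LFunction hχ)).mul (differentiable_LFunction hψ)).mul (differentiable_LFunction hχψ)
  have := estermann (c := cL (1 : DirichletCharacter ℂ 1) + cL χ + cL ψ + cL (χ * ψ)) (F := fun s => LFunction (1 : DirichletCharacter ℂ 1) s * LFunction χ s * LFunction ψ s * LFunction (χ * ψ) s)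
    (H := fun s => H1 s * LFunction χ s * LFunction ψ s * LFunction (χ * ψ) s) (c0 := 1/64) (B := 60 * (25 * (N:ℝ)) ^ 3) (β := β) (M := M)
    ?_ hD.abscissa (fun s hs => (hD s hs).1) hdiff ?_ (by norm_num) ?_ ?_ hβ hβ1 ?_ ?_
  · have h3 : (H1 1 * LFunction χ 1 * LFunction ψ 1 * LFunction (χ * ψ) 1).re ≤ ‖LFunction χ 1‖ * ‖LFunction ψ 1‖ * ‖LFunction (χ * ψ) 1‖ := by
      rw [H1_one, one_mul, ← norm_mul, ← norm_mul]; exact Complex.re_le_norm _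
    set X := ‖LFunction χ 1‖ * ‖LFunction ψ 1‖ * ‖LFunction (χ * ψ) 1‖ with hX
    have hX0 : 0 ≤ X := by positivity
    have h4 : 0 ≤ (2 - β) ^ M := pow_nonneg (by linarith) _
    have h5 : (H1 1 * LFunction χ 1 * LFunction ψ 1 * LFunction (χ * ψ) 1).re * (2 - β) ^ M ≤ X * (3 * (3072 * (60 * (25 * (N:ℝ)) ^ 3)) ^ (6 * (1 - β))) := by
      gcongr
    have h6 : (3072 * (60 * (25 * (N:ℝ)) ^ 3)) ^ (6 * (1 - β)) ≤ (3000000000 * (N:ℝ) ^ 3) ^ (6 * (1 - β)) := by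
      refine Real.rpow_le_rpow (by positivity) ?_ (by linarith)
      have : (0:ℝ) ≤ (N:ℝ)^3 := by positivity
      nlinarith
    have h7 := mul_le_mul_of_nonneg_left h6 hX0
    norm_num at this h5 h7 ⊢
    linarith
  · intro n
    obtain ⟨r, hr1, hr2, hr⟩ := real_val' h2 (n : ZMod N)
    obtain ⟨r', hr1', hr2', hr'⟩ := real_val' h2' (n : ZMod N)
    have := Lam_nn n
    simp only [Pi.zero_apply, Pi.add_apply, cL, MulChar.mul_apply, hr, hr']
    rw [MulChar.one_apply (isUnit_of_subsingleton _)]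
    norm_cast
    have e : 1 * ArithmeticFunction.vonMangoldt n + r * ArithmeticFunction.vonMangoldt n + r' * ArithmeticFunction.vonMangoldt n + r * r' * ArithmeticFunction.vonMangoldt n
      = (1 + r) * (1 + r') * ArithmeticFunction.vonMangoldt n := by ring
    rw [e]
    exact mul_nonneg (mul_nonneg (by linarith) (by linarith)) this
  · intro s hs
    rw [H1_eq (by rintro rfl; simp at hs)]; ring
  · have h1 := L_two_one
    have h3 := L_two h2
    have h4 := L_two h2'
    have h5 := L_two h2''
    have p4 : (0:ℂ) ≤ ((1/4:ℝ):ℂ) := by norm_cast; norm_num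
    have p1 : (0:ℂ) ≤ ((1:ℝ):ℂ) := Complex.zero_le_real.2 zero_le_one
    have a1 := mul_le_mul h1 h3 p4 (p1.trans h1)
    have q1 := (mul_nonneg p1 p4)
    have a2 := mul_le_mul a1 h4 p4 (q1.trans a1)
    have q2 := mul_nonneg q1 p4
    have a3 := mul_le_mul a2 h5 p4 (q2.trans a2)
    refine le_trans ?_ a3
    norm_cast; norm_num
  · intro s hs
    obtain ⟨a, b, c⟩ := H1_bound hs
    simp only [norm_mul]
    have d1 := upper_simple hχ a b
    have d2 := upper_simple hψ a b
    have d3 := upper_simple hχψ a b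
    calc _ ≤ 60 * (25 * (N:ℝ)) * (25 * (N:ℝ)) * (25 * (N:ℝ)) := by gcongr
      _ = _ := by ring
  · simp [hz]
  · linarith

lemma upper_one {N : ℕ} [NeZero N] {χ : DirichletCharacter ℂ N} (hχ : χ ≠ 1) {ε : ℝ} (hε : 0 < ε) (hε2 : ε ≤ 1/4) :
    ‖LFunction χ 1‖ ≤ (100 + 2 / ε) * (2 * (N:ℝ)) ^ (2 * ε) := by
  have := upper_core χ hε hε2 (s := 1) (by simp; linarith) (by norm_num) (Or.inr hχ)
  simpa [ind, hχ, QQ, mul_comm] using this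

lemma L_changeLevel_le {q N : ℕ} [NeZero q] [NeZero N] (h : q ∣ N) {χ : DirichletCharacter ℂ q} (hχ : χ ≠ 1) :
    ‖LFunction (changeLevel h χ) 1‖ ≤ ‖LFunction χ 1‖ * 2 ^ N.primeFactors.card := by
  rw [LFunction_changeLevel h χ (Or.inl hχ), norm_mul, norm_prod]
  gcongr
  rw [← Finset.prod_const]
  refine Finset.prod_le_prod (fun _ _ => norm_nonneg _) fun p hp => ?_
  have hp1 : (1:ℝ) ≤ p := by exact_mod_cast (Nat.prime_of_mem_primeFactors hp).one_lt.le
  refine (norm_sub_le _ _).trans ?_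
  rw [norm_mul, norm_one, Complex.cpow_neg_one, norm_inv, Complex.norm_natCast]
  have h1 := norm_chi_le χ p
  have h2 : (p:ℝ)⁻¹ ≤ 1 := inv_le_one_of_one_le₀ hp1
  have h3 : (0:ℝ) ≤ (p:ℝ)⁻¹ := by positivity
  nlinarith [norm_nonneg (χ p)]

lemma L_pos {N : ℕ} [NeZero N] {χ : DirichletCharacter ℂ N} (hχ : χ ≠ 1) (h2 : χ ^ 2 = 1) {β : ℝ} (hβ : 0 < β) (hβ1 : β < 1)
    (hz : ∀ b : ℝ, β < b → b < 1 → LFunction χ b ≠ 0) : 0 ≤ (LFunction χ β).re := by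
  by_contra hneg
  push Not at hneg
  have hc : ContinuousOn (fun x : ℝ => (LFunction χ x).re) (Set.Icc β 2) :=
    (Complex.continuous_re.comp ((differentiable_LFunction hχ).continuous.comp Complex.continuous_ofReal)).continuousOn
  have h2p : 0 < (LFunction χ (2:ℝ)).re := by
    have := (Complex.le_def.1 (L_two h2)).1
    simp at this ⊢
    linarith
  obtain ⟨b, hb, hb0⟩ := intermediate_value_Icc (by linarith : β ≤ 2) hc (show (0:ℝ) ∈ _ from ⟨hneg.le, h2p.le⟩)
  simp only at hb0
  have hb1 : LFunction χ b = 0 := by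
    rw [L_real hχ h2 (lt_of_lt_of_le hβ hb.1), hb0]; simp
  rcases lt_or_ge b 1 with h | h
  · rcases eq_or_lt_of_le hb.1 with h' | h'
    · subst h'; linarith
    · exact hz b h' h hb1
  · exact LFunction_ne_zero_of_one_le_re χ (Or.inl hχ) (by simpa using h) hb1

end FixPt

namespace FixPt
open Complex MeasureTheory Finset Set Filter Topology DirichletCharacter
open scoped ComplexOrder

lemma three_pow_bound {N : ℝ} (hN : 1 ≤ N) {x η : ℝ} (hx : x ≤ η) :
    (3000000000 * N ^ 3) ^ (6 * x) ≤ (3000000000) ^ (6 * η) * N ^ (18 * η) := by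
  have h1 : (3000000000 * N ^ 3) ^ (6 * x) ≤ (3000000000 * N ^ 3) ^ (6 * η) :=
    Real.rpow_le_rpow_of_exponent_le (by nlinarith [one_le_pow₀ hN (n := 3)]) (by linarith)
  refine h1.trans (le_of_eq ?_)
  rw [Real.mul_rpow (by norm_num) (by positivity), ← Real.rpow_natCast, ← Real.rpow_mul (by linarith)]
  congr 2; push_cast; ring

lemma siegel_caseB {η : ℝ} (hη : 0 < η) (hη2 : η ≤ 1/4)
    (h : ∀ (q : ℕ) [NeZero q] (χ : DirichletCharacter ℂ q), χ ≠ 1 → χ ^ 2 = 1 → ∀ b : ℝ, 1 - η < b → b < 1 → LFunction χ b ≠ 0) :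
    ∃ c : ℝ, 0 < c ∧ ∀ (q : ℕ) [NeZero q] (χ : DirichletCharacter ℂ q), χ ≠ 1 → χ ^ 2 = 1 →
      c ≤ (q : ℝ) ^ (23 * η) * ‖LFunction χ 1‖ := by
  refine ⟨η / (384 * (3000000000) ^ (6 * η)), by positivity, fun q _ χ h1 h2 => ?_⟩
  have hq : (1 : ℝ) ≤ q := by exact_mod_cast NeZero.pos q
  have := one_char h1 h2 (β := 1 - η) (by linarith) (by linarith) (L_pos h1 h2 (by linarith) (by linarith) (h q χ h1 h2))
  have h3 := three_pow_bound hq (x := 1 - (1 - η)) (η := η) (by linarith)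
  have h4 : (q:ℝ) ^ (18 * η) ≤ (q : ℝ) ^ (23 * η) := Real.rpow_le_rpow_of_exponent_le hq (by linarith)
  rw [div_le_iff₀ (by positivity)]
  calc η ≤ 384 * (3000000000 * (q:ℝ) ^ 3) ^ (6 * (1 - (1 - η))) * ‖LFunction χ 1‖ := by linarith
    _ ≤ 384 * ((3000000000) ^ (6 * η) * (q:ℝ) ^ (23 * η)) * ‖LFunction χ 1‖ := by
      gcongr
      refine h3.trans ?_
      gcongr
    _ = _ := by ring

lemma siegel_caseA {η : ℝ} (hη : 0 < η) (hη2 : η ≤ 1/4) {q₁ : ℕ} [NeZero q₁] {χ₁ : DirichletCharacter ℂ q₁} (hχ₁ : χ₁ ≠ 1)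
    (hχ₁2 : χ₁ ^ 2 = 1) {b : ℝ} (hb : 1 - η < b) (hb1 : b < 1) (hz : LFunction χ₁ b = 0) :
    ∃ c : ℝ, 0 < c ∧ ∀ (q : ℕ) [NeZero q] (χ : DirichletCharacter ℂ q), χ ≠ 1 → χ ^ 2 = 1 →
      c ≤ (q : ℝ) ^ (23 * η) * ‖LFunction χ 1‖ := by
  obtain ⟨C, hC1, hC⟩ := omega_bound 2 η (by norm_num) hη
  set K : ℝ := 384 * (3000000000) ^ (6 * η) * ((100 + 2 / η) * 2 ^ (2 * η)) ^ 2 * C * (q₁:ℝ) ^ (23 * η) with hK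
  have hq₁ : (1 : ℝ) ≤ q₁ := by exact_mod_cast NeZero.pos q₁
  have hK0 : 0 < K := by positivity
  refine ⟨(1 - b) / K, div_pos (by linarith) hK0, fun q _ χ h1 h2 => ?_⟩
  have hq : (1 : ℝ) ≤ q := by exact_mod_cast NeZero.pos q
  rw [div_le_iff₀ hK0]
  have d1 : q₁ ∣ q₁ * q := dvd_mul_right _ _
  have d2 : q ∣ q₁ * q := dvd_mul_left _ _
  set ψ₁ := changeLevel d1 χ₁
  set ψ := changeLevel d2 χ
  have e1 : ψ₁ ≠ 1 := by rwa [Ne, changeLevel_eq_one_iff]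
  have e2 : ψ ≠ 1 := by rwa [Ne, changeLevel_eq_one_iff]
  have s1 : ψ₁ ^ 2 = 1 := by rw [← map_pow, hχ₁2, map_one]
  have s2 : ψ ^ 2 = 1 := by rw [← map_pow, h2, map_one]
  have hz1 : LFunction ψ₁ b = 0 := by rw [LFunction_changeLevel d1 χ₁ (Or.inl hχ₁), hz, zero_mul]
  set N : ℝ := ((q₁ * q : ℕ) : ℝ) with hNdef
  have hN : 1 ≤ N := by rw [hNdef]; push_cast; nlinarith
  have hNpos : 0 < N := by linarith
  set U : ℝ := (100 + 2 / η) * (2 * N) ^ (2 * η) with hU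
  have hU1 : 1 ≤ U := by
    have a : 0 < 2 / η := by positivity
    have : 1 ≤ (2 * N) ^ (2 * η) := Real.one_le_rpow (by linarith) (by linarith)
    nlinarith
  have u1 : ‖LFunction ψ₁ 1‖ ≤ U := upper_one e1 hη hη2
  have hm : (1 - b) ≤ 384 * (3000000000 * N ^ 3) ^ (6 * (1 - b)) * (U * ‖LFunction ψ 1‖ * U) := by
    by_cases e3 : ψ₁ * ψ = 1
    · have e4 : ψ = ψ₁ := by
        have : ψ₁ * ψ = ψ₁ * ψ₁ := by rw [e3, ← sq, s1]
        exact mul_left_cancel this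
      have := one_char e2 s2 (β := b) (by linarith) hb1 (by rw [e4, hz1]; simp)
      refine this.trans ?_
      gcongr
      nlinarith [norm_nonneg (LFunction ψ 1), mul_nonneg (norm_nonneg (LFunction ψ 1)) (by nlinarith : 0 ≤ U * U - 1)]
    · have := two_char e1 e2 e3 s1 s2 (β := b) (by linarith) hb1 hz1
      refine this.trans ?_
      have u3 : ‖LFunction (ψ₁ * ψ) 1‖ ≤ U := upper_one e3 hη hη2
      gcongr
  have t1 := three_pow_bound hN (x := 1 - b) (η := η) (by linarith)
  have t2 : ‖LFunction ψ 1‖ ≤ ‖LFunction χ 1‖ * (C * N ^ η) := by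
    refine (L_changeLevel_le d2 h1).trans ?_
    gcongr
    exact hC _ (NeZero.ne _)
  have t3 : U = (100 + 2 / η) * 2 ^ (2 * η) * N ^ (2 * η) := by
    rw [hU, Real.mul_rpow (by norm_num) hNpos.le]; ring
  have t4 : N ^ (23 * η) = (q₁:ℝ) ^ (23 * η) * (q:ℝ) ^ (23 * η) := by
    rw [hNdef]; push_cast; rw [Real.mul_rpow (by linarith) (by linarith)]
  have t5 : N ^ (23 * η) = N ^ (18 * η) * N ^ (2 * η) * N ^ (2 * η) * N ^ η := by
    rw [← Real.rpow_add hNpos, ← Real.rpow_add hNpos, ← Real.rpow_add hNpos]; congr 1; ring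
  calc 1 - b ≤ _ := hm
    _ ≤ 384 * ((3000000000) ^ (6 * η) * N ^ (18 * η)) * (U * (‖LFunction χ 1‖ * (C * N ^ η)) * U) := by gcongr
    _ = ‖LFunction χ 1‖ * (384 * (3000000000) ^ (6 * η) * ((100 + 2 / η) * 2 ^ (2 * η)) ^ 2 * C) * N ^ (23 * η) := by
      rw [t3, t5]; ring
    _ = _ := by rw [t4, hK]; ring

theorem siegel {ε : ℝ} (hε : 0 < ε) : ∃ c : ℝ, 0 < c ∧ ∀ (q : ℕ) [NeZero q] (χ : DirichletCharacter ℂ q), χ ≠ 1 → χ ^ 2 = 1 →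
      c * (q : ℝ) ^ (-ε) ≤ ‖LFunction χ 1‖ := by
  set η := min (ε / 23) (1/4) with hηd
  have hη : 0 < η := by positivity
  have hη2 : η ≤ 1/4 := min_le_right _ _
  have hη3 : 23 * η ≤ ε := by have := min_le_left (ε / 23) (1/4); rw [← hηd] at this; linarith
  have main : ∃ c : ℝ, 0 < c ∧ ∀ (q : ℕ) [NeZero q] (χ : DirichletCharacter ℂ q), χ ≠ 1 → χ ^ 2 = 1 →
      c ≤ (q : ℝ) ^ (23 * η) * ‖LFunction χ 1‖ := by
    by_cases h : ∀ (q : ℕ) [NeZero q] (χ : DirichletCharacter ℂ q), χ ≠ 1 → χ ^ 2 = 1 → ∀ b : ℝ, 1 - η < b → b < 1 → LFunction χ b ≠ 0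
    · exact siegel_caseB hη hη2 h
    · push Not at h
      obtain ⟨q, _, χ, h1, h2, b, hb, hb1, hz⟩ := h
      exact siegel_caseA hη hη2 h1 h2 hb hb1 hz
  obtain ⟨c, hc, hh⟩ := main
  refine ⟨c, hc, fun q _ χ h1 h2 => ?_⟩
  have hq : (1 : ℝ) ≤ q := by exact_mod_cast NeZero.pos q
  rw [Real.rpow_neg (by linarith), ← div_eq_mul_inv, div_le_iff₀ (by positivity), mul_comm]
  refine (hh q χ h1 h2).trans ?_
  gcongr

end FixPt

namespace FixPt
open Complex MeasureTheory Finset Set Filter Topology DirichletCharacter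

lemma QQ_ge_q {q : ℕ} [NeZero q] (s : ℂ) : (q : ℝ) ≤ QQ q s := by
  have hq : (1 : ℝ) ≤ q := by exact_mod_cast NeZero.pos q
  have := abs_nonneg s.im
  unfold QQ; nlinarith

lemma near_one {q : ℕ} [NeZero q] {χ : DirichletCharacter ℂ q} (hχ : χ ≠ 1) {e : ℝ} (he : 0 < e) (he2 : e ≤ 1/4) {s : ℂ}
    (h1 : 1 < s.re) (h2 : s.re ≤ 2) (h3 : |s.im| ≤ 1) :
    ‖LFunction χ s - LFunction χ 1‖ ≤ KK e * (3 * (q:ℝ) ^ (2 * e)) * ‖s - 1‖ := by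
  have hq : (1 : ℝ) ≤ q := by exact_mod_cast NeZero.pos q
  have hK := (KK_ge he he2).2
  set S : Set ℂ := {z | 1 ≤ z.re ∧ z.re ≤ 2 ∧ -1 ≤ z.im ∧ z.im ≤ 1}
  have hS : Convex ℝ S := by
    have a := (convex_halfSpace_re_ge (1:ℝ)).inter ((convex_halfSpace_re_le (2:ℝ)).inter ((convex_halfSpace_im_ge (-1:ℝ)).inter (convex_halfSpace_im_le (1:ℝ))))
    exact a
  refine hS.norm_image_sub_le_of_norm_deriv_le (f := LFunction χ) (fun z _ => differentiable_LFunction hχ z) (fun z hz => ?_) ?_ ?_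
  · refine (deriv_upper he he2 hz.1 hz.2.1 (Or.inl hχ)).trans ?_
    gcongr
    have hz3 : |z.im| ≤ 1 := abs_le.2 ⟨hz.2.2.1, hz.2.2.2⟩
    have : QQ q z ≤ 3 * q := by unfold QQ; nlinarith
    calc QQ q z ^ (2 * e) ≤ (3 * (q:ℝ)) ^ (2 * e) := Real.rpow_le_rpow (by have := QQ_ge (q := q) z; linarith) this (by linarith)
      _ = 3 ^ (2 * e) * (q:ℝ) ^ (2 * e) := Real.mul_rpow (by norm_num) (by linarith)
      _ ≤ 3 ^ (1:ℝ) * (q:ℝ) ^ (2 * e) := by gcongr <;> linarith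
      _ = _ := by norm_num
  · exact ⟨by simp, by simp, by simp, by simp⟩
  · exact ⟨h1.le, h2, (abs_le.1 h3).1, (abs_le.1 h3).2⟩

lemma lower_dir' {q : ℕ} [NeZero q] (χ : DirichletCharacter ℂ q) {s : ℂ}
    (h1 : 1 < s.re) (h2 : s.re ≤ 2) : (s.re - 1) / 10 ≤ ‖LFunction χ s‖ := by
  have hp : 0 < s.re - 1 := by linarith
  have hM := L_le_zeta (χ ^ 2) (s := (s.re : ℂ) + 2 * s.im * I) (by simpa using h1) (by simpa using h2)
  have e : ((s.re : ℂ) + 2 * s.im * I).re = s.re := by simp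
  rw [e] at hM
  have := lower_direct χ h1 h2 (M := 10 / (s.re - 1)) (by positivity) hM
  rw [Complex.re_add_im] at this
  have e2 : ((s.re - 1) / 10) ^ 3 / (10 / (s.re - 1)) = ((s.re - 1) / 10) ^ 4 := by field_simp
  rw [e2] at this
  exact le_of_pow_le_pow_left₀ (by norm_num) (norm_nonneg _) this

theorem lower_full {ε : ℝ} (hε : 0 < ε) : ∃ c : ℝ, 0 < c ∧ ∀ (q : ℕ) [NeZero q] (χ : DirichletCharacter ℂ q) (s : ℂ),
    1 < s.re → s.re ≤ 2 → (χ ≠ 1 ∨ 1 ≤ |s.im|) → c * QQ q s ^ (-ε) ≤ ‖LFunction χ s‖ := by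
  set e := min (ε / 20) (1/4) with hed
  have he : 0 < e := by positivity
  have he2 : e ≤ 1/4 := min_le_right _ _
  have he3 : 20 * e ≤ ε := by have := min_le_left (ε / 20) (1/4); rw [← hed] at this; linarith
  obtain ⟨c1, hc1, hsieg⟩ := siegel he
  have hK := (KK_ge he he2).2
  set c2 := min 1 (c1 / (6 * KK e)) with hc2d
  have hc2 : 0 < c2 := by positivity
  have hc21 : c2 ≤ 1 := min_le_left _ _
  have hc22 : c2 * (6 * KK e) ≤ c1 := by
    have := min_le_right 1 (c1 / (6 * KK e)); rw [← hc2d] at this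
    rwa [← le_div_iff₀ (by positivity)]
  set W := 2 / c2 with hW
  have hW1 : 1 ≤ W := by rw [hW, le_div_iff₀ hc2]; linarith
  set c := min (1 / (16000 * (4 * KK e * W) ^ 4)) (min (c1 / 2) (c2 / 20)) with hcd
  have hca : c ≤ 1 / (16000 * (4 * KK e * W) ^ 4) := min_le_left _ _
  have hcb : c ≤ c1 / 2 := (min_le_right _ _).trans (min_le_left _ _)
  have hcc : c ≤ c2 / 20 := (min_le_right _ _).trans (min_le_right _ _)
  have hc0 : 0 < c := by positivity
  refine ⟨c, hc0, fun q _ χ s h1 h2 h3 => ?_⟩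
  have hQ := QQ_ge (q := q) s
  have hQq := QQ_ge_q (q := q) s
  have hq : (1 : ℝ) ≤ q := by exact_mod_cast NeZero.pos q
  set Q := QQ q s with hQd
  have hQ0 : 0 < Q := by linarith
  have hQm (a b : ℝ) (hab : a ≤ b) : Q ^ a ≤ Q ^ b := Real.rpow_le_rpow_of_exponent_le (by linarith) hab
  refine le_trans (mul_le_mul_of_nonneg_left (hQm (-ε) (-(20 * e)) (by linarith)) hc0.le) ?_
  have case341 (h4 : χ ^ 2 ≠ 1 ∨ 1 ≤ |s.im| * (W * Q ^ (3 * e))) : c * Q ^ (-(20 * e)) ≤ ‖LFunction χ s‖ := by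
    have hQ1 : 1 ≤ Q ^ (3 * e) := Real.one_le_rpow (by linarith) (by linarith)
    refine le_trans ?_ (lower_341' he he2 h1 h2 h3 (w := W * Q ^ (3 * e)) (by nlinarith) h4)
    rw [← hQd]
    have e1 : 16000 * (4 * KK e * Q ^ (2 * e) * (W * Q ^ (3 * e))) ^ 4 = 16000 * (4 * KK e * W) ^ 4 * Q ^ (20 * e) := by
      have : Q ^ (20 * e) = (Q ^ (2 * e) * Q ^ (3 * e)) ^ 4 := by
        rw [← Real.rpow_add hQ0, ← Real.rpow_natCast, ← Real.rpow_mul hQ0.le]; congr 1; push_cast; ring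
      rw [this]; ring
    rw [e1, Real.rpow_neg hQ0.le, ← one_div_mul_one_div, one_div (Q ^ (20 * e))]
    gcongr
  by_cases hχ2 : χ ^ 2 = 1
  swap
  · exact case341 (Or.inl hχ2)
  by_cases hr : c2 * Q ^ (-(3 * e)) / 2 ≤ |s.im|
  · refine case341 (Or.inr ?_)
    have : 1 = c2 * Q ^ (-(3 * e)) / 2 * (W * Q ^ (3 * e)) := by
      rw [hW, Real.rpow_neg hQ0.le]; field_simp
    rw [this]
    gcongr
  push Not at hr
  have hQs : Q ^ (-(3 * e)) ≤ 1 := Real.rpow_le_one_of_one_le_of_nonpos (by linarith) (by linarith)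
  have hQp : 0 < Q ^ (-(3 * e)) := by positivity
  have him : |s.im| < 1 := by nlinarith
  have hχ : χ ≠ 1 := h3.resolve_right (by linarith)
  by_cases hσ : c2 * Q ^ (-(3 * e)) / 2 ≤ s.re - 1
  · have := lower_dir' χ h1 h2
    have h5 := hQm (-(20 * e)) (-(3*e)) (by linarith)
    have h6 : c * Q ^ (-(20 * e)) ≤ c2 / 20 * Q ^ (-(3 * e)) := by gcongr
    linarith
  push Not at hσ
  have hns : ‖s - 1‖ ≤ c2 * Q ^ (-(3 * e)) := by
    refine (Complex.norm_le_abs_re_add_abs_im _).trans ?_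
    simp only [Complex.sub_re, Complex.one_re, Complex.sub_im, Complex.one_im, sub_zero]
    rw [abs_of_pos (by linarith : 0 < s.re - 1)]
    linarith
  have h7 := near_one hχ he he2 h1 h2 him.le
  have h8 : KK e * (3 * (q:ℝ) ^ (2 * e)) * ‖s - 1‖ ≤ c1 / 2 * (q:ℝ) ^ (-e) := by
    have a1 : Q ^ (-(3 * e)) ≤ (q:ℝ) ^ (-(3 * e)) := Real.rpow_le_rpow_of_nonpos (by linarith) hQq (by linarith)
    have a2 : (q:ℝ) ^ (-e) = (q:ℝ) ^ (2 * e) * (q:ℝ) ^ (-(3 * e)) := by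
      rw [← Real.rpow_add (by linarith)]; congr 1; ring
    have a3 : ‖s - 1‖ ≤ c2 * (q:ℝ) ^ (-(3 * e)) := hns.trans (by gcongr)
    rw [a2]
    calc KK e * (3 * (q:ℝ) ^ (2 * e)) * ‖s - 1‖ ≤ KK e * (3 * (q:ℝ) ^ (2 * e)) * (c2 * (q:ℝ) ^ (-(3 * e))) := by gcongr
      _ = c2 * (6 * KK e) / 2 * ((q:ℝ) ^ (2 * e) * (q:ℝ) ^ (-(3 * e))) := by ring
      _ ≤ _ := by gcongr
  have h9 := hsieg q χ hχ hχ2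
  have h10 := norm_sub_norm_le (LFunction χ 1) (LFunction χ s)
  rw [norm_sub_rev] at h10
  have h11 : c * Q ^ (-(20 * e)) ≤ c1 / 2 * (q:ℝ) ^ (-e) := by
    have a1 : Q ^ (-(20 * e)) ≤ (q:ℝ) ^ (-e) := (hQm _ _ (by linarith)).trans (Real.rpow_le_rpow_of_nonpos (by linarith) hQq (by linarith))
    gcongr
  linarith

end FixPt

namespace FixPt
open Complex MeasureTheory Finset Set Filter Topology DirichletCharacter

lemma logderiv_generic {f : ℂ → ℂ} {s : ℂ} {r M m : ℝ} (hr : 0 < r) (hm : 0 < m)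
    (hd : ∀ z, ‖z - s‖ ≤ r → DifferentiableAt ℂ f z) (hM : ∀ z, ‖z - s‖ ≤ r → ‖f z‖ ≤ M) (h0 : m ≤ ‖f s‖) (k : ℕ) :
    ‖iteratedDeriv k (fun z => deriv f z / f z) s‖ ≤ k.factorial * (4 * M / (m * r)) ^ (k + 1) := by
  have hmM : m ≤ M := h0.trans (hM s (by simpa using hr.le))
  have hM0 : 0 < M := by linarith
  set ρ := m * r / (4 * M) with hρ
  have hρ0 : 0 < ρ := by positivity
  have hρr : ρ ≤ r / 4 := by
    rw [hρ, div_le_iff₀ (by positivity)]; nlinarith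
  have hder : ∀ z, ‖z - s‖ ≤ r / 2 → ‖deriv f z‖ ≤ 2 * M / r := by
    intro z hz
    have := Complex.norm_deriv_le_of_forall_mem_sphere_norm_le (f := f) (c := z) (R := r / 2) (C := M) (by linarith) ?_ ?_
    · refine this.trans (le_of_eq (by field_simp))
    · refine DifferentiableOn.diffContOnCl fun w hw => (hd w ?_).differentiableWithinAt
      rw [closure_ball _ (by positivity), mem_closedBall_iff_norm] at hw
      have := norm_add_le (w - z) (z - s)
      rw [sub_add_sub_cancel] at this; linarith
    · intro w hw
      rw [mem_sphere_iff_norm] at hw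
      have := norm_add_le (w - z) (z - s)
      rw [sub_add_sub_cancel] at this
      exact hM w (by linarith)
  have hlow : ∀ z, ‖z - s‖ ≤ ρ → m / 2 ≤ ‖f z‖ := by
    intro z hz
    have h1 := (convex_closedBall s (r/2)).norm_image_sub_le_of_norm_deriv_le (f := f) (x := s) (y := z) (C := 2 * M / r)
      (fun w hw => hd w (by rw [mem_closedBall_iff_norm] at hw; linarith)) (fun w hw => hder w (by rwa [mem_closedBall_iff_norm] at hw))
      (by simp; linarith) (by rw [mem_closedBall_iff_norm]; linarith)
    have h2 : 2 * M / r * ‖z - s‖ ≤ m / 2 := by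
      calc 2 * M / r * ‖z - s‖ ≤ 2 * M / r * ρ := by gcongr
        _ = m / 2 := by rw [hρ]; field_simp; norm_num
    have h3 := norm_sub_norm_le (f s) (f z)
    rw [norm_sub_rev] at h3
    linarith
  have hne : ∀ z, ‖z - s‖ ≤ ρ → f z ≠ 0 := fun z hz h => by
    have := hlow z hz; rw [h, norm_zero] at this; linarith
  have hdd : DifferentiableOn ℂ (deriv f) (Metric.ball s r) := by
    refine DifferentiableOn.deriv (fun z hz => (hd z ?_).differentiableWithinAt) Metric.isOpen_ball
    rw [mem_ball_iff_norm] at hz; exact hz.le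
  have := Complex.norm_iteratedDeriv_le_of_forall_mem_sphere_norm_le (f := fun z => deriv f z / f z) (c := s) (R := ρ) (C := 4 * M / (m * r)) k hρ0 ?_ ?_
  · refine this.trans (le_of_eq ?_)
    rw [hρ, pow_succ, div_pow (m * r), div_pow (4 * M)]
    field_simp
  · refine DifferentiableOn.diffContOnCl fun w hw => ?_
    rw [closure_ball _ (by positivity), mem_closedBall_iff_norm] at hw
    refine DifferentiableAt.differentiableWithinAt (DifferentiableAt.div ?_ (hd w (by linarith)) (hne w hw))
    exact hdd.differentiableAt (Metric.isOpen_ball.mem_nhds (by rw [mem_ball_iff_norm]; linarith))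
  · intro w hw
    rw [mem_sphere_iff_norm] at hw
    rw [norm_div]
    have h1 := hder w (by linarith)
    have h2 := hlow w hw.le
    calc ‖deriv f w‖ / ‖f w‖ ≤ (2 * M / r) / (m / 2) := by gcongr
      _ = _ := by field_simp; norm_num

lemma logderiv_bound (k : ℕ) {δ : ℝ} (hδ : 0 < δ) : ∃ C : ℝ, 0 < C ∧ ∀ (q : ℕ) [NeZero q] (χ : DirichletCharacter ℂ q) (s : ℂ),
    1 < s.re → s.re ≤ 2 → (χ ≠ 1 ∨ 1 ≤ |s.im|) →
    ‖iteratedDeriv k (fun z => deriv (LFunction χ) z / LFunction χ z) s‖ ≤ C * QQ q s ^ δ := by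
  set ε := min (δ / (3 * (k + 1))) (1/4) with hε
  have he : 0 < ε := by positivity
  have he2 : ε ≤ 1/4 := min_le_right _ _
  have he3 : 3 * ε * (k + 1) ≤ δ := by
    have := min_le_left (δ / (3 * ((k:ℝ) + 1))) (1/4)
    rw [← hε, le_div_iff₀ (by positivity)] at this
    linarith
  obtain ⟨c, hc, hl⟩ := lower_full he
  refine ⟨k.factorial * (4 * (5 * (100 + 2 / ε)) / (c * ε)) ^ (k + 1), by positivity, fun q _ χ s h1 h2 h3 => ?_⟩
  have hQ := QQ_ge (q := q) s
  set Q := QQ q s with hQd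
  have hQ0 : 0 < Q := by linarith
  have := logderiv_generic (f := LFunction χ) (s := s) (r := ε) (M := 5 * (100 + 2 / ε) * Q ^ (2 * ε)) (m := c * Q ^ (-ε)) he (by positivity)
    (fun z hz => (local_upper he he2 h1.le h2 h3 hz).1) (fun z hz => (local_upper he he2 h1.le h2 h3 hz).2) (hl q χ s h1 h2 h3) k
  refine this.trans ?_
  have e1 : 4 * (5 * (100 + 2 / ε) * Q ^ (2 * ε)) / (c * Q ^ (-ε) * ε) = 4 * (5 * (100 + 2 / ε)) / (c * ε) * Q ^ (3 * ε) := by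
    have : Q ^ (2 * ε) = Q ^ (3 * ε) * Q ^ (-ε) := by rw [← Real.rpow_add hQ0]; congr 1; ring
    rw [this]
    field_simp
  rw [e1, mul_pow, ← mul_assoc]
  gcongr
  rw [← Real.rpow_natCast, ← Real.rpow_mul hQ0.le]
  refine Real.rpow_le_rpow_of_exponent_le (by linarith) ?_
  push_cast; linarith

lemma iter_upper (k : ℕ) {δ : ℝ} (hδ : 0 < δ) : ∃ C : ℝ, 0 < C ∧ ∀ (q : ℕ) [NeZero q] (χ : DirichletCharacter ℂ q) (s : ℂ),
    1 < s.re → s.re ≤ 2 → (χ ≠ 1 ∨ 1 ≤ |s.im|) →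
    ‖iteratedDeriv k (LFunction χ) s‖ ≤ C * QQ q s ^ δ := by
  set ε := min (δ / 2) (1/4) with hε
  have he : 0 < ε := by positivity
  have he2 : ε ≤ 1/4 := min_le_right _ _
  have he3 : 2 * ε ≤ δ := by
    have := min_le_left (δ / 2) (1/4)
    rw [← hε] at this
    linarith
  refine ⟨k.factorial * (5 * (100 + 2 / ε)) / ε ^ k, by positivity, fun q _ χ s h1 h2 h3 => ?_⟩
  have hQ := QQ_ge (q := q) s
  have := Complex.norm_iteratedDeriv_le_of_forall_mem_sphere_norm_le (f := LFunction χ) (c := s) (R := ε) (C := 5 * (100 + 2 / ε) * QQ q s ^ (2 * ε)) k he ?_ ?_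
  · refine this.trans ?_
    have h4 : QQ q s ^ (2 * ε) ≤ QQ q s ^ δ := Real.rpow_le_rpow_of_exponent_le (by linarith) he3
    calc _ = k.factorial * (5 * (100 + 2 / ε)) / ε ^ k * QQ q s ^ (2 * ε) := by ring
      _ ≤ _ := by gcongr
  · refine DifferentiableOn.diffContOnCl fun w hw => ?_
    rw [closure_ball _ (by positivity), mem_closedBall_iff_norm] at hw
    exact (local_upper he he2 h1.le h2 h3 hw).1.differentiableWithinAt
  · intro w hw
    rw [mem_sphere_iff_norm] at hw
    exact (local_upper he he2 h1.le h2 h3 hw.le).2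

end FixPt

namespace FixPt
open Complex MeasureTheory Finset Set Filter Topology DirichletCharacter

lemma reopen : IsOpen {s : ℂ | 1 < s.re} := isOpen_lt continuous_const Complex.continuous_re

lemma cL_series {q : ℕ} [NeZero q] (χ : DirichletCharacter ℂ q) {s : ℂ} (hs : 1 < s.re) :
    LSeries (cL χ) s = -(deriv (LFunction χ) s / LFunction χ s) := by
  have e : LSeries (cL χ) s = _ := LSeries_twist_vonMangoldt_eq χ hs
  rw [e, ← LFunction_eq_LSeries χ hs, ← deriv_LFunction_eq_deriv_LSeries χ hs, neg_div]

theorem D_chi (k : ℕ) : ∃ C : ℝ, 0 < C ∧ ∀ (q : ℕ) [NeZero q] (χ : DirichletCharacter ℂ q) (_ : χ ≠ 1) (s : ℂ),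
    1 < s.re → s.re ≤ 2 → ‖LSeries (LSeries.logMul^[k] (cL χ)) s‖ ≤ C * (q:ℝ) ^ (1/2 : ℝ) * (2 + |s.im|) ^ (1/2 : ℝ) := by
  obtain ⟨C, hC, h⟩ := logderiv_bound k (δ := 1/2) (by norm_num)
  refine ⟨C, hC, fun q _ χ hχ s h1 h2 => ?_⟩
  have h3 := h q χ s h1 h2 (Or.inl hχ)
  have h4 := LSeries_iteratedDeriv (f := cL χ) k (s := s) (lt_of_le_of_lt (Dat_L χ).abscissa (by exact_mod_cast h1))
  have h5 : Set.EqOn (LSeries (cL χ)) (fun z => -(deriv (LFunction χ) z / LFunction χ z)) {s : ℂ | 1 < s.re} := fun z hz => cL_series χ hz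
  rw [h5.iteratedDeriv_of_isOpen reopen k h1, iteratedDeriv_fun_neg] at h4
  have h6 := congrArg norm h4
  rw [norm_neg, norm_mul, norm_pow, norm_neg, norm_one, one_pow, one_mul] at h6
  rw [← h6, mul_assoc, ← Real.mul_rpow (by positivity) (by positivity)]
  exact h3

lemma H1_ne {s : ℂ} (hs : 1 ≤ s.re) : H1 s ≠ 0 := by
  by_cases h : s = 1
  · rw [h, H1_one]; exact one_ne_zero
  · rw [H1_eq h]
    exact mul_ne_zero (sub_ne_zero.2 h) (LFunction_ne_zero_of_one_le_re _ (Or.inr h) hs)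

lemma one_LS {s : ℂ} (hs : 1 < s.re) : LSeries 1 s = LFunction (1 : DirichletCharacter ℂ 1) s := by
  rw [LFunction_modOne_eq, LSeries_one_eq_riemannZeta hs]

noncomputable def a1 : ℕ → ℂ := cL (1 : DirichletCharacter ℂ 1) - 1

lemma a1_series {s : ℂ} (hs : 1 < s.re) : LSeriesSummable a1 s ∧ 
    LSeries a1 s = -(deriv (LFunction (1 : DirichletCharacter ℂ 1)) s / LFunction (1 : DirichletCharacter ℂ 1) s) - LFunction (1 : DirichletCharacter ℂ 1) s := by
  have h1 := (Dat_L (1 : DirichletCharacter ℂ 1) s hs).2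
  have h2 : LSeriesSummable 1 s := LSeriesSummable_one_iff.2 hs
  refine ⟨h1.sub h2, ?_⟩
  unfold a1
  rw [LSeries_sub h1 h2, cL_series _ hs, one_LS hs]

lemma a1_series' {s : ℂ} (hs : 1 < s.re) : LSeries a1 s = -(deriv H1 s / H1 s) - dslope H1 1 s := by
  have hs1 : s ≠ 1 := by rintro rfl; simp at hs
  have hs0 : s - 1 ≠ 0 := sub_ne_zero.2 hs1
  rw [(a1_series hs).2, dslope_of_ne _ hs1, slope_def_field, H1_one, H1_eq hs1]
  have hd : deriv H1 s = LFunction (1 : DirichletCharacter ℂ 1) s + (s - 1) * deriv (LFunction (1 : DirichletCharacter ℂ 1)) s := by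
    have e : H1 =ᶠ[𝓝 s] fun z => (z - 1) * LFunction (1 : DirichletCharacter ℂ 1) z := by
      filter_upwards [isOpen_ne.mem_nhds hs1] with z hz using H1_eq hz
    rw [e.deriv_eq]
    have := ((hasDerivAt_id s).sub_const 1).mul (differentiableAt_LFunction (1 : DirichletCharacter ℂ 1) s (Or.inl hs1)).hasDerivAt
    exact (HasDerivAt.deriv this).trans (by simp)
  rw [hd]
  have h0 : LFunction (1 : DirichletCharacter ℂ 1) s ≠ 0 := LFunction_ne_zero_of_one_le_re _ (Or.inr hs1) hs.le
  field_simp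
  ring

lemma a1_abs : LSeries.abscissaOfAbsConv a1 ≤ 1 := by
  refine LSeries.abscissaOfAbsConv_le_of_forall_lt_LSeriesSummable (x := 1) ?_
  intro y hy
  exact (a1_series (by simpa using hy)).1

theorem D_one (k : ℕ) : ∃ C : ℝ, 0 < C ∧ ∀ (s : ℂ),
    1 < s.re → s.re ≤ 2 → ‖LSeries (LSeries.logMul^[k] a1) s‖ ≤ C * (2 + |s.im|) ^ (1/2 : ℝ) := by
  obtain ⟨C, hC, h⟩ := logderiv_bound k (δ := 1/2) (by norm_num)
  obtain ⟨C', hC', h'⟩ := iter_upper k (δ := 1/2) (by norm_num)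
  -- compact part
  set E : ℂ → ℂ := fun s => -(deriv H1 s / H1 s) - dslope H1 1 s with hE
  have hd : Differentiable ℂ H1 := HH_diff _
  have hd2 : Differentiable ℂ (dslope H1 1) := by
    have := hd
    rw [← differentiableOn_univ] at this ⊢
    exact (Complex.differentiableOn_dslope Filter.univ_mem).2 this
  set U : Set ℂ := {s | H1 s ≠ 0}
  have hU : IsOpen U := isOpen_ne.preimage hd.continuous
  have hEd : DifferentiableOn ℂ E U := by
    intro s hs
    refine DifferentiableAt.differentiableWithinAt ?_
    exact (((hd.deriv s).div (hd s) hs).neg).sub (hd2 s)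
  have hcont : ContinuousOn (iteratedDeriv k E) U := by
    intro s hs
    refine ContinuousAt.continuousWithinAt ?_
    have : AnalyticAt ℂ E s := hEd.analyticAt (hU.mem_nhds hs)
    exact (this.iterated_deriv k |>.continuousAt.congr (by rw [iteratedDeriv_eq_iterate]))
  have hcomp : IsCompact (Set.Icc (1:ℝ) 2 ×ℂ Set.Icc (-1:ℝ) 1 : Set ℂ) := isCompact_Icc.reProdIm isCompact_Icc
  have hsub : (Set.Icc (1:ℝ) 2 ×ℂ Set.Icc (-1:ℝ) 1 : Set ℂ) ⊆ U := by
    intro s hs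
    rw [Complex.mem_reProdIm] at hs
    exact H1_ne hs.1.1
  obtain ⟨B, hB⟩ := hcomp.exists_bound_of_continuousOn (hcont.mono hsub)
  have hB0 : 0 ≤ B := (norm_nonneg _).trans (hB 1 (by rw [Complex.mem_reProdIm]; norm_num))
  refine ⟨C + C' + B, by positivity, fun s h1 h2 => ?_⟩
  have hp : 1 ≤ (2 + |s.im|) ^ (1/2 : ℝ) := Real.one_le_rpow (by have := abs_nonneg s.im; linarith) (by norm_num)
  have h4 := LSeries_iteratedDeriv (f := a1) k (s := s) (lt_of_le_of_lt a1_abs (by exact_mod_cast h1))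
  have h6 := congrArg norm h4
  rw [norm_mul, norm_pow, norm_neg, norm_one, one_pow, one_mul] at h6
  rw [← h6]
  by_cases him : 1 ≤ |s.im|
  · have h5 : Set.EqOn (LSeries a1) (fun z => -(deriv (LFunction (1 : DirichletCharacter ℂ 1)) z / LFunction (1 : DirichletCharacter ℂ 1) z) - LFunction (1 : DirichletCharacter ℂ 1) z) {s : ℂ | 1 < s.re} := fun z hz => (a1_series hz).2
    have hLd : DifferentiableOn ℂ (LFunction (1 : DirichletCharacter ℂ 1)) {s : ℂ | 1 < s.re} := fun z hz =>
      (differentiableAt_LFunction _ z (Or.inl (by rintro rfl; simp at hz))).differentiableWithinAt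
    have hL0 : ∀ z ∈ {s : ℂ | 1 < s.re}, LFunction (1 : DirichletCharacter ℂ 1) z ≠ 0 := fun z hz =>
      LFunction_ne_zero_of_one_le_re _ (Or.inr (by rintro rfl; simp at hz)) (le_of_lt hz)
    have hLL : DifferentiableOn ℂ (fun z => -(deriv (LFunction (1 : DirichletCharacter ℂ 1)) z / LFunction (1 : DirichletCharacter ℂ 1) z)) {s : ℂ | 1 < s.re} :=
      ((hLd.deriv reopen).div hLd hL0).neg
    rw [h5.iteratedDeriv_of_isOpen reopen k h1, iteratedDeriv_fun_sub ((hLL.contDiffOn reopen).contDiffAt (reopen.mem_nhds h1)) ((hLd.contDiffOn reopen).contDiffAt (reopen.mem_nhds h1)),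
      iteratedDeriv_fun_neg]
    refine (norm_sub_le _ _).trans ?_
    rw [norm_neg]
    have a := h 1 1 s h1 h2 (Or.inr him)
    have b := h' 1 1 s h1 h2 (Or.inr him)
    simp only [QQ, Nat.cast_one, one_mul] at a b
    have : 0 ≤ B * (2 + |s.im|) ^ (1/2 : ℝ) := by positivity
    linarith
  · have h5 : Set.EqOn (LSeries a1) E {s : ℂ | 1 < s.re} := fun z hz => a1_series' hz
    rw [h5.iteratedDeriv_of_isOpen reopen k h1]
    have := hB s (by
      rw [Complex.mem_reProdIm]
      push Not at him
      exact ⟨⟨h1.le, h2⟩, abs_le.1 him.le⟩)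
    nlinarith

end FixPt

namespace FixPt
open Complex MeasureTheory Finset Set Filter Topology DirichletCharacter

noncomputable def ff : ℝ → ℂ := fun u => (Set.Ioc (0:ℝ) 1).indicator (fun _ => (1:ℂ)) u - (Set.Ioc (0:ℝ) 1).indicator (fun t => (t:ℂ) ^ (1:ℂ)) u

lemma ff_eq {u : ℝ} (hu : 0 < u) : ff u = ((max 0 (1 - u) : ℝ) : ℂ) := by
  unfold ff
  by_cases h : u ≤ 1
  · have hm : u ∈ Set.Ioc (0:ℝ) 1 := ⟨hu, h⟩
    rw [Set.indicator_of_mem hm, Set.indicator_of_mem hm, max_eq_right (by linarith)]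
    simp
  · rw [Set.indicator_of_notMem (fun x => h x.2), Set.indicator_of_notMem (fun x => h x.2), max_eq_left (by linarith)]
    simp

lemma ff_cont {u : ℝ} (hu : 0 < u) : ContinuousAt ff u := by
  have : ContinuousAt (fun u : ℝ => ((max 0 (1 - u) : ℝ) : ℂ)) u := by fun_prop
  refine this.congr ?_
  filter_upwards [lt_mem_nhds hu] with v hv using (ff_eq hv).symm

lemma ff_mellin {s : ℂ} (hs : 0 < s.re) : HasMellin ff s (1 / s - 1 / (s + 1)) := 
  by
  have h1 := hasMellin_one_Ioc hs
  have h2 := hasMellin_cpow_Ioc (1:ℂ) (s := s) (by simp; linarith)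
  have := hasMellin_sub h1.1 h2.1
  rw [h1.2, h2.2] at this
  exact this

lemma ss_norm {σ : ℝ} (hσ : 1 ≤ σ) (y : ℝ) : ‖1 / ((σ:ℂ) + y * I) - 1 / ((σ:ℂ) + y * I + 1)‖ ≤ (1 + y ^ 2)⁻¹ := by
  have h1 : (σ:ℂ) + y * I ≠ 0 := by
    intro h; have := congrArg re h; simp at this; linarith
  have h2 : (σ:ℂ) + y * I + 1 ≠ 0 := by
    intro h; have := congrArg re h; simp at this; linarith
  rw [div_sub_div _ _ h1 h2]
  rw [show (1 * ((σ:ℂ) + y * I + 1) - (σ + y * I) * 1) = 1 by ring, one_div, norm_inv, norm_mul]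
  refine inv_anti₀ (by positivity) ?_
  have e1 : 1 + y ^ 2 ≤ ‖(σ:ℂ) + y * I‖ ^ 2 := by
    rw [Complex.sq_norm, Complex.normSq_apply]; simp; nlinarith
  have e2 : ‖(σ:ℂ) + y * I‖ ≤ ‖(σ:ℂ) + y * I + 1‖ := by
    refine le_of_sq_le_sq ?_ (norm_nonneg _)
    rw [Complex.sq_norm, Complex.normSq_apply, Complex.sq_norm, Complex.normSq_apply]; simp; nlinarith
  nlinarith [norm_nonneg ((σ:ℂ) + y * I)]

lemma ss_int {σ : ℝ} (hσ : 1 ≤ σ) : Integrable (fun y : ℝ => 1 / ((σ:ℂ) + y * I) - 1 / ((σ:ℂ) + y * I + 1)) := by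
  refine Integrable.mono' integrable_inv_one_add_sq ?_ (Eventually.of_forall (ss_norm hσ))
  have h1 : ∀ y : ℝ, (σ:ℂ) + y * I ≠ 0 := by
    intro y h; have := congrArg re h; simp at this; linarith
  have h2 : ∀ y : ℝ, (σ:ℂ) + y * I + 1 ≠ 0 := by
    intro y h; have := congrArg re h; simp at this; linarith
  refine Continuous.aestronglyMeasurable ?_
  exact (continuous_const.div (by fun_prop) h1).sub (continuous_const.div (by fun_prop) h2)

lemma ff_inv {σ : ℝ} (hσ : 1 ≤ σ) {u : ℝ} (hu : 0 < u) : 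
    (1 / (2 * Real.pi)) • ∫ y : ℝ, (u : ℂ) ^ (-((σ:ℂ) + y * I)) * (1 / ((σ:ℂ) + y * I) - 1 / ((σ:ℂ) + y * I + 1)) = ((max 0 (1 - u) : ℝ) : ℂ) := by
  have hm : ∀ y : ℝ, mellin ff (σ + y * I) = 1 / ((σ:ℂ) + y * I) - 1 / ((σ:ℂ) + y * I + 1) := fun y => (ff_mellin (by simp; linarith)).2
  have := mellinInv_mellin_eq σ ff hu (by exact (ff_mellin (s := (σ:ℂ)) (by simp; linarith)).1) ?_ (ff_cont hu)
  · rw [ff_eq hu] at this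
    rw [← this]
    unfold mellinInv
    simp only [hm, smul_eq_mul]
  · unfold VerticalIntegrable
    simp only [hm]
    exact ss_int hσ

noncomputable def MM : ℝ := ∫ y : ℝ, 2 * (1 + ‖y‖ ^ 2) ^ (-(3/2:ℝ) / 2)

lemma MM_int : Integrable (fun y : ℝ => 2 * (1 + ‖y‖ ^ 2) ^ (-(3/2:ℝ) / 2)) := 
  (integrable_rpow_neg_one_add_norm_sq (by simp; norm_num)).const_mul 2

lemma MM_nonneg : 0 ≤ MM := integral_nonneg fun y => by positivity

lemma MM_pt (y : ℝ) : (2 + |y|) ^ (1/2 : ℝ) * (1 + y ^ 2)⁻¹ ≤ 2 * (1 + ‖y‖ ^ 2) ^ (-(3/2:ℝ) / 2) := by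
  have e : (1 + ‖y‖ ^ 2) = 1 + y ^ 2 := by simp
  rw [e]
  have h0 : 0 < 1 + y ^ 2 := by positivity
  have h1 : (2 + |y|) ^ (1/2 : ℝ) ≤ 2 * (1 + y ^ 2) ^ (1/4 : ℝ) := by
    have h2 : 2 + |y| ≤ (16 * (1 + y ^ 2)) ^ (1/2 : ℝ) := by
      rw [← Real.sqrt_eq_rpow]
      apply Real.le_sqrt_of_sq_le
      nlinarith [sq_abs y, sq_nonneg (|y| - 2)]
    calc (2 + |y|) ^ (1/2 : ℝ) ≤ ((16 * (1 + y ^ 2)) ^ (1/2 : ℝ)) ^ (1/2 : ℝ) := Real.rpow_le_rpow (by positivity) h2 (by norm_num)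
      _ = 2 * (1 + y ^ 2) ^ (1/4 : ℝ) := by
        rw [← Real.rpow_mul (by positivity), Real.mul_rpow (by norm_num) h0.le]
        rw [show (16:ℝ) = 2 ^ (4:ℝ) by norm_num, ← Real.rpow_mul (by norm_num)]
        norm_num
  calc _ ≤ 2 * (1 + y ^ 2) ^ (1/4 : ℝ) * (1 + y ^ 2)⁻¹ := by gcongr
    _ = _ := by
      rw [← Real.rpow_neg_one, mul_assoc, ← Real.rpow_add h0]; norm_num

lemma perron {b : ℕ → ℂ} {A x : ℝ} (hA : 0 ≤ A) (hx : 3 ≤ x) (hb : ∀ s : ℂ, 1 < s.re → LSeriesSummable b s)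
    (hB : ∀ s : ℂ, 1 < s.re → s.re ≤ 2 → ‖LSeries b s‖ ≤ A * (2 + |s.im|) ^ (1/2 : ℝ)) :
    ‖∑ n ∈ Finset.Icc 1 ⌊x⌋₊, b n * (1 - n / x)‖ ≤ 3 * MM * A * x := by
  have hx0 : 0 < x := by linarith
  have hl : 1 < Real.log x := by
    rw [Real.lt_log_iff_exp_lt hx0]; have := Real.exp_one_lt_d9; linarith
  set σ : ℝ := 1 + 1 / Real.log x with hσd
  have hσ : 1 < σ := by
    have : 0 < 1 / Real.log x := by positivity
    linarith
  have hσ2 : σ ≤ 2 := by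
    have : 1 / Real.log x ≤ 1 := by rw [div_le_one (by linarith)]; exact hl.le
    linarith
  have hxσ : x ^ σ = Real.exp 1 * x := by
    rw [Real.rpow_def_of_pos hx0, hσd, mul_add, mul_one, mul_one_div_cancel (by linarith), add_comm, Real.exp_add, Real.exp_log hx0]
  set S : ℝ → ℂ := fun y => (σ:ℂ) + y * I with hS
  set R : ℝ → ℂ := fun y => 1 / S y - 1 / (S y + 1) with hR
  have hre : ∀ y, (S y).re = σ := fun y => by simp [hS]
  have him : ∀ y, (S y).im = y := fun y => by simp [hS]
  set F : ℕ → ℝ → ℂ := fun n y => LSeries.term b (S y) n * ((x:ℂ) ^ (S y) * R y) with hF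
  have hterm : ∀ n y, ‖F n y‖ = ‖LSeries.term b (σ:ℂ) n‖ * (x ^ σ * ‖R y‖) := by
    intro n y
    simp only [hF, norm_mul, LSeries.norm_term_eq, hre, ofReal_re, Complex.norm_cpow_eq_rpow_re_of_pos hx0]
  have hFc : ∀ n, AEStronglyMeasurable (F n) := by
    intro n
    refine AEStronglyMeasurable.mul ?_ (AEStronglyMeasurable.mul ?_ (ss_int hσ.le).1)
    · refine Continuous.aestronglyMeasurable ?_
      by_cases hn : n = 0
      · simp [hn]; fun_prop
      · simp only [LSeries.term_of_ne_zero hn]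
        refine continuous_const.div ?_ fun y => by
          rw [Complex.cpow_ne_zero_iff]; left; exact_mod_cast hn
        exact Continuous.const_cpow (by fun_prop) (Or.inl (by exact_mod_cast hn))
    · refine Continuous.aestronglyMeasurable ?_
      exact Continuous.const_cpow (by fun_prop) (Or.inl (by exact_mod_cast hx0.ne'))
  have hRi : Integrable R := ss_int hσ.le
  have hFi : ∀ n, Integrable (F n) := by
    intro n
    refine Integrable.mono' ((hRi.norm.const_mul (x ^ σ)).const_mul ‖LSeries.term b (σ:ℂ) n‖) (hFc n) (Eventually.of_forall fun y => (hterm n y).le)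
  have hFs : Summable fun n => ∫ y, ‖F n y‖ := by
    simp only [hterm]
    simp only [integral_const_mul]
    exact (hb σ (by simpa using hσ)).norm.mul_right _
  have key := hasSum_integral_of_summable_integral_norm hFi hFs
  have e1 : ∀ n, (1 / (2 * Real.pi)) • ∫ y, F n y = if n ∈ Finset.Icc 1 ⌊x⌋₊ then b n * (1 - n / x) else 0 := by
    intro n
    by_cases hn : n = 0
    · simp [hF, hn]
    have hn0 : (0:ℝ) < n := by exact_mod_cast Nat.pos_of_ne_zero hn
    have := ff_inv hσ.le (u := n / x) (by positivity)
    have e2 : ∀ y, F n y = b n * (((n / x : ℝ) : ℂ) ^ (-((σ:ℂ) + y * I)) * (1 / ((σ:ℂ) + y * I) - 1 / ((σ:ℂ) + y * I + 1))) := by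
      intro y
      simp only [hF, LSeries.term_of_ne_zero hn, hR, hS]
      rw [Complex.ofReal_div, Complex.cpow_neg]
      have e3 := Complex.div_cpow_ofReal_nonneg hn0.le hx0.le ((σ:ℂ) + y * I)
      rw [e3, inv_div]
      push_cast
      ring
    simp only [e2, integral_const_mul]
    rw [← mul_smul_comm, this]
    by_cases hnx : (n:ℝ) ≤ x
    · rw [if_pos (by rw [Finset.mem_Icc]; exact ⟨Nat.pos_of_ne_zero hn, Nat.le_floor hnx⟩), max_eq_right (by rw [sub_nonneg, div_le_one hx0]; exact hnx)]
      push_cast; rfl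
    · rw [if_neg (by rw [Finset.mem_Icc]; intro h; exact hnx ((Nat.le_floor_iff hx0.le).1 h.2)), max_eq_left (by rw [sub_nonpos, one_le_div hx0]; linarith)]
      simp
  have key2 := key.const_smul (1 / (2 * Real.pi))
  simp only [e1] at key2
  have key3 := key2.unique (hasSum_sum_of_ne_finset_zero (s := Finset.Icc 1 ⌊x⌋₊) (fun n hn => if_neg hn))
  rw [Finset.sum_congr rfl (fun n hn => if_pos hn)] at key3
  rw [← key3]
  have e4 : ∀ y, ‖∑' n, F n y‖ ≤ (A * x ^ σ) * (2 * (1 + ‖y‖ ^ 2) ^ (-(3/2:ℝ) / 2)) := by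
    intro y
    simp only [hF]
    rw [tsum_mul_right, norm_mul, norm_mul, Complex.norm_cpow_eq_rpow_re_of_pos hx0, hre]
    have a1 := hB (S y) (by rw [hre]; exact hσ) (by rw [hre]; exact hσ2)
    rw [him] at a1
    have a2 : ‖R y‖ ≤ (1 + y ^ 2)⁻¹ := ss_norm hσ.le y
    have a3 := MM_pt y
    have a4 : 0 ≤ x ^ σ := by positivity
    calc _ ≤ (A * (2 + |y|) ^ (1/2 : ℝ)) * (x ^ σ * (1 + y ^ 2)⁻¹) := by
          refine mul_le_mul a1 (by gcongr) (by positivity) (by positivity)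
      _ = (A * x ^ σ) * ((2 + |y|) ^ (1/2 : ℝ) * (1 + y ^ 2)⁻¹) := by ring
      _ ≤ _ := by gcongr
  have e5 := norm_integral_le_of_norm_le (MM_int.const_mul (A * x ^ σ)) (Eventually.of_forall e4)
  rw [integral_const_mul] at e5
  rw [norm_smul]
  have e6 : ‖1 / (2 * Real.pi)‖ ≤ 1 := by
    rw [Real.norm_of_nonneg (by positivity), div_le_one (by positivity)]
    have := Real.pi_gt_three; linarith
  have := MM_nonneg
  have he := Real.exp_one_lt_d9
  calc _ ≤ 1 * (A * x ^ σ * MM) := mul_le_mul e6 e5 (norm_nonneg _) zero_le_one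
    _ = Real.exp 1 * (A * x * MM) := by rw [hxσ]; ring
    _ ≤ 3 * (A * x * MM) := by gcongr; linarith
    _ = _ := by ring

end FixPt

namespace FixPt
open Complex MeasureTheory Finset Set Filter Topology DirichletCharacter

lemma logMul_iter (a : ℕ → ℂ) (k n : ℕ) : (LSeries.logMul^[k] a) n = (Real.log n : ℂ) ^ k * a n := by
  induction k generalizing a with
  | zero => simp
  | succ k ih => 
    rw [Function.iterate_succ, Function.comp_apply, ih]
    simp only [LSeries.logMul, ← Complex.natCast_log]
    ring

lemma abel_ineq {f : ℕ → ℂ} {g : ℕ → ℝ} {B : ℝ} (hg : Antitone g) (hg0 : ∀ n, 0 ≤ g n) (n : ℕ)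
    (h : ∀ j ≤ n, ‖∑ i ∈ Finset.range j, f i‖ ≤ B) : ‖∑ i ∈ Finset.range n, (g i : ℂ) * f i‖ ≤ B * g 0 := by
  have e : ∀ n, ∑ i ∈ Finset.range n, (g i : ℂ) * f i = g n * ∑ i ∈ Finset.range n, f i + ∑ i ∈ Finset.range n, ((g i - g (i+1) : ℝ) : ℂ) * ∑ j ∈ Finset.range (i+1), f j := by
    intro n
    induction n with
    | zero => simp
    | succ n ih => 
      rw [Finset.sum_range_succ, ih, Finset.sum_range_succ (n := n) (f := fun i => ((g i - g (i+1) : ℝ) : ℂ) * ∑ j ∈ Finset.range (i+1), f j), Finset.sum_range_succ (n := n) (f := f)]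
      push_cast; ring
  rw [e]
  calc _ ≤ ‖(g n : ℂ) * ∑ i ∈ Finset.range n, f i‖ + ∑ i ∈ Finset.range n, ‖((g i - g (i+1) : ℝ) : ℂ) * ∑ j ∈ Finset.range (i+1), f j‖ := 
        (norm_add_le _ _).trans (by gcongr; exact norm_sum_le _ _)
    _ ≤ g n * B + ∑ i ∈ Finset.range n, (g i - g (i+1)) * B := by
        gcongr with i hi
        · rw [norm_mul, Complex.norm_real, Real.norm_of_nonneg (hg0 n)]
          exact mul_le_mul_of_nonneg_left (h n le_rfl) (hg0 n)
        · have : 0 ≤ g i - g (i+1) := sub_nonneg.2 (hg (Nat.le_succ i))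
          rw [norm_mul, Complex.norm_real, Real.norm_of_nonneg this]
          exact mul_le_mul_of_nonneg_left (h (i+1) (by have := Finset.mem_range.1 hi; omega)) this
    _ = B * g 0 := by
        rw [← Finset.sum_mul, Finset.sum_range_sub']; ring

lemma desmooth {b : ℕ → ℂ} {M W h : ℝ} {N : ℕ} (hM : 0 ≤ M) (hN : 3 ≤ N) (hh : 0 < h) (hhN : h ≤ N)
    (hT : ∀ x : ℝ, 3 ≤ x → ‖∑ n ∈ Finset.Icc 1 ⌊x⌋₊, b n * (1 - n / x)‖ ≤ M * x)
    (hW0 : 0 ≤ W) (hW : ∀ n : ℕ, (n:ℝ) ≤ 2 * N → ‖b n‖ ≤ W) :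
    ‖∑ n ∈ Finset.Icc 1 N, b n‖ ≤ 5 * M * N ^ 2 / h + (h + 1) * W := by
  have hN3 : (3:ℝ) ≤ N := by exact_mod_cast hN
  set N' := ⌊(N:ℝ) + h⌋₊ with hN'
  have hNN : N ≤ N' := Nat.le_floor (by linarith)
  have hN'h : (N':ℝ) ≤ N + h := Nat.floor_le (by linarith)
  have t1 := hT N hN3
  have t2 := hT (N + h) (by linarith)
  rw [Nat.floor_natCast] at t1
  rw [← hN'] at t2
  have hsplit : ∀ f : ℕ → ℂ, ∑ n ∈ Finset.Icc 1 N', f n = ∑ n ∈ Finset.Icc 1 N, f n + ∑ n ∈ Finset.Ioc N N', f n := by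
    intro f
    rw [← Finset.sum_union]
    · congr 1; ext n; simp only [Finset.mem_union, Finset.mem_Icc, Finset.mem_Ioc]; omega
    · rw [Finset.disjoint_left]; intro n; simp only [Finset.mem_Icc, Finset.mem_Ioc]; omega
  have hN0 : (N:ℂ) ≠ 0 := by norm_cast; omega
  have hNh0 : ((N:ℂ) + h) ≠ 0 := by
    have : ((N:ℝ) + h) ≠ 0 := by linarith
    exact_mod_cast this
  have ident : (h:ℂ) * ∑ n ∈ Finset.Icc 1 N, b n = ((N:ℂ) + h) * (∑ n ∈ Finset.Icc 1 N', b n * (1 - n / ((N + h : ℝ) : ℂ))) - N * (∑ n ∈ Finset.Icc 1 N, b n * (1 - n / ((N:ℝ) : ℂ)))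
      - ∑ n ∈ Finset.Ioc N N', b n * (N + h - n) := by
    rw [Finset.mul_sum, Finset.mul_sum, Finset.mul_sum, hsplit]
    rw [add_sub_assoc, add_comm, ← sub_eq_sub_iff_add_eq_add.2 rfl]
    rw [← sub_eq_zero]
    have z1 : ∑ n ∈ Finset.Ioc N N', ((N:ℂ) + h) * (b n * (1 - n / ((N + h : ℝ) : ℂ))) = ∑ n ∈ Finset.Ioc N N', b n * (N + h - n) := by
      refine Finset.sum_congr rfl fun n _ => ?_
      push_cast; field_simp
    have z2 : ∑ n ∈ Finset.Icc 1 N, ((N:ℂ) + h) * (b n * (1 - n / ((N + h : ℝ) : ℂ))) = ∑ n ∈ Finset.Icc 1 N, N * (b n * (1 - n / ((N:ℝ) : ℂ))) + ∑ n ∈ Finset.Icc 1 N, (h:ℂ) * b n := by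
      rw [← Finset.sum_add_distrib]
      refine Finset.sum_congr rfl fun n _ => ?_
      push_cast; field_simp; ring
    rw [z1, z2]; ring
  have n1 : ‖((N:ℂ) + h) * (∑ n ∈ Finset.Icc 1 N', b n * (1 - n / ((N + h : ℝ) : ℂ)))‖ ≤ M * (4 * N ^ 2) := by
    rw [norm_mul, show (N:ℂ) + h = ((N + h : ℝ) : ℂ) by push_cast; rfl, Complex.norm_real, Real.norm_of_nonneg (by positivity)]
    calc _ ≤ (N + h) * (M * (N + h)) := by gcongr
      _ = M * (N + h) ^ 2 := by ring
      _ ≤ _ := by gcongr; nlinarith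
  have n2 : ‖(N:ℂ) * (∑ n ∈ Finset.Icc 1 N, b n * (1 - n / ((N:ℝ) : ℂ)))‖ ≤ M * N ^ 2 := by
    rw [norm_mul, Complex.norm_natCast]
    calc _ ≤ N * (M * N) := by gcongr
      _ = _ := by ring
  have n3 : ‖∑ n ∈ Finset.Ioc N N', b n * (N + h - n)‖ ≤ h * ((h + 1) * W) := by
    calc _ ≤ ∑ n ∈ Finset.Ioc N N', ‖b n * (N + h - n)‖ := norm_sum_le _ _
      _ ≤ ∑ n ∈ Finset.Ioc N N', W * h := by
        refine Finset.sum_le_sum fun n hn => ?_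
        rw [Finset.mem_Ioc] at hn
        have c1 : (N:ℝ) < n := by exact_mod_cast hn.1
        have c2 : (n:ℝ) ≤ N + h := le_trans (by exact_mod_cast hn.2) hN'h
        rw [norm_mul, show (N:ℂ) + h - n = ((N + h - n : ℝ) : ℂ) by push_cast; rfl, Complex.norm_real, Real.norm_of_nonneg (by linarith)]
        refine mul_le_mul (hW n (by linarith)) (by linarith) (by linarith) hW0
      _ = (N' - N : ℝ) * (W * h) := by
        rw [Finset.sum_const, Nat.card_Ioc, nsmul_eq_mul, Nat.cast_sub hNN]
      _ ≤ (h + 1) * (W * h) := by gcongr; linarith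
      _ = _ := by ring
  have fin : h * ‖∑ n ∈ Finset.Icc 1 N, b n‖ ≤ M * (4 * N ^ 2) + M * N ^ 2 + h * ((h + 1) * W) := by
    calc h * ‖∑ n ∈ Finset.Icc 1 N, b n‖ = ‖(h:ℂ) * ∑ n ∈ Finset.Icc 1 N, b n‖ := by
          rw [norm_mul, Complex.norm_real, Real.norm_of_nonneg hh.le]
      _ ≤ _ := by
          rw [ident]
          exact (norm_sub_le _ _).trans (add_le_add ((norm_sub_le _ _).trans (add_le_add n1 n2)) n3)
  have : 5 * M * N ^ 2 / h + (h + 1) * W = (M * (4 * N ^ 2) + M * N ^ 2 + h * ((h + 1) * W)) / h := by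
    field_simp; ring
  rw [this, le_div_iff₀ hh]; linarith

end FixPt

namespace FixPt
open Complex MeasureTheory Finset Set Filter Topology DirichletCharacter

lemma log_pow_le (j : ℕ) : ∃ C : ℝ, 1 ≤ C ∧ ∀ x : ℝ, 1 ≤ x → Real.log x ^ j ≤ C * x ^ (1/2 : ℝ) := by
  refine ⟨(2 * ((j:ℝ) + 1)) ^ j, one_le_pow₀ (by linarith [show (0:ℝ) ≤ j from Nat.cast_nonneg j]), fun x hx => ?_⟩
  have h := Real.log_le_rpow_div (x := x) (by linarith) (ε := 1 / (2 * ((j:ℝ) + 1))) (by positivity)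
  calc Real.log x ^ j ≤ (x ^ (1 / (2 * ((j:ℝ) + 1))) / (1 / (2 * ((j:ℝ) + 1)))) ^ j := by
        gcongr; exact Real.log_nonneg hx
    _ = (2 * ((j:ℝ) + 1)) ^ j * x ^ (1 / (2 * ((j:ℝ) + 1)) * j) := by
        rw [div_div_eq_mul_div, div_one, mul_pow, ← Real.rpow_mul_natCast (by linarith)]; ring
    _ ≤ _ := by
        gcongr
        rw [div_mul_eq_mul_div, div_le_div_iff₀ (by positivity) (by norm_num)]; linarith

lemma log3 {x : ℝ} (hx : 3 ≤ x) : 1 < Real.log x := by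
  rw [Real.lt_log_iff_exp_lt (by linarith)]; have := Real.exp_one_lt_d9; linarith

lemma psum (m : ℕ) : ∃ K : ℝ, 1 ≤ K ∧ ∀ (a : ℕ → ℂ) (A : ℝ) (N : ℕ), 1 ≤ A → 3 ≤ N → (∀ n, ‖a n‖ ≤ Real.log n + 1) →
    LSeries.abscissaOfAbsConv a ≤ 1 → 
    (∀ s : ℂ, 1 < s.re → s.re ≤ 2 → ‖LSeries (LSeries.logMul^[2 * m + 1] a) s‖ ≤ A * (2 + |s.im|) ^ (1/2 : ℝ)) →
    ‖∑ n ∈ Finset.Icc 1 N, (LSeries.logMul^[2 * m + 1] a) n‖ ≤ K * A * N * Real.log N ^ (m + 1) := by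
  obtain ⟨C, hC, hCl⟩ := log_pow_le (2 * m + 2)
  have hMM := MM_nonneg
  refine ⟨15 * MM + 9 ^ (m+1) * (1 + C), ?_, ?_⟩
  · have : (1:ℝ) ≤ 9 ^ (m+1) := one_le_pow₀ (by norm_num)
    nlinarith
  intro a A N hA hN ha habs hB
  set b := LSeries.logMul^[2 * m + 1] a with hb
  have hN3 : (3:ℝ) ≤ N := by exact_mod_cast hN
  have hN0 : (0:ℝ) < N := by linarith
  set L := Real.log N with hL
  have hL1 : 1 < L := log3 hN3
  have hLm : 1 ≤ L ^ (m+1) := one_le_pow₀ hL1.le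
  have hsum : ∀ s : ℂ, 1 < s.re → LSeriesSummable b s := by
    intro s hs
    refine LSeriesSummable_of_abscissaOfAbsConv_lt_re ?_
    rw [hb, LSeries.absicssaOfAbsConv_logPowMul]
    exact lt_of_le_of_lt habs (by exact_mod_cast hs)
  have hbn : ∀ n : ℕ, (n:ℝ) ≤ 2 * N → ‖b n‖ ≤ (3 * L) ^ (2 * m + 2) := by
    intro n hn
    have hln : 0 ≤ Real.log n := Real.log_natCast_nonneg n
    have hln2 : Real.log n + 1 ≤ 3 * L := by
      rcases Nat.eq_zero_or_pos n with h | h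
      · simp [h]; linarith
      have hn0 : (0:ℝ) < n := by exact_mod_cast h
      have := Real.log_le_log hn0 hn
      rw [Real.log_mul (by norm_num) hN0.ne'] at this
      have := Real.log_two_lt_d9
      linarith
    rw [hb, logMul_iter, norm_mul, norm_pow, Complex.norm_real, Real.norm_of_nonneg hln]
    calc _ ≤ (3 * L) ^ (2 * m + 1) * (3 * L) := by
          gcongr
          · linarith
          · exact (ha n).trans hln2
      _ = _ := by ring
  have key := desmooth (b := b) (M := 3 * MM * A) (W := (3 * L) ^ (2 * m + 2)) (h := N / L ^ (m+1)) (N := N) (by positivity) hN (by positivity)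
    (div_le_self hN0.le hLm) (fun x hx => perron (by linarith) hx hsum hB) (by positivity) hbn
  have e1 : 5 * (3 * MM * A) * N ^ 2 / (N / L ^ (m+1)) = 15 * MM * A * N * L ^ (m+1) := by
    field_simp; ring
  have e2 : (N / L ^ (m+1) + 1) * (3 * L) ^ (2 * m + 2) = 9 ^ (m+1) * (N * L ^ (m+1) + L ^ (2 * m + 2)) := by
    rw [show 2 * m + 2 = 2 * (m+1) by ring, pow_mul, mul_pow, mul_pow, show (3:ℝ)^2 = 9 by norm_num, ← pow_mul, pow_mul L 2, pow_right_comm, pow_two (L ^ (m+1))]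
    field_simp
  rw [e1, e2] at key
  refine key.trans ?_
  have e3 : L ^ (2 * m + 2) ≤ C * (N * L ^ (m+1)) := by
    refine (hCl N (by linarith)).trans ?_
    have : (N:ℝ) ^ (1/2 : ℝ) ≤ N := by
      calc (N:ℝ) ^ (1/2 : ℝ) ≤ (N:ℝ) ^ (1:ℝ) := Real.rpow_le_rpow_of_exponent_le (by linarith) (by norm_num)
        _ = N := Real.rpow_one _
    have h2 : (N:ℝ) ≤ N * L ^ (m+1) := le_mul_of_one_le_right hN0.le hLm
    nlinarith
  have p9 : (0:ℝ) < 9 ^ (m+1) := by positivity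
  have e4 : 0 ≤ N * L ^ (m+1) := by positivity
  calc _ ≤ 15 * MM * A * N * L ^ (m+1) + 9 ^ (m+1) * (N * L ^ (m+1) + C * (N * L ^ (m+1))) := by gcongr
    _ = 15 * MM * A * N * L ^ (m+1) + 1 * (9 ^ (m+1) * (1 + C) * (N * L ^ (m+1))) := by ring
    _ ≤ 15 * MM * A * N * L ^ (m+1) + A * (9 ^ (m+1) * (1 + C) * (N * L ^ (m+1))) := by gcongr
    _ = _ := by ring

theorem divlog (m : ℕ) : ∃ K : ℝ, 1 ≤ K ∧ ∀ (a : ℕ → ℂ) (A : ℝ) (x : ℝ), 1 ≤ A → 9 ≤ x → (∀ n, ‖a n‖ ≤ Real.log n + 1) →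
    LSeries.abscissaOfAbsConv a ≤ 1 → 
    (∀ s : ℂ, 1 < s.re → s.re ≤ 2 → ‖LSeries (LSeries.logMul^[2 * m + 1] a) s‖ ≤ A * (2 + |s.im|) ^ (1/2 : ℝ)) →
    ‖∑ n ∈ Finset.Icc 2 ⌊x⌋₊, a n / Real.log n‖ ≤ K * A * x / Real.log x ^ (m + 1) := by
  obtain ⟨K, hK, H⟩ := psum m
  obtain ⟨C, hC, hCl⟩ := log_pow_le (m + 1)
  refine ⟨3 * C + 2 * 4 ^ (m+1) * K, by nlinarith [show (0:ℝ) < 4 ^ (m+1) by positivity], ?_⟩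
  intro a A x hA hx ha habs hB
  have hx0 : (0:ℝ) < x := by linarith
  set b := LSeries.logMul^[2 * m + 1] a with hb
  set L := Real.log x with hL
  have hL1 : 1 < L := log3 (by linarith)
  set N := ⌊x⌋₊ with hN
  set N0 := ⌊Real.sqrt x⌋₊ with hN0
  have hsq3 : 3 ≤ Real.sqrt x := Real.le_sqrt_of_sq_le (by linarith)
  have hN03 : 3 ≤ N0 := Nat.le_floor (by exact_mod_cast hsq3)
  have hsx : Real.sqrt x ≤ x := by
    have := Real.sq_sqrt hx0.le
    nlinarith
  have hNN : N0 ≤ N := Nat.floor_le_floor hsx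
  have hNx : (N:ℝ) ≤ x := Nat.floor_le hx0.le
  have hsplit : ∑ n ∈ Finset.Icc 2 N, a n / (Real.log n : ℂ) = ∑ n ∈ Finset.Icc 2 N0, a n / (Real.log n : ℂ) + ∑ i ∈ Finset.range (N - N0), a (N0 + 1 + i) / (Real.log ((N0 + 1 + i : ℕ):ℝ) : ℂ) := by
    rw [show N - N0 = (N + 1) - (N0 + 1) by omega, ← Finset.sum_Ico_eq_sum_range (fun n => a n / (Real.log (n:ℝ) : ℂ)), ← Finset.sum_union]
    · congr 1; ext n; simp only [Finset.mem_union, Finset.mem_Icc, Finset.mem_Ico]; omega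
    · rw [Finset.disjoint_left]; intro n; simp only [Finset.mem_Icc, Finset.mem_Ico]; omega
  -- first part
  have p1 : ‖∑ n ∈ Finset.Icc 2 N0, a n / (Real.log n : ℂ)‖ ≤ 3 * Real.sqrt x := by
    calc _ ≤ ∑ n ∈ Finset.Icc 2 N0, ‖a n / (Real.log n : ℂ)‖ := norm_sum_le _ _
      _ ≤ ∑ n ∈ Finset.Icc 2 N0, (3:ℝ) := by
        refine Finset.sum_le_sum fun n hn => ?_
        rw [Finset.mem_Icc] at hn
        have h2 : (2:ℝ) ≤ n := by exact_mod_cast hn.1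
        have hl : Real.log 2 ≤ Real.log n := Real.log_le_log (by norm_num) h2
        have := Real.log_two_gt_d9
        have hp : 0 < Real.log n := by linarith
        rw [norm_div, Complex.norm_real, Real.norm_of_nonneg hp.le, div_le_iff₀ hp]
        have := ha n
        linarith
      _ ≤ _ := by
        rw [Finset.sum_const, Nat.card_Icc, nsmul_eq_mul]
        have : ((N0 + 1 - 2 : ℕ) : ℝ) ≤ N0 := by exact_mod_cast (by omega)
        have : (N0:ℝ) ≤ Real.sqrt x := Nat.floor_le (by positivity)
        linarith
  have p1' : 3 * Real.sqrt x ≤ 3 * C * x / L ^ (m+1) := by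
    rw [le_div_iff₀ (by positivity)]
    have h1 := hCl x (by linarith)
    rw [← Real.sqrt_eq_rpow] at h1
    have := Real.mul_self_sqrt hx0.le
    have h0 := Real.sqrt_nonneg x
    calc 3 * Real.sqrt x * L ^ (m+1) ≤ 3 * Real.sqrt x * (C * Real.sqrt x) := by gcongr
      _ = 3 * C * (Real.sqrt x * Real.sqrt x) := by ring
      _ = _ := by rw [this]
  -- second part
  have hl0 : ∀ i : ℕ, 0 < Real.log ((N0 + 1 + i : ℕ):ℝ) := fun i => Real.log_pos (by exact_mod_cast (by omega))
  have p2 := abel_ineq (f := fun i => b (N0 + 1 + i)) (g := fun i => 1 / Real.log ((N0 + 1 + i : ℕ):ℝ) ^ (2 * m + 2)) (B := 2 * (K * A * x * L ^ (m+1))) ?_ ?_ (N - N0) ?_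
  rotate_left
  · intro i j hij
    have := hl0 i
    refine one_div_le_one_div_of_le (pow_pos (hl0 i) _) ?_
    gcongr
  · intro i; have := hl0 i; positivity
  · intro j hj
    have bd : ∀ M : ℕ, 3 ≤ M → M ≤ N → ‖∑ n ∈ Finset.Icc 1 M, b n‖ ≤ K * A * x * L ^ (m+1) := by
      intro M h3 hMN
      refine (H a A M hA h3 ha habs hB).trans ?_
      have h1 : (M:ℝ) ≤ x := le_trans (by exact_mod_cast hMN) hNx
      have h2 : (3:ℝ) ≤ M := by exact_mod_cast h3
      have : 1 < Real.log M := log3 h2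
      have : Real.log M ≤ L := Real.log_le_log (by linarith) h1
      gcongr
    have e : ∑ i ∈ Finset.range j, b (N0 + 1 + i) = ∑ n ∈ Finset.Icc 1 (N0 + j), b n - ∑ n ∈ Finset.Icc 1 N0, b n := by
      rw [eq_sub_iff_add_eq]
      have : ∑ n ∈ Finset.Ico (N0+1) (N0 + 1 + j), b n = ∑ i ∈ Finset.range j, b (N0 + 1 + i) := by
        rw [Finset.sum_Ico_eq_sum_range, show N0 + 1 + j - (N0 + 1) = j by omega]
      rw [← this, ← Finset.sum_union]
      · congr 1; ext n; simp only [Finset.mem_union, Finset.mem_Icc, Finset.mem_Ico]; omega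
      · rw [Finset.disjoint_left]; intro n; simp only [Finset.mem_Icc, Finset.mem_Ico]; omega
    rw [e]
    refine (norm_sub_le _ _).trans ?_
    have := bd (N0 + j) (by omega) (by omega)
    have := bd N0 hN03 hNN
    linarith
  have e2 : ∀ i, a (N0 + 1 + i) / (Real.log ((N0 + 1 + i : ℕ):ℝ) : ℂ) = ((1 / Real.log ((N0 + 1 + i : ℕ):ℝ) ^ (2 * m + 2) : ℝ) : ℂ) * b (N0 + 1 + i) := by
    intro i
    rw [hb, logMul_iter]
    have : (Real.log ((N0 + 1 + i : ℕ):ℝ) : ℂ) ≠ 0 := by exact_mod_cast (hl0 i).ne'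
    rw [Complex.ofReal_div, Complex.ofReal_pow, Complex.ofReal_one]
    field_simp
    ring
  simp only [← e2] at p2
  have p2' : 2 * (K * A * x * L ^ (m+1)) * (1 / Real.log ((N0 + 1 + 0 : ℕ):ℝ) ^ (2 * m + 2)) ≤ 2 * 4 ^ (m+1) * K * A * x / L ^ (m+1) := by
    have h1 : L / 2 ≤ Real.log ((N0 + 1 + 0 : ℕ):ℝ) := by
      rw [hL, ← Real.log_sqrt hx0.le]
      refine Real.log_le_log (by linarith) ?_
      push_cast
      have := Nat.lt_floor_add_one (Real.sqrt x)
      linarith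
    have h2 : 1 / Real.log ((N0 + 1 + 0 : ℕ):ℝ) ^ (2 * m + 2) ≤ 1 / (L / 2) ^ (2 * m + 2) := by
      gcongr
    calc _ ≤ 2 * (K * A * x * L ^ (m+1)) * (1 / (L / 2) ^ (2 * m + 2)) := by gcongr
      _ = _ := by
        rw [show 2 * m + 2 = 2 * (m+1) by ring, div_pow, pow_mul 2 2, show (2:ℝ)^2 = 4 by norm_num, mul_comm 2 (m+1), pow_mul, pow_two (L ^ (m+1))]
        field_simp
  rw [hsplit]
  refine (norm_add_le _ _).trans ?_
  have h0 : 3 * C * x / L ^ (m+1) ≤ 3 * C * A * x / L ^ (m+1) := by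
    refine div_le_div_of_nonneg_right ?_ (by positivity)
    refine mul_le_mul_of_nonneg_right ?_ hx0.le
    nlinarith
  calc _ ≤ 3 * C * A * x / L ^ (m+1) + 2 * 4 ^ (m+1) * K * A * x / L ^ (m+1) := by linarith
    _ = _ := by ring

end FixPt

namespace FixPt
open Complex MeasureTheory Finset Set Filter Topology DirichletCharacter

noncomputable def PP (x : ℝ) : Finset ℕ := Finset.filter Nat.Prime (Finset.Iic ⌊x⌋₊)

noncomputable def Li (x : ℝ) : ℝ := ∫ t in (2 : ℝ)..x, 1 / Real.log t

lemma invlog_anti : AntitoneOn (fun t : ℝ => 1 / Real.log t) (Set.Ici 2) := by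
  intro a ha b _ hab
  have h2 : (2:ℝ) ≤ a := ha
  have : 0 < Real.log a := Real.log_pos (by linarith)
  exact one_div_le_one_div_of_le this (Real.log_le_log (by linarith) hab)

lemma invlog_bd {t : ℝ} (ht : 2 ≤ t) : 0 ≤ 1 / Real.log t ∧ 1 / Real.log t ≤ 2 := by
  have := Real.log_two_gt_d9
  have h : Real.log 2 ≤ Real.log t := Real.log_le_log (by norm_num) ht
  have hp : 0 < Real.log t := by linarith
  refine ⟨by positivity, ?_⟩
  rw [div_le_iff₀ hp]; linarith

lemma invlog_int {a b : ℝ} (ha : 2 ≤ a) (hb : 2 ≤ b) : IntervalIntegrable (fun t : ℝ => 1 / Real.log t) volume a b := by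
  refine (invlog_anti.mono ?_).intervalIntegrable
  intro t ht
  exact (le_min ha hb).trans ht.1

lemma sum_invlog {x : ℝ} (hx : 2 ≤ x) : |∑ n ∈ Finset.Icc 2 ⌊x⌋₊, 1 / Real.log n - Li x| ≤ 4 := by
  set N := ⌊x⌋₊ with hN
  have hN2 : 2 ≤ N := Nat.le_floor (by exact_mod_cast hx)
  have hN2' : (2:ℝ) ≤ N := by exact_mod_cast hN2
  have hNx : (N:ℝ) ≤ x := Nat.floor_le (by linarith)
  have hxN : x ≤ N + 1 := (Nat.lt_floor_add_one x).le
  have anti : AntitoneOn (fun t : ℝ => 1 / Real.log t) (Set.Icc ((2:ℕ):ℝ) N) := invlog_anti.mono (fun t ht => by simpa using ht.1)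
  have i1 := AntitoneOn.integral_le_sum_Ico hN2 anti
  have i2 := AntitoneOn.sum_le_integral_Ico hN2 anti
  have s1 : ∑ n ∈ Finset.Icc 2 N, 1 / Real.log n = ∑ n ∈ Finset.Ico 2 N, 1 / Real.log n + 1 / Real.log N := by
    rw [← Finset.sum_Ico_succ_top hN2]; rfl
  have s2 : ∑ n ∈ Finset.Icc 2 N, 1 / Real.log n = 1 / Real.log (2:ℕ) + ∑ n ∈ Finset.Ico 2 N, 1 / Real.log ((n+1 : ℕ):ℝ) := by
    have : Finset.Icc 2 N = Finset.Ico 2 (N+1) := by rfl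
    rw [this, Finset.sum_eq_sum_Ico_succ_bot (by omega), Finset.sum_Ico_add' (fun n : ℕ => 1 / Real.log (n:ℝ))]
  have hsp : Li x = (∫ t in (2:ℝ)..N, 1 / Real.log t) + ∫ t in (N:ℝ)..x, 1 / Real.log t := by
    unfold Li
    rw [intervalIntegral.integral_add_adjacent_intervals (invlog_int le_rfl hN2') (invlog_int hN2' hx)]
  have t1 : 0 ≤ ∫ t in (N:ℝ)..x, 1 / Real.log t := intervalIntegral.integral_nonneg hNx fun t ht => (invlog_bd (hN2'.trans ht.1)).1
  have t2 : ∫ t in (N:ℝ)..x, 1 / Real.log t ≤ 2 := by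
    calc _ ≤ ∫ t in (N:ℝ)..x, (2:ℝ) := intervalIntegral.integral_mono_on hNx (invlog_int hN2' hx) (by simp) fun t ht => (invlog_bd (hN2'.trans ht.1)).2
      _ ≤ _ := by simp; linarith
  have b1 := invlog_bd hN2'
  have b2 := invlog_bd (t := (2:ℕ)) (by norm_num)
  rw [hsp, abs_le]
  simp only [Nat.cast_ofNat] at i1 i2 s2 b2
  constructor <;> linarith

lemma pl {q : ℕ} (χ : DirichletCharacter ℂ q) {x : ℝ} (hx : 2 ≤ x) :
    ‖∑ p ∈ PP x, χ (p : ZMod q) - ∑ n ∈ Finset.Icc 2 ⌊x⌋₊, cL χ n / Real.log n‖ ≤ 3 * (Real.sqrt x * Real.log x) := by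
  have h1 : ∑ p ∈ PP x, χ (p : ZMod q) = ∑ n ∈ (Finset.Icc 2 ⌊x⌋₊).filter Nat.Prime, cL χ n / Real.log n := by
    refine Finset.sum_congr ?_ ?_
    · ext n
      simp only [PP, Finset.mem_filter, Finset.mem_Iic, Finset.mem_Icc]
      exact ⟨fun h => ⟨⟨h.2.two_le, h.1⟩, h.2⟩, fun h => ⟨h.1.2, h.2⟩⟩
    · intro n hn
      simp only [Finset.mem_filter, Finset.mem_Icc] at hn
      have hl : (Real.log n : ℂ) ≠ 0 := by
        exact_mod_cast (Real.log_pos (by exact_mod_cast hn.2.one_lt)).ne'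
      rw [cL, ArithmeticFunction.vonMangoldt_apply_prime hn.2]
      field_simp
  rw [h1, ← Finset.sum_filter_add_sum_filter_not (Finset.Icc 2 ⌊x⌋₊) Nat.Prime, sub_add_cancel_left, norm_neg]
  have h2 := Chebyshev.psi_sub_theta_eq_sum_not_prime x
  have h3 := Chebyshev.psi_sub_theta_le (x := x) (by linarith)
  have hlam : ∀ n : ℕ, 0 ≤ ArithmeticFunction.vonMangoldt n := fun n => ArithmeticFunction.vonMangoldt_nonneg
  calc _ ≤ ∑ n ∈ (Finset.Icc 2 ⌊x⌋₊).filter (fun n => ¬ n.Prime), ‖cL χ n / Real.log n‖ := norm_sum_le _ _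
    _ ≤ ∑ n ∈ (Finset.Icc 2 ⌊x⌋₊).filter (fun n => ¬ n.Prime), (3/2) * ArithmeticFunction.vonMangoldt n := by
      refine Finset.sum_le_sum fun n hn => ?_
      simp only [Finset.mem_filter, Finset.mem_Icc] at hn
      have h2 : (2:ℝ) ≤ n := by exact_mod_cast hn.1.1
      have hl : Real.log 2 ≤ Real.log n := Real.log_le_log (by norm_num) h2
      have := Real.log_two_gt_d9
      have hp : 0 < Real.log n := by linarith
      rw [norm_div, Complex.norm_real, Real.norm_of_nonneg hp.le, div_le_iff₀ hp, cL, norm_mul, Complex.norm_real, Real.norm_of_nonneg (hlam n)]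
      have a := norm_chi_le χ n
      have := hlam n
      nlinarith
    _ ≤ ∑ n ∈ (Finset.Ioc 0 ⌊x⌋₊).filter (fun n => ¬ n.Prime), (3/2) * ArithmeticFunction.vonMangoldt n := by
      refine Finset.sum_le_sum_of_subset_of_nonneg ?_ fun n _ _ => by have := hlam n; positivity
      intro n
      simp only [Finset.mem_filter, Finset.mem_Icc, Finset.mem_Ioc]
      rintro ⟨h, h'⟩; exact ⟨⟨by omega, h.2⟩, h'⟩
    _ ≤ _ := by
      rw [← Finset.mul_sum, ← h2]; linarith

lemma sqrt_small (m : ℕ) : ∃ C : ℝ, 1 ≤ C ∧ ∀ x : ℝ, 9 ≤ x → Real.sqrt x * Real.log x ≤ C * x / Real.log x ^ (m+1) := by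
  obtain ⟨C, hC, h⟩ := log_pow_le (m+2)
  refine ⟨C, hC, fun x hx => ?_⟩
  have hL : 1 < Real.log x := log3 (by linarith)
  rw [le_div_iff₀ (by positivity)]
  have h1 := h x (by linarith)
  rw [← Real.sqrt_eq_rpow] at h1
  have := Real.mul_self_sqrt (show 0 ≤ x by linarith)
  calc Real.sqrt x * Real.log x * Real.log x ^ (m+1) = Real.sqrt x * Real.log x ^ (m+2) := by ring
    _ ≤ Real.sqrt x * (C * Real.sqrt x) := by gcongr
    _ = C * (Real.sqrt x * Real.sqrt x) := by ring
    _ = _ := by rw [this]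

lemma one_small {x : ℝ} (hx : 9 ≤ x) : 1 ≤ Real.sqrt x * Real.log x := by
  have hL : 1 < Real.log x := log3 (by linarith)
  have : 1 ≤ Real.sqrt x := Real.le_sqrt_of_sq_le (by linarith)
  nlinarith

lemma sw_chi (m : ℕ) : ∃ K : ℝ, 1 ≤ K ∧ ∀ (q : ℕ) [NeZero q] (χ : DirichletCharacter ℂ q) (x : ℝ), χ ≠ 1 → 9 ≤ x →
    ‖∑ p ∈ PP x, χ (p : ZMod q)‖ ≤ K * q * x / Real.log x ^ (m+1) := by
  obtain ⟨C, hC, hD⟩ := D_chi (2 * m + 1)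
  obtain ⟨K, hK, H⟩ := divlog m
  obtain ⟨C2, hC2, hs⟩ := sqrt_small m
  refine ⟨K * (C + 1) + 3 * C2, by nlinarith, ?_⟩
  intro q _ χ x hχ hx
  have hL : 1 < Real.log x := log3 (by linarith)
  have hq : (1:ℝ) ≤ q := by exact_mod_cast Nat.pos_of_ne_zero (NeZero.ne q)
  have h1 := pl χ (x := x) (by linarith)
  have h2 := H (cL χ) ((C + 1) * q) x (by nlinarith) hx ?_ (Dat_L χ).abscissa ?_
  · have h3 := hs x hx
    have h4 : ‖∑ p ∈ PP x, χ (p : ZMod q)‖ ≤ 3 * (Real.sqrt x * Real.log x) + K * ((C + 1) * q) * x / Real.log x ^ (m+1) := by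
      have := norm_add_le (∑ p ∈ PP x, χ (p : ZMod q) - ∑ n ∈ Finset.Icc 2 ⌊x⌋₊, cL χ n / Real.log n) (∑ n ∈ Finset.Icc 2 ⌊x⌋₊, cL χ n / Real.log n)
      rw [sub_add_cancel] at this
      linarith
    have hxL : 0 ≤ x / Real.log x ^ (m+1) := div_nonneg (by linarith) (by positivity)
    rw [mul_div_assoc] at h3 h4 ⊢
    have h5 : C2 * (x / Real.log x ^ (m+1)) ≤ q * (C2 * (x / Real.log x ^ (m+1))) := le_mul_of_one_le_left (by positivity) hq
    linarith
  · intro n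
    rw [cL, norm_mul, Complex.norm_real, Real.norm_of_nonneg ArithmeticFunction.vonMangoldt_nonneg]
    have a := norm_chi_le χ n
    have b := ArithmeticFunction.vonMangoldt_le_log (n := n)
    have c : 0 ≤ ArithmeticFunction.vonMangoldt n := ArithmeticFunction.vonMangoldt_nonneg
    nlinarith
  · intro s h1 h2
    refine (hD q χ hχ s h1 h2).trans ?_
    have : (q:ℝ) ^ (1/2:ℝ) ≤ q := by
      calc (q:ℝ) ^ (1/2 : ℝ) ≤ (q:ℝ) ^ (1:ℝ) := Real.rpow_le_rpow_of_exponent_le (by linarith) (by norm_num)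
        _ = q := Real.rpow_one _
    gcongr
    linarith

lemma pnt (m : ℕ) : ∃ K : ℝ, 1 ≤ K ∧ ∀ (x : ℝ), 9 ≤ x →
    |((PP x).card : ℝ) - Li x| ≤ K * x / Real.log x ^ (m+1) := by
  obtain ⟨C, hC, hD⟩ := D_one (2 * m + 1)
  obtain ⟨K, hK, H⟩ := divlog m
  obtain ⟨C2, hC2, hs⟩ := sqrt_small m
  refine ⟨K * (C + 1) + 7 * C2, by nlinarith, ?_⟩
  intro x hx
  have hL : 1 < Real.log x := log3 (by linarith)
  have h1 := pl (1 : DirichletCharacter ℂ 1) (x := x) (by linarith)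
  have h2 := H a1 (C + 1) x (by linarith) hx ?_ a1_abs ?_
  · have h3 := hs x hx
    have h4 := sum_invlog (x := x) (by linarith)
    have h5 := one_small hx
    have e1 : ∑ p ∈ PP x, (1 : DirichletCharacter ℂ 1) (p : ZMod 1) = ((PP x).card : ℂ) := by
      rw [Finset.sum_congr rfl (g := fun _ => (1:ℂ)) (fun p _ => by
        rw [Subsingleton.elim (p : ZMod 1) 1]; simp)]
      simp
    have e2 : ∑ n ∈ Finset.Icc 2 ⌊x⌋₊, cL (1 : DirichletCharacter ℂ 1) n / Real.log n = ∑ n ∈ Finset.Icc 2 ⌊x⌋₊, a1 n / Real.log n + ((∑ n ∈ Finset.Icc 2 ⌊x⌋₊, 1 / Real.log n : ℝ) : ℂ) := by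
      push_cast
      rw [← Finset.sum_add_distrib]
      refine Finset.sum_congr rfl fun n _ => ?_
      rw [a1, Pi.sub_apply, Pi.one_apply]; ring
    rw [e1, e2] at h1
    have e3 : |((PP x).card : ℝ) - Li x| = ‖((PP x).card : ℂ) - Li x‖ := by
      rw [← Real.norm_eq_abs, ← Complex.norm_real]; push_cast; rfl
    rw [e3]
    have e4 : |∑ n ∈ Finset.Icc 2 ⌊x⌋₊, 1 / Real.log n - Li x| = ‖((∑ n ∈ Finset.Icc 2 ⌊x⌋₊, 1 / Real.log n : ℝ) : ℂ) - Li x‖ := by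
      rw [← Real.norm_eq_abs, ← Complex.norm_real, Complex.ofReal_sub]
    rw [e4] at h4
    have e5 : ((PP x).card : ℂ) - Li x = (((PP x).card : ℂ) - (∑ n ∈ Finset.Icc 2 ⌊x⌋₊, a1 n / Real.log n + ((∑ n ∈ Finset.Icc 2 ⌊x⌋₊, 1 / Real.log n : ℝ) : ℂ)))
      + (∑ n ∈ Finset.Icc 2 ⌊x⌋₊, a1 n / Real.log n) + (((∑ n ∈ Finset.Icc 2 ⌊x⌋₊, 1 / Real.log n : ℝ) : ℂ) - Li x) := by ring
    rw [e5]
    have h6 := norm_add₃_le (a := ((PP x).card : ℂ) - (∑ n ∈ Finset.Icc 2 ⌊x⌋₊, a1 n / Real.log n + ((∑ n ∈ Finset.Icc 2 ⌊x⌋₊, 1 / Real.log n : ℝ) : ℂ)))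
      (b := ∑ n ∈ Finset.Icc 2 ⌊x⌋₊, a1 n / Real.log n) (c := ((∑ n ∈ Finset.Icc 2 ⌊x⌋₊, 1 / Real.log n : ℝ) : ℂ) - Li x)
    refine h6.trans ?_
    rw [mul_div_assoc] at h3 h2 ⊢
    nlinarith
  · intro n
    rw [a1, Pi.sub_apply, Pi.one_apply]
    refine (norm_sub_le _ _).trans ?_
    rw [cL, norm_mul, Complex.norm_real, Real.norm_of_nonneg ArithmeticFunction.vonMangoldt_nonneg]
    have a := norm_chi_le (1 : DirichletCharacter ℂ 1) n
    have b := ArithmeticFunction.vonMangoldt_le_log (n := n)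
    have c : 0 ≤ ArithmeticFunction.vonMangoldt n := ArithmeticFunction.vonMangoldt_nonneg
    rw [norm_one]
    nlinarith
  · intro s h1 h2
    refine (hD s h1 h2).trans ?_
    gcongr
    linarith

noncomputable def pi1 (x : ℝ) (d : ℕ) : ℕ := ((PP x).filter (fun p => d ∣ p - 1)).card

theorem sw (m : ℕ) : ∃ K : ℝ, 1 ≤ K ∧ ∀ (d : ℕ) (x : ℝ), d ≠ 0 → 9 ≤ x →
    |(pi1 x d : ℝ) - Li x / d.totient| ≤ K * d * x / Real.log x ^ (m+1) := by
  obtain ⟨K1, hK1, H1⟩ := sw_chi m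
  obtain ⟨K2, hK2, H2⟩ := pnt m
  obtain ⟨C2, hC2, hs⟩ := sqrt_small m
  refine ⟨K1 + K2 + C2, by linarith, ?_⟩
  intro d x hd hx
  haveI : NeZero d := ⟨hd⟩
  have hL : 1 < Real.log x := log3 (by linarith)
  have hφ : (1:ℝ) ≤ d.totient := by exact_mod_cast Nat.totient_pos.2 (Nat.pos_of_ne_zero hd)
  have hd1 : (1:ℝ) ≤ d := by exact_mod_cast Nat.pos_of_ne_zero hd
  have horth : ∑ χ : DirichletCharacter ℂ d, ∑ p ∈ PP x, χ (p : ZMod d) = (d.totient : ℂ) * pi1 x d := by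
    rw [Finset.sum_comm]
    simp only [sum_characters_eq]
    rw [← Finset.sum_filter, Finset.sum_const, nsmul_eq_mul, mul_comm]
    congr 3
    refine Finset.filter_congr fun p hp => ?_
    simp only [PP, Finset.mem_filter] at hp
    have : (p : ZMod d) = 1 ↔ ((1:ℕ) : ZMod d) = (p:ZMod d) := by rw [Nat.cast_one]; exact eq_comm
    rw [this, ZMod.natCast_eq_natCast_iff, Nat.modEq_iff_dvd' hp.2.one_lt.le]
  have hprin : ‖∑ p ∈ PP x, (1 : DirichletCharacter ℂ d) (p : ZMod d) - (PP x).card‖ ≤ d := by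
    have : ∑ p ∈ PP x, (1 : DirichletCharacter ℂ d) (p : ZMod d) - (PP x).card = ∑ p ∈ PP x, ((1 : DirichletCharacter ℂ d) (p : ZMod d) - 1) := by
      rw [Finset.sum_sub_distrib]; simp
    rw [this]
    calc _ ≤ ∑ p ∈ PP x, ‖(1 : DirichletCharacter ℂ d) (p : ZMod d) - 1‖ := norm_sum_le _ _
      _ ≤ ∑ p ∈ PP x, (if p ∣ d then (1:ℝ) else 0) := by
        refine Finset.sum_le_sum fun p hp => ?_
        simp only [PP, Finset.mem_filter] at hp
        split_ifs with h
        · by_cases hu : IsUnit (p : ZMod d)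
          · rw [MulChar.one_apply hu]; simp
          · rw [MulChar.map_nonunit _ hu]; simp
        · rw [MulChar.one_apply ((ZMod.isUnit_iff_coprime p d).2 ((Nat.Prime.coprime_iff_not_dvd hp.2).2 h))]; simp
      _ = ((PP x).filter (fun p => p ∣ d)).card := by
        rw [← Finset.sum_filter]; simp
      _ ≤ d := by
        have : (PP x).filter (fun p => p ∣ d) ⊆ d.divisors := by
          intro p hp
          rw [Finset.mem_filter] at hp
          exact Nat.mem_divisors.2 ⟨hp.2, hd⟩
        exact_mod_cast (Finset.card_le_card this).trans (Nat.card_divisors_le_self d)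
  have hp2 := H2 x hx
  have e3 : |((PP x).card : ℝ) - Li x| = ‖((PP x).card : ℂ) - Li x‖ := by
    rw [← Real.norm_eq_abs, ← Complex.norm_real]; push_cast; rfl
  rw [e3] at hp2
  have h3 := (one_small hx).trans (hs x hx)
  rw [← Finset.add_sum_erase _ _ (Finset.mem_univ (1 : DirichletCharacter ℂ d))] at horth
  have hrest : ‖∑ χ ∈ Finset.univ.erase (1 : DirichletCharacter ℂ d), ∑ p ∈ PP x, χ (p : ZMod d)‖ ≤ d.totient * (K1 * d * x / Real.log x ^ (m+1)) := by
    calc _ ≤ ∑ χ ∈ Finset.univ.erase (1 : DirichletCharacter ℂ d), ‖∑ p ∈ PP x, χ (p : ZMod d)‖ := norm_sum_le _ _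
      _ ≤ ∑ χ ∈ Finset.univ.erase (1 : DirichletCharacter ℂ d), (K1 * d * x / Real.log x ^ (m+1)) := by
        refine Finset.sum_le_sum fun χ hχ => H1 d χ x (Finset.ne_of_mem_erase hχ) hx
      _ ≤ ∑ χ : DirichletCharacter ℂ d, (K1 * d * x / Real.log x ^ (m+1)) := by
        refine Finset.sum_le_sum_of_subset_of_nonneg (Finset.erase_subset _ _) fun _ _ _ => ?_
        have : 0 ≤ x := by linarith
        positivity
      _ = _ := by
        rw [Finset.sum_const, Finset.card_univ, ← Nat.card_eq_fintype_card, DirichletCharacter.card_eq_totient_of_hasEnoughRootsOfUnity ℂ d, nsmul_eq_mul]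
  have tot : ‖(d.totient : ℂ) * pi1 x d - Li x‖ ≤ d.totient * ((K1 + K2 + C2) * d * x / Real.log x ^ (m+1)) := by
    rw [← horth]
    have e5 : ∑ p ∈ PP x, (1 : DirichletCharacter ℂ d) (p : ZMod d) + ∑ χ ∈ Finset.univ.erase (1 : DirichletCharacter ℂ d), ∑ p ∈ PP x, χ (p : ZMod d) - Li x
      = (∑ p ∈ PP x, (1 : DirichletCharacter ℂ d) (p : ZMod d) - (PP x).card) + ∑ χ ∈ Finset.univ.erase (1 : DirichletCharacter ℂ d), ∑ p ∈ PP x, χ (p : ZMod d) + ((PP x).card - Li x) := by ring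
    rw [e5]
    refine norm_add₃_le.trans ?_
    have hz : 0 ≤ x / Real.log x ^ (m+1) := div_nonneg (by linarith) (by positivity)
    rw [mul_div_assoc] at h3 hp2 hrest ⊢
    set Z := x / Real.log x ^ (m+1)
    set T : ℝ := (d.totient:ℝ)
    have hTd : 1 ≤ T * d := by nlinarith
    have a1 : (d:ℝ) ≤ T * (C2 * d * Z) := by
      calc (d:ℝ) ≤ d * (C2 * Z) := by nlinarith
        _ = 1 * (d * (C2 * Z)) := by ring
        _ ≤ T * (d * (C2 * Z)) := by gcongr
        _ = _ := by ring
    have a2 : K2 * Z ≤ T * (K2 * d * Z) := by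
      calc K2 * Z = 1 * (K2 * Z) := by ring
        _ ≤ (T * d) * (K2 * Z) := by gcongr
        _ = _ := by ring
    have : T * ((K1 + K2 + C2) * d * Z) = T * (C2 * d * Z) + T * (K1 * d * Z) + T * (K2 * d * Z) := by ring
    linarith
  have e6 : |(pi1 x d : ℝ) - Li x / d.totient| = ‖(d.totient : ℂ) * pi1 x d - Li x‖ / d.totient := by
    have : (d.totient : ℂ) * pi1 x d - Li x = ((d.totient * (pi1 x d - Li x / d.totient) : ℝ) : ℂ) := by
      push_cast
      have : (d.totient : ℂ) ≠ 0 := by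
        have : (d.totient : ℝ) ≠ 0 := by linarith
        exact_mod_cast this
      field_simp
    rw [this, Complex.norm_real, norm_mul, Real.norm_of_nonneg (by linarith), Real.norm_eq_abs]
    field_simp
  rw [e6, div_le_iff₀ (by linarith)]
  linarith

end FixPt

namespace FixPt
open Complex MeasureTheory Finset Set Filter Topology DirichletCharacter

noncomputable def ug (q : ℕ) : ℝ := (1 - 1 / (q:ℝ)) ^ 2 - 1

open Classical in
noncomputable def fG (d : ℕ) : ℝ := if Squarefree d then ∏ q ∈ d.primeFactors, ug q else 0

lemma sqfree_prod {S : Finset ℕ} (hS : ∀ q ∈ S, Nat.Prime q) : Squarefree (∏ q ∈ S, q) := by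
  refine Finset.squarefree_prod_of_pairwise_isCoprime ?_ fun q hq => (hS q hq).squarefree
  intro a ha b hb hab
  exact Nat.coprime_iff_isRelPrime.1 ((Nat.coprime_primes (hS a ha) (hS b hb)).2 hab)

lemma totient_real (n : ℕ) : (n.totient : ℝ) = n * ∏ p ∈ n.primeFactors, (1 - (p:ℝ)⁻¹) := by
  have := congrArg (fun r : ℚ => (r:ℝ)) (Nat.totient_eq_mul_prod_factors n)
  push_cast at this
  exact this

lemma fG_sum {n : ℕ} (hn : n ≠ 0) : ∑ d ∈ n.divisors, fG d = ((n.totient : ℝ) / n) ^ 2 := by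
  have h1 : ((n.totient : ℝ) / n) ^ 2 = ∏ q ∈ n.primeFactors, (1 + ug q) := by
    have h2 := totient_real n
    rw [h2, mul_div_cancel_left₀ _ (by exact_mod_cast hn), ← Finset.prod_pow]
    refine Finset.prod_congr rfl fun q _ => ?_
    unfold ug; rw [one_div]; ring
  rw [h1, Finset.prod_one_add]
  symm
  have h3 : ∑ d ∈ n.divisors, fG d = ∑ d ∈ n.divisors.filter Squarefree, ∏ q ∈ d.primeFactors, ug q := by
    rw [Finset.sum_filter]
    refine Finset.sum_congr rfl fun d _ => ?_
    unfold fG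
    split_ifs <;> rfl
  rw [h3]
  refine Finset.sum_bij' (fun S _ => ∏ q ∈ S, q) (fun d _ => d.primeFactors) ?_ ?_ ?_ ?_ ?_
  · intro S hS
    rw [Finset.mem_powerset] at hS
    rw [Finset.mem_filter, Nat.mem_divisors]
    refine ⟨⟨?_, hn⟩, sqfree_prod fun q hq => Nat.prime_of_mem_primeFactors (hS hq)⟩
    exact (Finset.prod_dvd_prod_of_subset _ _ _ hS).trans (Nat.prod_primeFactors_dvd n)
  · intro d hd
    rw [Finset.mem_filter, Nat.mem_divisors] at hd
    rw [Finset.mem_powerset]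
    exact Nat.primeFactors_mono hd.1.1 hn
  · intro S hS
    rw [Finset.mem_powerset] at hS
    exact Nat.primeFactors_prod fun q hq => Nat.prime_of_mem_primeFactors (hS hq)
  · intro d hd
    rw [Finset.mem_filter] at hd
    exact Nat.prod_primeFactors_of_squarefree hd.2
  · intro S hS
    rw [Finset.mem_powerset] at hS
    rw [Nat.primeFactors_prod fun q hq => Nat.prime_of_mem_primeFactors (hS hq)]

lemma ug_abs {q : ℕ} (hq : 2 ≤ q) : |ug q| ≤ 2 / q ∧ |ug q| ≤ 1 := by
  have h2 : (2:ℝ) ≤ q := by exact_mod_cast hq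
  have h1 : 1 / (q:ℝ) ≤ 1 / 2 := one_div_le_one_div_of_le (by norm_num) h2
  have h0 : 0 < 1 / (q:ℝ) := by positivity
  unfold ug
  rw [show 2 / (q:ℝ) = 2 * (1 / q) by ring]
  set u := 1 / (q:ℝ)
  rw [abs_le, abs_le]
  constructor <;> constructor <;> nlinarith

lemma fG_abs1 (d : ℕ) : |fG d| ≤ 1 := by
  unfold fG
  split_ifs
  · rw [Finset.abs_prod]
    exact Finset.prod_le_one (fun _ _ => abs_nonneg _) fun q hq => (ug_abs (Nat.prime_of_mem_primeFactors hq).two_le).2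
  · simp

lemma fG_abs2 {d : ℕ} (hd : d ≠ 0) : |fG d| ≤ 2 ^ d.primeFactors.card / d := by
  unfold fG
  split_ifs with h
  · rw [Finset.abs_prod]
    calc _ ≤ ∏ q ∈ d.primeFactors, (2 / (q:ℝ)) := 
          Finset.prod_le_prod (fun _ _ => abs_nonneg _) fun q hq => (ug_abs (Nat.prime_of_mem_primeFactors hq).two_le).1
      _ = _ := by
        rw [Finset.prod_div_distrib, Finset.prod_const]
        congr 1
        rw [← Nat.cast_prod, Nat.prod_primeFactors_of_squarefree h]
  · simp; positivity

lemma fG_abs3 {d : ℕ} (hd : d ≠ 0) : |fG d| / d.totient ≤ 4 ^ d.primeFactors.card / (d:ℝ) ^ 2 := by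
  have hd0 : (0:ℝ) < d := by exact_mod_cast Nat.pos_of_ne_zero hd
  have hφ : (0:ℝ) < d.totient := by exact_mod_cast Nat.totient_pos.2 (Nat.pos_of_ne_zero hd)
  have h1 : (d:ℝ) / 2 ^ d.primeFactors.card ≤ d.totient := by
    have h2 : (d.totient : ℝ) = d * ∏ p ∈ d.primeFactors, (1 - (p:ℝ)⁻¹) := totient_real d
    rw [h2, div_eq_mul_inv, ← inv_pow, ← Finset.prod_const]
    gcongr with q hq
    · have h2 : (2:ℝ) ≤ q := by exact_mod_cast (Nat.prime_of_mem_primeFactors hq).two_le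
      have : (q:ℝ)⁻¹ ≤ 2⁻¹ := inv_anti₀ (by norm_num) h2
      linarith
  calc |fG d| / d.totient ≤ (2 ^ d.primeFactors.card / d) / ((d:ℝ) / 2 ^ d.primeFactors.card) := by
        gcongr; exact fG_abs2 hd
    _ = _ := by
        rw [show (4:ℝ) = 2 * 2 by norm_num, mul_pow]; field_simp

noncomputable def gG (d : ℕ) : ℝ := fG d / d.totient

lemma pi1_le {x : ℝ} (hx : 1 ≤ x) (d : ℕ) (hd : d ≠ 0) : (pi1 x d : ℝ) ≤ x / d := by
  have h1 : pi1 x d ≤ ⌊x⌋₊ / d := by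
    rw [← Nat.card_multiples]
    unfold pi1
    refine Finset.card_le_card_of_injOn (fun p => p - 2) ?_ ?_
    · intro p hp
      simp only [PP, Finset.coe_filter, Finset.mem_filter, Finset.mem_Iic, Set.mem_setOf_eq] at hp
      have := hp.1.2.two_le
      simp only [Finset.coe_filter, Finset.mem_range, Set.mem_setOf_eq]
      refine ⟨by omega, ?_⟩
      rw [show p - 2 + 1 = p - 1 by omega]; exact hp.2
    · intro a ha b hb hab
      simp only [PP, Finset.coe_filter, Finset.mem_filter, Finset.mem_Iic, Set.mem_setOf_eq] at ha hb
      have := ha.1.2.two_le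
      have := hb.1.2.two_le
      simp only at hab
      omega
  calc (pi1 x d : ℝ) ≤ ((⌊x⌋₊ / d : ℕ) : ℝ) := by exact_mod_cast h1
    _ ≤ (⌊x⌋₊ : ℝ) / d := Nat.cast_div_le
    _ ≤ x / d := by gcongr; exact Nat.floor_le (by linarith)

lemma tail_bd : ∃ C : ℝ, 1 ≤ C ∧ ∀ d : ℕ, d ≠ 0 → 4 ^ d.primeFactors.card / (d:ℝ) ^ 2 ≤ C * (d:ℝ) ^ (-(3/2) : ℝ) := by
  obtain ⟨C, hC, h⟩ := omega_bound 4 (1/2) (by norm_num) (by norm_num)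
  refine ⟨C, hC, fun d hd => ?_⟩
  have hd0 : (0:ℝ) < d := by exact_mod_cast Nat.pos_of_ne_zero hd
  calc _ ≤ (C * (d:ℝ) ^ (1/2:ℝ)) / (d:ℝ) ^ 2 := by gcongr; exact h d hd
    _ = _ := by
      rw [mul_div_assoc, ← Real.rpow_natCast, ← Real.rpow_sub hd0]; norm_num

lemma gG_summable : Summable fun d => ‖gG d‖ := by
  obtain ⟨C, hC, h⟩ := tail_bd
  refine Summable.of_nonneg_of_le (fun _ => norm_nonneg _) (fun d => ?_) ((Real.summable_nat_rpow (p := -(3/2))).2 (by norm_num) |>.mul_left C)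
  by_cases hd : d = 0
  · simp [hd, gG]
  · rw [gG, norm_div, Real.norm_eq_abs, Real.norm_natCast]
    exact (fG_abs3 hd).trans (h d hd)

lemma fG_mul {m n : ℕ} (h : m.Coprime n) : fG (m * n) = fG m * fG n := by
  unfold fG
  by_cases hm : Squarefree m
  · by_cases hn : Squarefree n
    · rw [if_pos ((Nat.squarefree_mul h).2 ⟨hm, hn⟩), if_pos hm, if_pos hn, h.primeFactors_mul, Finset.prod_union h.disjoint_primeFactors]
    · rw [if_neg (fun h' => hn ((Nat.squarefree_mul h).1 h').2), if_neg hn, mul_zero]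
  · rw [if_neg (fun h' => hm ((Nat.squarefree_mul h).1 h').1), if_neg hm, zero_mul]

lemma gG_euler : (∏' p : Nat.Primes, (1 + ((1 - 1 / ((p : ℕ) : ℝ)) ^ 2 - 1) / (((p : ℕ) : ℝ) - 1))) = ∑' d, gG d := by
  rw [← EulerProduct.eulerProduct_tprod (f := gG)]
  · congr 1; ext p
    have hp := p.2
    rw [tsum_eq_sum (s := Finset.range 2)]
    · rw [Finset.sum_range_succ, Finset.sum_range_one, pow_zero, pow_one]
      congr 1
      · simp [gG, fG]
      · rw [gG, fG, if_pos hp.squarefree, hp.primeFactors, Finset.prod_singleton, Nat.totient_prime hp, Nat.cast_sub hp.one_lt.le, ug]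
        simp
    · intro e he
      rw [Finset.mem_range, not_lt] at he
      rw [gG, fG, if_neg, zero_div]
      rw [Nat.squarefree_pow_iff hp.one_lt.ne' (by omega)]
      omega
  · simp [gG, fG]
  · intro m n h
    rw [gG, gG, gG, fG_mul h, Nat.totient_mul h, Nat.cast_mul, mul_div_mul_comm]
  · exact gG_summable
  · simp [gG, fG]

lemma sum_swap (x : ℝ) : ∑ p ∈ PP x, (((p-1).totient : ℝ) / ((p - 1 : ℕ):ℝ)) ^ 2 = ∑ d ∈ Finset.Icc 1 ⌊x⌋₊, fG d * pi1 x d := by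
  have h1 : ∀ p ∈ PP x, (((p-1).totient : ℝ) / ((p - 1 : ℕ):ℝ)) ^ 2 = ∑ d ∈ Finset.Icc 1 ⌊x⌋₊, if d ∣ p - 1 then fG d else 0 := by
    intro p hp
    simp only [PP, Finset.mem_filter, Finset.mem_Iic] at hp
    have := hp.2.two_le
    rw [← fG_sum (by omega), ← Finset.sum_filter]
    refine Finset.sum_congr ?_ fun _ _ => rfl
    ext d
    simp only [Nat.mem_divisors, Finset.mem_filter, Finset.mem_Icc]
    constructor
    · rintro ⟨h1, h2⟩
      have := Nat.le_of_dvd (by omega) h1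
      exact ⟨⟨Nat.pos_of_dvd_of_pos h1 (by omega), by omega⟩, h1⟩
    · rintro ⟨_, h⟩
      exact ⟨h, by omega⟩
  rw [Finset.sum_congr rfl h1, Finset.sum_comm]
  refine Finset.sum_congr rfl fun d _ => ?_
  rw [← Finset.sum_filter, Finset.sum_const, nsmul_eq_mul, mul_comm]; rfl

lemma pi1_zero {x : ℝ} (d : ℕ) (hd : d ∉ Finset.Icc 1 ⌊x⌋₊) : fG d * pi1 x d = 0 := by
  by_cases h0 : d = 0
  · simp [h0, fG]
  have : pi1 x d = 0 := by
    unfold pi1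
    rw [Finset.card_eq_zero, Finset.filter_eq_empty_iff]
    intro p hp hdp
    simp only [PP, Finset.mem_filter, Finset.mem_Iic] at hp
    rw [Finset.mem_Icc] at hd
    have := hp.2.two_le
    have := Nat.le_of_dvd (by omega) hdp
    omega
  rw [this]; simp

lemma Li_bd {x : ℝ} (hx : 2 ≤ x) : 0 ≤ Li x ∧ Li x ≤ 2 * x := by
  refine ⟨intervalIntegral.integral_nonneg hx fun t ht => (invlog_bd ht.1).1, ?_⟩
  unfold Li
  calc _ ≤ ∫ t in (2:ℝ)..x, (2:ℝ) := intervalIntegral.integral_mono_on hx (invlog_int le_rfl hx) (by simp) fun t ht => (invlog_bd ht.1).2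
    _ ≤ _ := by simp; linarith

theorem phi_avg (r : ℕ) : ∃ K : ℝ, 1 ≤ K ∧ ∀ x : ℝ, 9 ≤ x →
    |∑ p ∈ PP x, (((p-1).totient : ℝ) / ((p - 1 : ℕ):ℝ)) ^ 2 - (∏' p : Nat.Primes, (1 + ((1 - 1 / ((p : ℕ) : ℝ)) ^ 2 - 1) / (((p : ℕ) : ℝ) - 1))) * Li x| ≤ K * x / Real.log x ^ r := by
  obtain ⟨K, hK, H⟩ := sw (13 * r)
  obtain ⟨C, hC, hT⟩ := tail_bd
  have hZs : Summable (fun d : ℕ => (d:ℝ) ^ (-(5/4) : ℝ)) := Real.summable_nat_rpow.2 (by norm_num)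
  set Z := ∑' d : ℕ, (d:ℝ) ^ (-(5/4) : ℝ) with hZ
  have hZ1 : 1 ≤ Z := by
    have := hZs.le_tsum 1 (fun d _ => by positivity)
    simpa using this
  refine ⟨(K + 3 * C) * Z, by nlinarith, ?_⟩
  intro x hx
  have hx0 : 0 < x := by linarith
  set L := Real.log x with hL
  have hL1 : 1 < L := log3 (by linarith)
  obtain ⟨hLi0, hLi⟩ := Li_bd (x := x) (by linarith)
  have hs1 : HasSum (fun d => fG d * pi1 x d) (∑ d ∈ Finset.Icc 1 ⌊x⌋₊, fG d * pi1 x d) := hasSum_sum_of_ne_finset_zero pi1_zero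
  have hs2 : HasSum (fun d => gG d * Li x) ((∑' d, gG d) * Li x) := (gG_summable.of_norm).hasSum.mul_right _
  have hs := hs1.sub hs2
  rw [sum_swap, gG_euler, ← hs.tsum_eq, ← Real.norm_eq_abs]
  have hbound : ∀ d : ℕ, ‖fG d * pi1 x d - gG d * Li x‖ ≤ ((K + 3 * C) * x / L ^ r) * (d:ℝ) ^ (-(5/4) : ℝ) := by
    intro d
    by_cases hd : d = 0
    · simp [hd, fG, gG]
    have hd0 : (0:ℝ) < d := by exact_mod_cast Nat.pos_of_ne_zero hd
    have hd1 : (1:ℝ) ≤ d := by exact_mod_cast Nat.pos_of_ne_zero hd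
    have hφ : (0:ℝ) < d.totient := by exact_mod_cast Nat.totient_pos.2 (Nat.pos_of_ne_zero hd)
    by_cases hD : (d:ℝ) ≤ L ^ (4 * r)
    · have e1 : fG d * pi1 x d - gG d * Li x = fG d * (pi1 x d - Li x / d.totient) := by
        rw [gG]; ring
      rw [e1, norm_mul, Real.norm_eq_abs, Real.norm_eq_abs]
      have h1 := H d x hd hx
      have h2 := fG_abs1 d
      have e2 : (d:ℝ) ≤ L ^ (12 * r) * (d:ℝ) ^ (-(5/4) : ℝ) := by
        rw [Real.rpow_neg hd0.le, ← div_eq_mul_inv, le_div_iff₀ (by positivity)]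
        calc (d:ℝ) * (d:ℝ) ^ (5/4 : ℝ) ≤ d * (d:ℝ) ^ (2:ℝ) := by
              gcongr
              · norm_num
          _ = (d:ℝ) ^ 3 := by
              rw [show (2:ℝ) = ((2:ℕ):ℝ) by norm_num, Real.rpow_natCast]; ring
          _ ≤ (L ^ (4 * r)) ^ 3 := by gcongr
          _ = _ := by rw [← pow_mul]; congr 1; ring
      have e3 : L ^ (12 * r) / L ^ (13 * r + 1) ≤ 1 / L ^ r := by
        rw [div_le_div_iff₀ (by positivity) (by positivity), one_mul, ← pow_add]
        exact pow_le_pow_right₀ hL1.le (by omega)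
      calc |fG d| * |(pi1 x d : ℝ) - Li x / d.totient| ≤ 1 * (K * d * x / L ^ (13 * r + 1)) := by gcongr
        _ ≤ 1 * (K * (L ^ (12 * r) * (d:ℝ) ^ (-(5/4) : ℝ)) * x / L ^ (13 * r + 1)) := by gcongr
        _ = K * x * (d:ℝ) ^ (-(5/4) : ℝ) * (L ^ (12 * r) / L ^ (13 * r + 1)) := by ring
        _ ≤ K * x * (d:ℝ) ^ (-(5/4) : ℝ) * (1 / L ^ r) := by gcongr
        _ = (K * x / L ^ r) * (d:ℝ) ^ (-(5/4) : ℝ) := by ring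
        _ ≤ _ := by gcongr; linarith
    · push Not at hD
      have h1 : |fG d| * pi1 x d ≤ C * (d:ℝ) ^ (-(3/2) : ℝ) * x := by
        calc |fG d| * pi1 x d ≤ (2 ^ d.primeFactors.card / d) * (x / d) := by
              gcongr
              · exact fG_abs2 hd
              · exact pi1_le (by linarith) d hd
          _ = (2 ^ d.primeFactors.card / (d:ℝ)^2) * x := by field_simp
          _ ≤ (4 ^ d.primeFactors.card / (d:ℝ)^2) * x := by gcongr; norm_num
          _ ≤ _ := by gcongr; exact hT d hd
      have h2 : |gG d| * Li x ≤ C * (d:ℝ) ^ (-(3/2) : ℝ) * (2 * x) := by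
        rw [gG, abs_div, Nat.abs_cast]
        gcongr
        exact (fG_abs3 hd).trans (hT d hd)
      have h3 : ‖fG d * pi1 x d - gG d * Li x‖ ≤ |fG d| * pi1 x d + |gG d| * Li x := by
        refine (norm_sub_le _ _).trans (le_of_eq ?_)
        rw [norm_mul, norm_mul, Real.norm_natCast, Real.norm_of_nonneg hLi0]
        rfl
      have h4 : (d:ℝ) ^ (-(3/2) : ℝ) ≤ 1 / L ^ r * (d:ℝ) ^ (-(5/4) : ℝ) := by
        rw [show (-(3/2) : ℝ) = -(1/4) + -(5/4) by norm_num, Real.rpow_add hd0]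
        gcongr
        rw [Real.rpow_neg hd0.le, ← one_div]
        gcongr
        calc L ^ r = (L ^ (4 * r)) ^ (1/4 : ℝ) := by
              rw [← Real.rpow_natCast, ← Real.rpow_natCast, ← Real.rpow_mul (by linarith)]
              congr 1; push_cast; ring
          _ ≤ _ := by gcongr
      calc _ ≤ 3 * C * x * (d:ℝ) ^ (-(3/2) : ℝ) := by linarith
        _ ≤ 3 * C * x * (1 / L ^ r * (d:ℝ) ^ (-(5/4) : ℝ)) := by gcongr
        _ = (3 * C * x / L ^ r) * (d:ℝ) ^ (-(5/4) : ℝ) := by ring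
        _ ≤ _ := by gcongr; linarith
  refine (tsum_of_norm_bounded (hZs.hasSum.mul_left _) hbound).trans (le_of_eq ?_)
  rw [← hZ]; ring

end FixPt

namespace FixPt
open Complex MeasureTheory Finset Set Filter Topology DirichletCharacter

section
variable {p : ℕ} [hp : Fact p.Prime]

noncomputable def psi (p : ℕ) [Fact p.Prime] : AddChar (ZMod p) ℂ := ZMod.stdAddChar

lemma psi_norm (a : ZMod p) : ‖psi p a‖ = 1 := AddChar.norm_apply _ _

open Classical in
lemma psi_sum (b : ZMod p) : ∑ a : ZMod p, psi p (a * b) = if b = 0 then (p:ℂ) else 0 := by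
  have := AddChar.sum_mulShift (ψ := psi p) b (ZMod.isPrimitive_stdAddChar p)
  rw [ZMod.card] at this
  rw [this]
  split_ifs <;> simp

open Classical in
noncomputable def etaH (H : Subgroup (ZMod p)ˣ) (a : ZMod p) : ℂ :=
  ∑ u : (ZMod p)ˣ with u ∈ H, psi p (a * u)

open Classical in
lemma eta_sq (H : Subgroup (ZMod p)ˣ) :
    ∑ a : ZMod p, ‖etaH H a‖ ^ 2 = p * ((univ : Finset (ZMod p)ˣ).filter (· ∈ H)).card := by
  have h : ∀ a : ZMod p, ((‖etaH H a‖ ^ 2 : ℝ) : ℂ) =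
      ∑ u : (ZMod p)ˣ with u ∈ H, ∑ v : (ZMod p)ˣ with v ∈ H, psi p (a * (u - v)) := by
    intro a
    push_cast
    rw [← Complex.mul_conj', etaH, map_sum, Finset.sum_mul_sum]
    refine Finset.sum_congr rfl fun u _ => Finset.sum_congr rfl fun v _ => ?_
    rw [← AddChar.map_neg_eq_conj, ← AddChar.map_add_eq_mul]
    congr 1; ring
  have h2 : ((∑ a : ZMod p, ‖etaH H a‖ ^ 2 : ℝ) : ℂ) = ((p * ((univ : Finset (ZMod p)ˣ).filter (· ∈ H)).card : ℝ) : ℂ) := by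
    push_cast
    have h' := fun a => h a
    push_cast at h'
    simp_rw [h']
    rw [Finset.sum_comm]
    simp_rw [Finset.sum_comm (s := (univ : Finset (ZMod p))), psi_sum, sub_eq_zero, Units.val_inj]
    rw [Finset.sum_congr rfl (g := fun _ => (p:ℂ))]
    · rw [Finset.sum_const]; simp [mul_comm]
    · intro u hu
      rw [Finset.sum_ite_eq, if_pos hu]
  exact_mod_cast h2

open Classical in
lemma eta_bound (H : Subgroup (ZMod p)ˣ) {a : ZMod p} (ha : a ≠ 0) : ‖etaH H a‖ ≤ Real.sqrt p := by
  have h1 := eta_sq H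
  set S := (univ : Finset (ZMod p)ˣ).filter (· ∈ H) with hS
  have h2 : ∀ w ∈ S, ‖etaH H (a * w)‖ ^ 2 = ‖etaH H a‖ ^ 2 := by
    intro w hw
    rw [hS, Finset.mem_filter] at hw
    congr 2
    unfold etaH
    refine Finset.sum_bij' (fun u _ => w * u) (fun u _ => w⁻¹ * u) ?_ ?_ ?_ ?_ ?_
    · intro u hu
      rw [Finset.mem_filter] at hu ⊢
      exact ⟨Finset.mem_univ _, H.mul_mem hw.2 hu.2⟩
    · intro u hu
      rw [Finset.mem_filter] at hu ⊢
      exact ⟨Finset.mem_univ _, H.mul_mem (H.inv_mem hw.2) hu.2⟩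
    · intros; simp
    · intros; simp
    · intros; congr 1; push_cast; ring
  have h3 : ∑ w ∈ S, ‖etaH H (a * w)‖ ^ 2 ≤ ∑ a : ZMod p, ‖etaH H a‖ ^ 2 := by
    rw [← Finset.sum_image (s := S) (g := fun w : (ZMod p)ˣ => a * (w : ZMod p)) (f := fun b => ‖etaH H b‖ ^ 2)]
    · exact Finset.sum_le_sum_of_subset_of_nonneg (Finset.subset_univ _) fun _ _ _ => by positivity
    · intro u _ v _ huv
      exact Units.ext (mul_left_cancel₀ ha huv)
  rw [Finset.sum_congr rfl h2, Finset.sum_const, nsmul_eq_mul, h1] at h3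
  have h4 : (0:ℝ) < S.card := by
    have : (1 : (ZMod p)ˣ) ∈ S := by rw [hS, Finset.mem_filter]; exact ⟨Finset.mem_univ _, H.one_mem⟩
    exact_mod_cast Finset.card_pos.2 ⟨1, this⟩
  refine Real.le_sqrt_of_sq_le ?_
  nlinarith

lemma psi_one_sub {b : ℕ} (hb : 0 < b) (hb' : b < p) :
    1 / ‖psi p (b : ZMod p) - 1‖ ≤ (p:ℝ) / 4 * (1 / b + 1 / (p - b : ℕ)) := by
  have hp0 : (0:ℝ) < p := by exact_mod_cast hp.out.pos
  have hb0 : (0:ℝ) < b := by exact_mod_cast hb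
  have hc : ((p - b : ℕ) : ℝ) = p - b := by push_cast [hb'.le]; ring
  have hc0 : (0:ℝ) < ((p - b : ℕ) : ℝ) := by exact_mod_cast Nat.sub_pos_of_lt hb'
  have e1 : psi p (b : ZMod p) = Complex.exp (Complex.I * ((2 * Real.pi * b / p : ℝ) : ℂ)) := by
    have := ZMod.stdAddChar_coe (N := p) (b : ℤ)
    unfold psi
    push_cast at this
    rw [this]
    congr 1; push_cast; ring
  have e2 : ‖psi p (b : ZMod p) - 1‖ = 2 * |Real.sin (Real.pi * b / p)| := by
    rw [e1, Complex.norm_exp_I_mul_ofReal_sub_one, Real.norm_eq_abs, abs_mul, abs_two]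
    congr 3; ring
  rw [e2]
  have hpi := Real.pi_pos
  by_cases h : (b:ℝ) ≤ p / 2
  · have h1 := Real.mul_le_sin (x := Real.pi * b / p) (by positivity) (by
      rw [div_le_div_iff₀ hp0 two_pos]; nlinarith)
    have h2 : 2 / Real.pi * (Real.pi * b / p) = 2 * b / p := by field_simp
    rw [h2] at h1
    have h3 : 4 * b / p ≤ 2 * |Real.sin (Real.pi * b / p)| := by
      have := le_abs_self (Real.sin (Real.pi * b / p))
      calc 4 * (b:ℝ) / p = 2 * (2 * b / p) := by ring
        _ ≤ _ := by linarith
    calc _ ≤ 1 / (4 * (b:ℝ) / p) := by gcongr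
      _ = p / 4 * (1 / b) := by field_simp
      _ ≤ _ := by gcongr; simp; 
  · push Not at h
    have h1 := Real.mul_le_sin (x := Real.pi * (p - b : ℕ) / p) (by positivity) (by
      rw [div_le_div_iff₀ hp0 two_pos, hc]; nlinarith)
    have h2 : 2 / Real.pi * (Real.pi * (p - b : ℕ) / p) = 2 * (p - b : ℕ) / p := by field_simp
    rw [h2] at h1
    have h0 : Real.sin (Real.pi * (p - b : ℕ) / p) = Real.sin (Real.pi * b / p) := by
      rw [hc, ← Real.sin_pi_sub]; congr 1; field_simp; ring
    rw [h0] at h1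
    have h3 : 4 * ((p - b : ℕ):ℝ) / p ≤ 2 * |Real.sin (Real.pi * b / p)| := by
      have := le_abs_self (Real.sin (Real.pi * b / p))
      calc 4 * ((p - b : ℕ):ℝ) / p = 2 * (2 * (p - b : ℕ) / p) := by ring
        _ ≤ _ := by linarith
    calc _ ≤ 1 / (4 * ((p - b : ℕ):ℝ) / p) := by gcongr
      _ = p / 4 * (1 / (p - b : ℕ)) := by field_simp
      _ ≤ _ := by gcongr; simp; 

lemma geo_bound (N : ℕ) {b : ZMod p} (hb : b ≠ 0) :
    ‖∑ k ∈ Finset.Icc 1 N, psi p (b * k)‖ ≤ 2 * (1 / ‖psi p b - 1‖) := by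
  have h1 : psi p b ≠ 1 := by
    intro h
    refine hb (ZMod.injective_stdAddChar (N := p) ?_)
    rw [AddChar.map_zero_eq_one]; exact h
  have h2 : ∀ k : ℕ, psi p (b * k) = psi p b ^ k := by
    intro k
    rw [← AddChar.map_nsmul_eq_pow, nsmul_eq_mul, mul_comm]
  simp_rw [h2]
  have h3 : (Finset.Icc 1 N) = Finset.Ico 1 (N+1) := by ext; simp
  rw [h3, geom_sum_Ico h1 (by omega), norm_div, div_eq_mul_one_div]
  gcongr
  refine (norm_sub_le _ _).trans (le_of_eq ?_)
  rw [norm_pow, norm_pow, psi_norm]; norm_num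

open Classical in
lemma geo_sum (N : ℕ) : ∑ b : ZMod p with b ≠ 0, ‖∑ k ∈ Finset.Icc 1 N, psi p (b * k)‖ ≤ p * (1 + Real.log p) := by
  have hp0 : (0:ℝ) < p := by exact_mod_cast hp.out.pos
  have h1 : ∑ b : ZMod p with b ≠ 0, ‖∑ k ∈ Finset.Icc 1 N, psi p (b * k)‖ ≤
      ∑ b : ZMod p with b ≠ 0, (fun b : ℕ => 2 * ((p:ℝ) / 4 * (1 / b + 1 / (p - b : ℕ)))) b.val := by
    refine Finset.sum_le_sum fun b hb => ?_
    rw [Finset.mem_filter] at hb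
    refine (geo_bound N hb.2).trans ?_
    have := psi_one_sub (p := p) (b := b.val) (Nat.pos_of_ne_zero (by simpa using hb.2)) (ZMod.val_lt b)
    rw [ZMod.natCast_zmod_val] at this
    simp only
    linarith
  have h2 : ∀ f : ℕ → ℝ, ∑ b : ZMod p with b ≠ 0, f b.val = ∑ b ∈ Finset.Icc 1 (p-1), f b := by
    intro f
    refine Finset.sum_bij (fun b _ => b.val) ?_ ?_ ?_ ?_
    · intro b hb
      rw [Finset.mem_filter] at hb
      have h1 : b.val ≠ 0 := by simpa using hb.2
      have h2 := ZMod.val_lt b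
      rw [Finset.mem_Icc]; omega
    · intro a _ b _ h; exact ZMod.val_injective p h
    · intro b hb
      rw [Finset.mem_Icc] at hb
      have h1 : b < p := by have := hp.out.pos; omega
      refine ⟨(b : ZMod p), ?_, ZMod.val_natCast_of_lt h1⟩
      rw [Finset.mem_filter]
      refine ⟨Finset.mem_univ _, fun h => ?_⟩
      have := ZMod.val_natCast_of_lt h1
      rw [h, ZMod.val_zero] at this; omega
    · intros; rfl
  refine (h1.trans_eq (h2 (fun b : ℕ => 2 * ((p:ℝ) / 4 * (1 / b + 1 / (p - b : ℕ)))))).trans ?_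
  have h3 : ∑ b ∈ Finset.Icc 1 (p-1), (1 / ((p - b : ℕ):ℝ)) = ∑ b ∈ Finset.Icc 1 (p-1), (1 / (b:ℝ)) := by
    refine Finset.sum_bij' (fun b _ => p - b) (fun b _ => p - b) ?_ ?_ ?_ ?_ ?_
    all_goals intro b hb; rw [Finset.mem_Icc] at hb
    · rw [Finset.mem_Icc]; omega
    · rw [Finset.mem_Icc]; omega
    · omega
    · omega
  have h4 : ∑ b ∈ Finset.Icc 1 (p-1), (1 / (b:ℝ)) ≤ 1 + Real.log p := by
    have := harmonic_le_one_add_log (p-1)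
    rw [harmonic_eq_sum_Icc] at this
    push_cast at this
    simp only [one_div]
    refine this.trans ?_
    by_cases h : p - 1 = 0
    · have : (1:ℝ) ≤ p := by exact_mod_cast hp.out.one_lt.le
      have := Real.log_nonneg this
      rw [h]; simp [this]
    · have : (0:ℝ) < (p - 1 : ℕ) := by exact_mod_cast Nat.pos_of_ne_zero h
      gcongr
      omega
  rw [← Finset.mul_sum, ← Finset.mul_sum, Finset.sum_add_distrib, h3]
  nlinarith

end
end FixPt

namespace FixPt
open Complex MeasureTheory Finset Set Filter Topology DirichletCharacter

open Classical in
lemma mob_gcd {n : ℕ} (hn : n ≠ 0) (k : ℕ) :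
    ∑ d ∈ n.divisors, (if d ∣ k then ArithmeticFunction.moebius d else 0) = if Nat.gcd k n = 1 then 1 else 0 := by
  have h1 := congrArg (fun f => f (Nat.gcd k n)) ArithmeticFunction.moebius_mul_coe_zeta
  simp only [ArithmeticFunction.coe_mul_zeta_apply, ArithmeticFunction.one_apply] at h1
  rw [← h1, ← Finset.sum_filter]
  refine Finset.sum_congr ?_ fun _ _ => rfl
  ext d
  rw [Finset.mem_filter, Nat.mem_divisors, Nat.mem_divisors, Nat.dvd_gcd_iff]
  have : Nat.gcd k n ≠ 0 := Nat.gcd_ne_zero_right hn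
  tauto

lemma mob_abs {n : ℕ} (hn : n ≠ 0) :
    ∑ d ∈ n.divisors, |((ArithmeticFunction.moebius d : ℤ) : ℝ)| = 2 ^ n.primeFactors.card := by
  have h1 : ∑ d ∈ n.divisors, |((ArithmeticFunction.moebius d : ℤ) : ℝ)| =
      ∑ d ∈ n.divisors with Squarefree d, (1:ℝ) := by
    rw [Finset.sum_filter]
    refine Finset.sum_congr rfl fun d _ => ?_
    rw [← Int.cast_abs, ArithmeticFunction.abs_moebius]
    split_ifs <;> simp
  rw [h1, Nat.sum_divisors_filter_squarefree hn]
  rw [Finset.sum_const, Finset.card_powerset, nsmul_eq_mul, mul_one]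
  push_cast
  congr 2
  rw [Nat.factors_eq]
  rfl

lemma tot_mob {n : ℕ} (hn : n ≠ 0) :
    ∑ e ∈ n.divisors, ((ArithmeticFunction.moebius e : ℤ) : ℝ) * ((n / e : ℕ) : ℝ) = n.totient := by
  have := (ArithmeticFunction.sum_eq_iff_sum_mul_moebius_eq (R := ℝ) (f := fun n => (n.totient : ℝ)) (g := fun n => (n : ℝ))).1 (by
    intro m hm
    exact_mod_cast Nat.sum_totient m) n (Nat.pos_of_ne_zero hn)
  rw [← this, Nat.sum_divisorsAntidiagonal (f := fun a b => ((ArithmeticFunction.moebius a : ℤ) : ℝ) * (b : ℝ))]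

section
variable {p : ℕ} [hp : Fact p.Prime]

lemma card_units_p : Nat.card (ZMod p)ˣ = p - 1 := by
  rw [Nat.card_eq_fintype_card, ZMod.card_units]

open Classical in
noncomputable def gens (p : ℕ) [Fact p.Prime] : Finset (ZMod p)ˣ := univ.filter fun u => orderOf u = p - 1

lemma gens_card : (gens p).card = (p-1).totient := by
  have := IsCyclic.card_orderOf_eq_totient (α := (ZMod p)ˣ) (d := p - 1) (by rw [← Nat.card_eq_fintype_card, card_units_p])
  rw [← this]
  unfold gens
  congr 

open Classical in
lemma gen_ind {g : (ZMod p)ˣ} (hg : orderOf g = p - 1) (hg' : ∀ u, u ∈ Subgroup.zpowers g) (u : (ZMod p)ˣ) :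
    ∑ d ∈ (p-1).divisors, (if u ∈ Subgroup.zpowers (g ^ d) then ArithmeticFunction.moebius d else 0) = if orderOf u = p - 1 then 1 else 0 := by
  have hn : 0 < p - 1 := Nat.sub_pos_of_lt hp.out.one_lt
  obtain ⟨k, rfl⟩ := (mem_powers_iff_mem_zpowers.2 (hg' u))
  simp only
  have h1 : ∀ d ∈ (p-1).divisors, (g ^ k ∈ Subgroup.zpowers (g ^ d) ↔ d ∣ k) := by
    intro d hd
    have hd := Nat.dvd_of_mem_divisors hd
    constructor
    · intro h
      obtain ⟨j, hj⟩ := mem_powers_iff_mem_zpowers.2 h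
      simp only at hj
      rw [← pow_mul, pow_eq_pow_iff_modEq, hg] at hj
      exact (hj.of_dvd hd).dvd_iff (dvd_refl d) |>.1 (Dvd.intro _ rfl)
    · rintro ⟨j, rfl⟩
      rw [pow_mul]; exact Subgroup.pow_mem _ (Subgroup.mem_zpowers _) _
  rw [Finset.sum_congr rfl (g := fun d => if d ∣ k then ArithmeticFunction.moebius d else 0)
    (fun d hd => by simp only [h1 d hd]), mob_gcd hn.ne']
  congr 1
  rw [orderOf_pow, hg, Nat.gcd_comm]
  refine propext ⟨fun h => by rw [h, Nat.div_one], fun h => ?_⟩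
  exact (Nat.div_eq_self.1 h).resolve_left hn.ne'

lemma gens_sum_bound {a : ZMod p} (ha : a ≠ 0) :
    ‖∑ u ∈ gens p, psi p (a * u)‖ ≤ 2 ^ (p-1).primeFactors.card * Real.sqrt p := by
  classical
  have hn : 0 < p - 1 := Nat.sub_pos_of_lt hp.out.one_lt
  obtain ⟨g, hg'⟩ := IsCyclic.exists_generator (α := (ZMod p)ˣ)
  have hg : orderOf g = p - 1 := by rw [orderOf_eq_card_of_forall_mem_zpowers hg', card_units_p]
  have h1 : ∑ u ∈ gens p, psi p (a * u) = ∑ d ∈ (p-1).divisors, ((ArithmeticFunction.moebius d : ℤ) : ℂ) * etaH (Subgroup.zpowers (g ^ d)) a := by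
    unfold gens etaH
    rw [Finset.sum_filter]
    simp_rw [Finset.mul_sum, Finset.sum_filter]
    rw [Finset.sum_comm]
    refine Finset.sum_congr rfl fun u _ => ?_
    have h2 := congrArg (fun z : ℤ => (z : ℂ) * psi p (a * u)) (gen_ind hg hg' u)
    simp only [Int.cast_sum, Finset.sum_mul] at h2
    rw [Finset.sum_congr rfl (g := fun d => ((if u ∈ Subgroup.zpowers (g ^ d) then ArithmeticFunction.moebius d else 0 : ℤ) : ℂ) * psi p (a * u))]
    · rw [h2]; split_ifs <;> simp
    · intro d _
      split_ifs <;> simp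
  rw [h1, ← mob_abs hn.ne', Finset.sum_mul]
  refine (norm_sum_le _ _).trans (Finset.sum_le_sum fun d _ => ?_)
  rw [norm_mul, Complex.norm_intCast]
  gcongr
  exact eta_bound _ ha

open Classical in
lemma count_e {e : ℕ} (he : e ∣ p - 1) (N : ℕ) :
    |((∑ k ∈ Finset.Icc 1 N, ∑ u ∈ gens p, if ((e:ZMod p) * k = u) then 1 else 0 : ℕ) : ℝ) - N * (p-1).totient / p| ≤
      2 ^ (p-1).primeFactors.card * Real.sqrt p * (1 + Real.log p) := by
  have hn : 0 < p - 1 := Nat.sub_pos_of_lt hp.out.one_lt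
  have hp0 : (0:ℝ) < p := by exact_mod_cast hp.out.pos
  have hpC : (p:ℂ) ≠ 0 := by exact_mod_cast hp.out.ne_zero
  have he0 : (e : ZMod p) ≠ 0 := by
    rw [Ne, ZMod.natCast_eq_zero_iff]
    intro h
    have := Nat.le_of_dvd hn (h.trans he)
    omega
  set D : ZMod p → ℂ := fun a => ∑ k ∈ Finset.Icc 1 N, psi p (a * k) with hD
  set S : ZMod p → ℂ := fun a => ∑ u ∈ gens p, psi p (a * u) with hS
  have h1 : (p:ℂ) * ((∑ k ∈ Finset.Icc 1 N, ∑ u ∈ gens p, if ((e:ZMod p) * k = u) then 1 else 0 : ℕ) : ℂ)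
      = ∑ a : ZMod p, D (a * e) * S (-a) := by
    have h2 : ∀ a, D (a * e) * S (-a) = ∑ k ∈ Finset.Icc 1 N, ∑ u ∈ gens p, psi p (a * ((e:ZMod p) * k - u)) := by
      intro a
      rw [hD, hS]
      simp only
      rw [Finset.sum_mul_sum]
      refine Finset.sum_congr rfl fun k _ => Finset.sum_congr rfl fun u _ => ?_
      rw [← AddChar.map_add_eq_mul]; congr 1; ring
    simp_rw [h2]
    conv_rhs => rw [Finset.sum_comm]
    push_cast
    rw [Finset.mul_sum]
    refine Finset.sum_congr rfl fun k _ => ?_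
    conv_rhs => rw [Finset.sum_comm]
    rw [Finset.mul_sum]
    refine Finset.sum_congr rfl fun u _ => ?_
    rw [psi_sum]
    simp only [sub_eq_zero]
    split_ifs <;> simp
  have h3 : ∑ a : ZMod p, D (a * e) * S (-a) = N * (p-1).totient + ∑ a : ZMod p with a ≠ 0, D (a * e) * S (-a) := by
    rw [← Finset.sum_filter_add_sum_filter_not univ (fun a : ZMod p => a = 0)]
    congr 1
    rw [Finset.sum_filter, Finset.sum_ite_eq' univ (0 : ZMod p)]
    simp [hD, hS, gens_card]
  have h4 : ‖∑ a : ZMod p with a ≠ 0, D (a * e) * S (-a)‖ ≤ (p * (1 + Real.log p)) * (2 ^ (p-1).primeFactors.card * Real.sqrt p) := by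
    calc _ ≤ ∑ a : ZMod p with a ≠ 0, ‖D (a * e)‖ * (2 ^ (p-1).primeFactors.card * Real.sqrt p) := by
          refine (norm_sum_le _ _).trans (Finset.sum_le_sum fun a ha => ?_)
          rw [Finset.mem_filter] at ha
          rw [norm_mul]
          gcongr
          exact gens_sum_bound (neg_ne_zero.2 ha.2)
      _ = (∑ a : ZMod p with a ≠ 0, ‖D (a * e)‖) * (2 ^ (p-1).primeFactors.card * Real.sqrt p) := by rw [Finset.sum_mul]
      _ = (∑ a : ZMod p with a ≠ 0, ‖D a‖) * (2 ^ (p-1).primeFactors.card * Real.sqrt p) := by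
          congr 1
          refine Finset.sum_bij' (fun a _ => a * e) (fun a _ => a * (e : ZMod p)⁻¹) ?_ ?_ ?_ ?_ ?_
          · intro a ha; rw [Finset.mem_filter] at ha ⊢; exact ⟨Finset.mem_univ _, mul_ne_zero ha.2 he0⟩
          · intro a ha; rw [Finset.mem_filter] at ha ⊢; exact ⟨Finset.mem_univ _, mul_ne_zero ha.2 (inv_ne_zero he0)⟩
          · intro a _; field_simp
          · intro a _; field_simp
          · intros; rfl
      _ ≤ _ := by
          gcongr
          exact geo_sum N
  set c := (∑ k ∈ Finset.Icc 1 N, ∑ u ∈ gens p, if ((e:ZMod p) * k = u) then 1 else 0 : ℕ) with hc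
  have h5 : ‖((c - N * (p-1).totient / p : ℝ) : ℂ)‖ = ‖∑ a : ZMod p with a ≠ 0, D (a * e) * S (-a)‖ / p := by
    have : ((c - N * (p-1).totient / p : ℝ) : ℂ) = (∑ a : ZMod p with a ≠ 0, D (a * e) * S (-a)) / p := by
      rw [h3] at h1
      rw [← sub_eq_iff_eq_add'.2 h1]
      push_cast
      field_simp
    rw [this, norm_div, Complex.norm_natCast]
  rw [Complex.norm_real, Real.norm_eq_abs] at h5
  rw [h5, div_le_iff₀ hp0]
  linarith

end
end FixPt

namespace FixPt
open Complex MeasureTheory Finset Set Filter Topology DirichletCharacter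

open Classical in
noncomputable def Hset (p : ℕ) : Finset ℕ :=
  (Finset.Icc 1 (p-1)).filter fun h => IsPrimitiveRoot (h : ZMod p) (p-1) ∧ Nat.gcd h (p-1) = 1

section
variable {p : ℕ} [hp : Fact p.Prime]

lemma pr_unit (u : (ZMod p)ˣ) : IsPrimitiveRoot (u : ZMod p) (p-1) ↔ orderOf u = p - 1 := by
  rw [IsPrimitiveRoot.coe_units_iff]
  exact ⟨fun h => h.eq_orderOf.symm, fun h => h ▸ IsPrimitiveRoot.orderOf u⟩

open Classical in
lemma pr_ind (x : ZMod p) : (∑ u ∈ gens p, if x = u then 1 else 0 : ℕ) = if IsPrimitiveRoot x (p-1) then 1 else 0 := by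
  have hn : 0 < p - 1 := Nat.sub_pos_of_lt hp.out.one_lt
  split_ifs with h
  · obtain ⟨v, rfl⟩ := h.isUnit hn.ne'
    have hv := (pr_unit v).1 h
    simp_rw [Units.val_inj]
    rw [Finset.sum_ite_eq, if_pos]
    unfold gens
    rw [Finset.mem_filter]; exact ⟨Finset.mem_univ _, hv⟩
  · refine Finset.sum_eq_zero fun u hu => if_neg ?_
    rintro rfl
    unfold gens at hu
    rw [Finset.mem_filter] at hu
    exact h ((pr_unit u).2 hu.2)

open Classical in
lemma Hset_sum : ((Hset p).card : ℝ) = ∑ e ∈ (p-1).divisors, ((ArithmeticFunction.moebius e : ℤ) : ℝ) *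
    ((∑ k ∈ Finset.Icc 1 ((p-1)/e), ∑ u ∈ gens p, if ((e:ZMod p) * k = u) then 1 else 0 : ℕ) : ℝ) := by
  have hn : 0 < p - 1 := Nat.sub_pos_of_lt hp.out.one_lt
  have h1 : ((Hset p).card : ℤ) = ∑ h ∈ Finset.Icc 1 (p-1), (if IsPrimitiveRoot (h : ZMod p) (p-1) then 1 else 0) *
      ∑ d ∈ (p-1).divisors, (if d ∣ h then ArithmeticFunction.moebius d else 0) := by
    unfold Hset
    rw [Finset.card_filter]
    push_cast
    refine Finset.sum_congr rfl fun h _ => ?_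
    rw [mob_gcd hn.ne']
    split_ifs <;> simp_all
  have h2 : ((Hset p).card : ℤ) = ∑ e ∈ (p-1).divisors, (ArithmeticFunction.moebius e : ℤ) *
    ((∑ k ∈ Finset.Icc 1 ((p-1)/e), ∑ u ∈ gens p, if ((e:ZMod p) * k = u) then 1 else 0 : ℕ) : ℤ) := by
    rw [h1]
    simp_rw [Finset.mul_sum]
    rw [Finset.sum_comm]
    refine Finset.sum_congr rfl fun e he => ?_
    have he' := Nat.dvd_of_mem_divisors he
    have he0 : 0 < e := Nat.pos_of_dvd_of_pos he' hn
    simp_rw [pr_ind]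
    push_cast
    rw [Finset.mul_sum]
    simp_rw [mul_ite, mul_zero]
    rw [← Finset.sum_filter]
    symm
    refine Finset.sum_bij (fun k _ => e * k) ?_ ?_ ?_ ?_
    · intro k hk
      rw [Finset.mem_Icc] at hk
      rw [Finset.mem_filter, Finset.mem_Icc]
      refine ⟨⟨Nat.mul_pos he0 hk.1, ?_⟩, Dvd.intro _ rfl⟩
      rw [mul_comm]
      exact (Nat.le_div_iff_mul_le he0).1 hk.2
    · intro a _ b _ h
      exact Nat.eq_of_mul_eq_mul_left he0 h
    · intro h hh
      rw [Finset.mem_filter, Finset.mem_Icc] at hh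
      obtain ⟨⟨h1, h2⟩, k, rfl⟩ := hh
      refine ⟨k, ?_, rfl⟩
      rw [Finset.mem_Icc, Nat.le_div_iff_mul_le he0, mul_comm k]
      exact ⟨Nat.pos_of_mul_pos_left h1, h2⟩
    · intro k _
      push_cast
      split_ifs <;> simp
  have h3 := congrArg (fun z : ℤ => (z : ℝ)) h2
  push_cast at h3 ⊢
  exact h3

lemma Hset_est : |((Hset p).card : ℝ) - ((p-1).totient : ℝ)^2 / ((p-1:ℕ):ℝ)| ≤
    4 ^ (p-1).primeFactors.card * Real.sqrt p * (1 + Real.log p) + 1 := by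
  classical
  have hn : 0 < p - 1 := Nat.sub_pos_of_lt hp.out.one_lt
  have hp0 : (0:ℝ) < p := by exact_mod_cast hp.out.pos
  have hn0 : (0:ℝ) < ((p-1:ℕ):ℝ) := by exact_mod_cast hn
  have hpn : (p:ℝ) = ((p-1:ℕ):ℝ) + 1 := by
    have : p = (p - 1) + 1 := by omega
    exact_mod_cast this
  have h1 : |((Hset p).card : ℝ) - ((p-1).totient : ℝ)^2 / p| ≤ 4 ^ (p-1).primeFactors.card * Real.sqrt p * (1 + Real.log p) := by
    have e1 : ((p-1).totient : ℝ)^2 / p = ∑ e ∈ (p-1).divisors, ((ArithmeticFunction.moebius e : ℤ) : ℝ) * (((p-1)/e : ℕ) * (p-1).totient / p) := by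
      rw [sq, mul_div_assoc]
      nth_rewrite 1 [← tot_mob hn.ne']
      rw [Finset.sum_mul]
      refine Finset.sum_congr rfl fun e _ => ?_
      ring
    rw [Hset_sum, e1, ← Finset.sum_sub_distrib]
    calc _ ≤ ∑ e ∈ (p-1).divisors, |((ArithmeticFunction.moebius e : ℤ) : ℝ)| * (2 ^ (p-1).primeFactors.card * Real.sqrt p * (1 + Real.log p)) := by
          refine (Finset.abs_sum_le_sum_abs _ _).trans (Finset.sum_le_sum fun e he => ?_)
          rw [← mul_sub, abs_mul]
          gcongr
          exact count_e (Nat.dvd_of_mem_divisors he) _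
      _ = _ := by
          rw [← Finset.sum_mul, mob_abs hn.ne', show (4:ℝ) = 2 * 2 by norm_num, mul_pow]; ring
  have h2 : |((p-1).totient : ℝ)^2 / p - ((p-1).totient : ℝ)^2 / ((p-1:ℕ):ℝ)| ≤ 1 := by
    have h3 : ((p-1).totient : ℝ) ≤ ((p-1:ℕ):ℝ) := by exact_mod_cast Nat.totient_le _
    have h4 : (0:ℝ) ≤ ((p-1).totient : ℝ) := by positivity
    have e : ((p-1).totient : ℝ)^2 / p - ((p-1).totient : ℝ)^2 / ((p-1:ℕ):ℝ) = - (((p-1).totient : ℝ)^2 / (p * ((p-1:ℕ):ℝ))) := by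
      rw [hpn]; field_simp; ring
    rw [e, abs_neg, abs_of_nonneg (by positivity), div_le_one (by positivity), hpn]
    nlinarith
  calc _ ≤ |((Hset p).card : ℝ) - ((p-1).totient : ℝ)^2 / p| + |((p-1).totient : ℝ)^2 / p - ((p-1).totient : ℝ)^2 / ((p-1:ℕ):ℝ)| := abs_sub_le _ _ _
    _ ≤ _ := by linarith

lemma F_eq : Nat.card {gh : ℕ × ℕ // 1 ≤ gh.1 ∧ gh.1 ≤ p - 1 ∧ 1 ≤ gh.2 ∧ gh.2 ≤ p - 1 ∧
              gh.1 ^ gh.2 ≡ gh.2 [MOD p] ∧ IsPrimitiveRoot (gh.1 : ZMod p) (p - 1) ∧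
              IsPrimitiveRoot (gh.2 : ZMod p) (p - 1) ∧ Nat.gcd gh.2 (p - 1) = 1} = (Hset p).card := by
  classical
  have hn : 0 < p - 1 := Nat.sub_pos_of_lt hp.out.one_lt
  have hcard : (Hset p).card = Nat.card ((Hset p : Set ℕ)) := by simp
  rw [hcard]
  refine Nat.card_congr (Equiv.ofBijective (fun gh => ⟨gh.1.2, ?_⟩) ⟨?_, ?_⟩)
  · obtain ⟨⟨g, h⟩, h1, h2, h3, h4, h5, h6, h7, h8⟩ := gh
    simp only [Hset, Finset.coe_filter, Finset.mem_Icc]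
    exact ⟨⟨h3, h4⟩, h7, h8⟩
  · rintro ⟨⟨g, h⟩, h1, h2, h3, h4, h5, h6, h7, h8⟩ ⟨⟨g', h'⟩, h1', h2', h3', h4', h5', h6', h7', h8'⟩ hh
    simp only [Subtype.mk.injEq] at hh
    subst hh
    obtain ⟨u, hu⟩ := h6.isUnit hn.ne'
    obtain ⟨v, hv⟩ := h6'.isUnit hn.ne'
    rw [← ZMod.natCast_eq_natCast_iff] at h5 h5'
    push_cast at h5 h5'
    rw [← hu] at h5
    rw [← hv] at h5'
    have e1 : u ^ h = v ^ h := by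
      apply Units.ext; push_cast; rw [h5, h5']
    have hco : (Nat.card (ZMod p)ˣ).Coprime h := by rw [card_units_p]; exact (Nat.coprime_comm.1 h8)
    have e2 : u = v := (powCoprime hco).injective e1
    have e3 : (g : ZMod p) = g' := by rw [← hu, ← hv, e2]
    rw [ZMod.natCast_eq_natCast_iff] at e3
    have := e3.eq_of_lt_of_lt (by omega) (by omega)
    subst this; rfl
  · rintro ⟨h, hh⟩
    simp only [Hset, Finset.coe_filter, Finset.mem_Icc] at hh
    obtain ⟨⟨h3, h4⟩, h7, h8⟩ := hh
    have hco : (Nat.card (ZMod p)ˣ).Coprime h := by rw [card_units_p]; exact (Nat.coprime_comm.1 h8)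
    obtain ⟨w, hw⟩ := h7.isUnit hn.ne'
    obtain ⟨u, hu⟩ := (powCoprime hco).surjective w
    have hu' : u ^ h = w := hu
    have hwo : orderOf w = p - 1 := (pr_unit w).1 (by rw [hw]; exact h7)
    have huo : orderOf u = p - 1 := by
      refine Nat.dvd_antisymm ?_ ?_
      · rw [← card_units_p]; exact orderOf_dvd_natCard u
      · rw [← hwo, ← hu']; exact orderOf_pow_dvd h
    have hv : ((u : ZMod p).val : ZMod p) = u := ZMod.natCast_zmod_val _
    refine ⟨⟨((u : ZMod p).val, h), ?_, ?_, h3, h4, ?_, ?_, h7, h8⟩, rfl⟩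
    · simp only
      have : (u : ZMod p).val ≠ 0 := by rw [Ne, ZMod.val_eq_zero]; exact u.ne_zero
      omega
    · simp only
      have := ZMod.val_lt (u : ZMod p)
      omega
    · simp only
      rw [← ZMod.natCast_eq_natCast_iff]
      push_cast
      rw [← hw, ← hu', ZMod.natCast_zmod_val]; push_cast; rfl
    · simp only
      rw [hv]; exact (pr_unit u).2 huo

end
end FixPt

namespace FixPt
open Complex MeasureTheory Finset Set Filter Topology DirichletCharacter

noncomputable def FF (p : ℕ) : ℝ := (Nat.card {gh : ℕ × ℕ // 1 ≤ gh.1 ∧ gh.1 ≤ p - 1 ∧ 1 ≤ gh.2 ∧ gh.2 ≤ p - 1 ∧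
              gh.1 ^ gh.2 ≡ gh.2 [MOD p] ∧ IsPrimitiveRoot (gh.1 : ZMod p) (p - 1) ∧
              IsPrimitiveRoot (gh.2 : ZMod p) (p - 1) ∧ Nat.gcd gh.2 (p - 1) = 1} : ℝ) / ((p - 1 : ℕ) : ℝ)

lemma F_near : ∃ K : ℝ, 1 ≤ K ∧ ∀ p : ℕ, p.Prime →
    |FF p - (((p-1).totient : ℝ) / ((p - 1 : ℕ):ℝ)) ^ 2| ≤ K * (p:ℝ) ^ (-(1/4) : ℝ) := by
  obtain ⟨C, hC, h⟩ := omega_bound 4 (1/8) (by norm_num) (by norm_num)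
  refine ⟨20 * C, by linarith, fun p hp => ?_⟩
  haveI : Fact p.Prime := ⟨hp⟩
  have hn : 0 < p - 1 := Nat.sub_pos_of_lt hp.one_lt
  have hn0 : (0:ℝ) < ((p-1:ℕ):ℝ) := by exact_mod_cast hn
  have hp0 : (0:ℝ) < p := by exact_mod_cast hp.pos
  have hp1 : (1:ℝ) ≤ p := by exact_mod_cast hp.one_lt.le
  have hnp : ((p-1:ℕ):ℝ) ≤ p := by exact_mod_cast Nat.sub_le _ _
  have hpn : (p:ℝ) / 2 ≤ ((p-1:ℕ):ℝ) := by
    have h2 := hp.two_le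
    have : (p:ℝ) ≤ 2 * ((p-1:ℕ):ℝ) := by exact_mod_cast (by omega : p ≤ 2 * (p-1))
    linarith
  have e1 : FF p - (((p-1).totient : ℝ) / ((p - 1 : ℕ):ℝ)) ^ 2 = (((Hset p).card : ℝ) - ((p-1).totient : ℝ)^2 / ((p-1:ℕ):ℝ)) / ((p-1:ℕ):ℝ) := by
    unfold FF
    rw [F_eq]; field_simp
  rw [e1, abs_div, abs_of_pos hn0]
  have h1 : (4:ℝ) ^ (p-1).primeFactors.card ≤ C * (p:ℝ) ^ (1/8 : ℝ) :=
    (h (p-1) hn.ne').trans (by gcongr)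
  have hlog0 := Real.log_nonneg hp1
  have h2 : 1 + Real.log p ≤ 9 * (p:ℝ) ^ (1/8 : ℝ) := by
    have h3 := Real.log_le_rpow_div hp0.le (ε := 1/8) (by norm_num)
    have h4 : 1 ≤ (p:ℝ) ^ (1/8 : ℝ) := Real.one_le_rpow hp1 (by norm_num)
    linarith
  have h5 : 1 ≤ (p:ℝ) ^ (3/4 : ℝ) := Real.one_le_rpow hp1 (by norm_num)
  have h6 : |((Hset p).card : ℝ) - ((p-1).totient : ℝ)^2 / ((p-1:ℕ):ℝ)| ≤ 10 * C * (p:ℝ) ^ (3/4 : ℝ) := by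
    refine Hset_est.trans ?_
    have h7 : (4:ℝ) ^ (p-1).primeFactors.card * Real.sqrt p * (1 + Real.log p) ≤ 9 * C * (p:ℝ) ^ (3/4 : ℝ) := by
      calc _ ≤ (C * (p:ℝ) ^ (1/8 : ℝ)) * (p:ℝ) ^ (1/2 : ℝ) * (9 * (p:ℝ) ^ (1/8 : ℝ)) := by
            rw [Real.sqrt_eq_rpow]; gcongr
        _ = 9 * C * ((p:ℝ) ^ (1/8 : ℝ) * (p:ℝ) ^ (1/2 : ℝ) * (p:ℝ) ^ (1/8 : ℝ)) := by ring
        _ = _ := by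
            rw [← Real.rpow_add hp0, ← Real.rpow_add hp0]; norm_num
    nlinarith
  calc _ ≤ 10 * C * (p:ℝ) ^ (3/4 : ℝ) / ((p:ℝ) / 2) := by gcongr
    _ = 20 * C * ((p:ℝ) ^ (3/4 : ℝ) / p) := by ring
    _ = _ := by
      rw [← Real.rpow_sub_one hp0.ne']; norm_num

lemma pow_sum_bd {x : ℝ} (hx : 9 ≤ x) : ∑ p ∈ PP x, (p:ℝ) ^ (-(1/4) : ℝ) ≤ 2 * x ^ (7/8 : ℝ) := by
  have hx0 : 0 < x := by linarith
  have h1 : ∀ p ∈ PP x, (p:ℝ) ^ (-(1/4) : ℝ) ≤ (if (p:ℝ) ≤ x ^ (1/2:ℝ) then 1 else 0) + x ^ (-(1/8) : ℝ) := by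
    intro p hp
    unfold PP at hp
    rw [Finset.mem_filter] at hp
    have hp1 : (1:ℝ) ≤ p := by exact_mod_cast hp.2.one_lt.le
    split_ifs with h
    · have := Real.rpow_le_one_of_one_le_of_nonpos hp1 (show (-(1/4) : ℝ) ≤ 0 by norm_num)
      have : 0 < x ^ (-(1/8) : ℝ) := by positivity
      linarith
    · push Not at h
      rw [zero_add]
      calc (p:ℝ) ^ (-(1/4) : ℝ) ≤ (x ^ (1/2:ℝ)) ^ (-(1/4) : ℝ) := 
            Real.rpow_le_rpow_of_nonpos (by positivity) h.le (by norm_num)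
        _ = _ := by rw [← Real.rpow_mul hx0.le]; norm_num
  have h2 : (((PP x).filter (fun p : ℕ => (p:ℝ) ≤ x ^ (1/2:ℝ))).card : ℝ) ≤ x ^ (7/8 : ℝ) := by
    have h3 : ((PP x).filter (fun p : ℕ => (p:ℝ) ≤ x ^ (1/2:ℝ))).card ≤ (Finset.Icc 1 ⌊x ^ (1/2:ℝ)⌋₊).card := by
      refine Finset.card_le_card fun p hp => ?_
      unfold PP at hp
      rw [Finset.mem_filter, Finset.mem_filter] at hp
      rw [Finset.mem_Icc]
      exact ⟨hp.1.2.one_lt.le, Nat.le_floor hp.2⟩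
    rw [Nat.card_Icc, Nat.add_sub_cancel] at h3
    calc (((PP x).filter (fun p : ℕ => (p:ℝ) ≤ x ^ (1/2:ℝ))).card : ℝ) ≤ (⌊x ^ (1/2:ℝ)⌋₊ : ℝ) := by exact_mod_cast h3
      _ ≤ x ^ (1/2:ℝ) := Nat.floor_le (by positivity)
      _ ≤ _ := Real.rpow_le_rpow_of_exponent_le (by linarith) (by norm_num)
  have h4 : ((PP x).card : ℝ) ≤ x := by
    have h3 : (PP x).card ≤ (Finset.Icc 1 ⌊x⌋₊).card := by
      refine Finset.card_le_card fun p hp => ?_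
      unfold PP at hp
      rw [Finset.mem_filter, Finset.mem_Iic] at hp
      rw [Finset.mem_Icc]
      exact ⟨hp.2.one_lt.le, hp.1⟩
    rw [Nat.card_Icc, Nat.add_sub_cancel] at h3
    calc ((PP x).card : ℝ) ≤ (⌊x⌋₊ : ℝ) := by exact_mod_cast h3
      _ ≤ x := Nat.floor_le (by positivity)
  refine (Finset.sum_le_sum h1).trans ?_
  rw [Finset.sum_add_distrib, Finset.sum_boole, Finset.sum_const, nsmul_eq_mul]
  have h5 : ((PP x).card : ℝ) * x ^ (-(1/8) : ℝ) ≤ x ^ (7/8 : ℝ) := by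
    calc _ ≤ x ^ (1:ℝ) * x ^ (-(1/8) : ℝ) := by rw [Real.rpow_one]; gcongr
      _ = _ := by rw [← Real.rpow_add hx0]; norm_num
  linarith

lemma seven_eighths (r : ℕ) : ∃ K : ℝ, 1 ≤ K ∧ ∀ x : ℝ, 9 ≤ x → x ^ (7/8 : ℝ) ≤ K * x / Real.log x ^ r := by
  obtain ⟨C, hC, h⟩ := log_pow_le (4 * r)
  refine ⟨C, hC, fun x hx => ?_⟩
  have hx0 : 0 < x := by linarith
  have hL : 1 < Real.log x := log3 (by linarith)
  have h1 : Real.log x ^ r ≤ C * x ^ (1/8 : ℝ) := by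
    refine le_of_pow_le_pow_left₀ (n := 4) (by norm_num) (by positivity) ?_
    calc (Real.log x ^ r) ^ 4 = Real.log x ^ (4 * r) := by rw [← pow_mul, mul_comm]
      _ ≤ C * x ^ (1/2 : ℝ) := h x (by linarith)
      _ ≤ C ^ 4 * x ^ (1/2 : ℝ) := by gcongr; exact le_self_pow₀ hC (by norm_num)
      _ = _ := by
        rw [mul_pow]; congr 1
        rw [← Real.rpow_natCast, ← Real.rpow_mul hx0.le]; norm_num
  rw [le_div_iff₀ (by positivity)]
  calc x ^ (7/8 : ℝ) * Real.log x ^ r ≤ x ^ (7/8 : ℝ) * (C * x ^ (1/8 : ℝ)) := by gcongr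
    _ = C * (x ^ (7/8 : ℝ) * x ^ (1/8 : ℝ)) := by ring
    _ = _ := by rw [← Real.rpow_add hx0]; norm_num

lemma large_x (r : ℕ) : ∃ K : ℝ, 1 ≤ K ∧ ∀ x : ℝ, 9 ≤ x →
    |∑ p ∈ PP x, FF p - (∏' p : Nat.Primes, (1 + ((1 - 1 / ((p : ℕ) : ℝ)) ^ 2 - 1) / (((p : ℕ) : ℝ) - 1))) * Li x| ≤ K * x / Real.log x ^ r := by
  obtain ⟨K1, hK1, h1⟩ := phi_avg r
  obtain ⟨K2, hK2, h2⟩ := F_near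
  obtain ⟨K3, hK3, h3⟩ := seven_eighths r
  refine ⟨K1 + K2 * 2 * K3, by nlinarith, fun x hx => ?_⟩
  have hL : 1 < Real.log x := log3 (by linarith)
  have h4 : |∑ p ∈ PP x, FF p - ∑ p ∈ PP x, (((p-1).totient : ℝ) / ((p - 1 : ℕ):ℝ)) ^ 2| ≤ K2 * (2 * (K3 * x / Real.log x ^ r)) := by
    rw [← Finset.sum_sub_distrib]
    refine (Finset.abs_sum_le_sum_abs _ _).trans ?_
    calc _ ≤ ∑ p ∈ PP x, K2 * (p:ℝ) ^ (-(1/4) : ℝ) := by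
          refine Finset.sum_le_sum fun p hp => h2 p ?_
          unfold PP at hp
          exact (Finset.mem_filter.1 hp).2
      _ = K2 * ∑ p ∈ PP x, (p:ℝ) ^ (-(1/4) : ℝ) := by rw [Finset.mul_sum]
      _ ≤ K2 * (2 * x ^ (7/8 : ℝ)) := by gcongr; exact pow_sum_bd hx
      _ ≤ _ := by gcongr; exact h3 x hx
  refine (abs_sub_le _ (∑ p ∈ PP x, (((p-1).totient : ℝ) / ((p - 1 : ℕ):ℝ)) ^ 2) _).trans ?_
  refine (add_le_add h4 (h1 x hx)).trans (le_of_eq ?_)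
  ring

theorem main_thm (C : ℝ) (hC : 0 < C) : ∃ K : ℝ, ∀ x : ℝ, 2 ≤ x →
    |∑ p ∈ PP x, FF p - (∏' p : Nat.Primes, (1 + ((1 - 1 / ((p : ℕ) : ℝ)) ^ 2 - 1) / (((p : ℕ) : ℝ) - 1))) * Li x| ≤ K * x / Real.log x ^ C := by
  obtain ⟨K1, hK1, h1⟩ := large_x ⌈C⌉₊
  set A := ∏' p : Nat.Primes, (1 + ((1 - 1 / ((p : ℕ) : ℝ)) ^ 2 - 1) / (((p : ℕ) : ℝ) - 1)) with hA
  have hF0 : ∀ p, 0 ≤ FF p := fun p => by unfold FF; positivity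
  set S := ∑ p ∈ PP 9, FF p with hS
  have hS0 : 0 ≤ S := Finset.sum_nonneg fun p _ => hF0 p
  have hL9 : 1 < Real.log 9 := log3 (by norm_num)
  set K0 := (S + |A| * 18) * Real.log 9 ^ C with hK0
  have hK00 : 0 ≤ K0 := by positivity
  refine ⟨K1 + K0, fun x hx => ?_⟩
  have hlog : 0 < Real.log x := Real.log_pos (by linarith)
  by_cases h9 : 9 ≤ x
  · have hL : 1 < Real.log x := log3 (by linarith)
    refine (h1 x h9).trans ?_
    have : Real.log x ^ C ≤ Real.log x ^ ⌈C⌉₊ := by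
      rw [← Real.rpow_natCast]
      exact Real.rpow_le_rpow_of_exponent_le hL.le (Nat.le_ceil C)
    gcongr
    linarith
  · push Not at h9
    obtain ⟨hl0, hl⟩ := Li_bd hx
    have hs : ∑ p ∈ PP x, FF p ≤ S := by
      refine Finset.sum_le_sum_of_subset_of_nonneg ?_ fun p _ _ => hF0 p
      intro p hp
      unfold PP at hp ⊢
      rw [Finset.mem_filter, Finset.mem_Iic] at hp ⊢
      exact ⟨hp.1.trans (Nat.floor_le_floor h9.le), hp.2⟩
    have hs0 : 0 ≤ ∑ p ∈ PP x, FF p := Finset.sum_nonneg fun p _ => hF0 p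
    have hl9 : Real.log x ^ C ≤ Real.log 9 ^ C := by
      gcongr
    calc _ ≤ |∑ p ∈ PP x, FF p| + |A * Li x| := abs_sub _ _
      _ ≤ S + |A| * 18 := by
          rw [abs_of_nonneg hs0, abs_mul, abs_of_nonneg hl0]
          gcongr
          linarith
      _ = K0 * 1 / Real.log 9 ^ C := by
          rw [hK0]; field_simp
      _ ≤ (K1 + K0) * x / Real.log x ^ C := by
          gcongr <;> linarith

end FixPt

theorem averaged_fixed_points_gPR_hRPPR (C : ℝ) (hC : 0 < C) :
    ∃ K : ℝ, ∀ x : ℝ, 2 ≤ x →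
      |(∑ p ∈ Finset.filter Nat.Prime (Finset.Iic ⌊x⌋₊),
          (Nat.card {gh : ℕ × ℕ // 1 ≤ gh.1 ∧ gh.1 ≤ p - 1 ∧ 1 ≤ gh.2 ∧ gh.2 ≤ p - 1 ∧
              gh.1 ^ gh.2 ≡ gh.2 [MOD p] ∧ IsPrimitiveRoot (gh.1 : ZMod p) (p - 1) ∧
              IsPrimitiveRoot (gh.2 : ZMod p) (p - 1) ∧ Nat.gcd gh.2 (p - 1) = 1} : ℝ) / ((p - 1 : ℕ) : ℝ)) -
        (∏' p : Nat.Primes, (1 + ((1 - 1 / ((p : ℕ) : ℝ)) ^ 2 - 1) / (((p : ℕ) : ℝ) - 1))) *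
          ∫ t in (2 : ℝ)..x, 1 / Real.log t| ≤ K * x / Real.log x ^ C :=
  FixPt.main_thm C hC
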